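/- arXiv:2401.08306 — 2 statements merged into one kernel-verified Lean document; each statement's English description precedes it below -/
import Mathlib

section
/- Let F be a discretely valued Henselian field with perfect residue field, l a positive integer, and E/F a finitely ramified, at most l-ramified separable extension. Then ψ_{E/F}(l) is an integer; moreover, if E/F is finite, then ψ_{E/F}(l) = e(E/F)·(l + 1) − val_E(𝔡_{E/F}) − 1, where 𝔡_{E/F} is the different of E/F and val_E is the normalized valuation of E. -/
noncomputable section

open scoped Classical

/-- An additive `ℝ ∪ {⊤}`-valued valuation on a field `Ω`. -/
structure AddVal (Ω : Type*) [Field Ω] where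
  v : Ω → WithTop ℝ
  v_zero : v 0 = ⊤
  v_ne_top : ∀ x : Ω, x ≠ 0 → v x ≠ ⊤
  v_mul : ∀ x y : Ω, v (x * y) = v x + v y
  v_min_le_add : ∀ x y : Ω, min (v x) (v y) ≤ v (x + y)

namespace AddVal

variable {Ω : Type*} [Field Ω]

/-- `V` is normalized on `F`: its value group on `F^×` is exactly `ℤ`.
This encodes that `F` is a discretely valued field and `V` extends the
normalized discrete valuation `val_F` of `F`. -/
def IsNormalizedOn (V : AddVal Ω) (F : Type*) [Field F] [Algebra F Ω] : Prop :=
  (∀ x : F, x ≠ 0 → ∃ k : ℤ, V.v (algebraMap F Ω x) = ((k : ℝ) : WithTop ℝ)) ∧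
    (∃ x : F, V.v (algebraMap F Ω x) = ((1 : ℝ) : WithTop ℝ))

/-- Henselian property of the valued field `(F, val_F)` (simple-root Hensel lemma). -/
def IsHenselianOn (V : AddVal Ω) (F : Type*) [Field F] [Algebra F Ω] : Prop :=
  ∀ f : Polynomial F,
    (∀ i : ℕ, 0 ≤ V.v (algebraMap F Ω (f.coeff i))) →
      ∀ a₀ : F, 0 ≤ V.v (algebraMap F Ω a₀) →
        0 < V.v (algebraMap F Ω (Polynomial.eval a₀ f)) →
        V.v (algebraMap F Ω (Polynomial.eval a₀ (Polynomial.derivative f))) = 0 →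
        ∃ a : F, Polynomial.eval a f = 0 ∧ 0 < V.v (algebraMap F Ω (a - a₀))

/-- The residue field of `(F, val_F)` is perfect: in positive residue characteristic `p`,
the Frobenius is surjective on the residue field. -/
def HasPerfectResidueFieldOn (V : AddVal Ω) (F : Type*) [Field F] [Algebra F Ω] : Prop :=
  ∀ p : ℕ, p.Prime → 0 < V.v (algebraMap F Ω (p : F)) →
    ∀ x : F, 0 ≤ V.v (algebraMap F Ω x) →
      ∃ y : F, 0 ≤ V.v (algebraMap F Ω y) ∧ 0 < V.v (algebraMap F Ω (x - y ^ p))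

/-- `e` is the (absolute) ramification index of `E` over the field on which `V` is
normalized: the value group of `E^×` is exactly `(1/e)ℤ`.  In particular `E` is
finitely ramified. -/
def IsRamIdx (V : AddVal Ω) {K : Type*} [Field K] [Algebra K Ω]
    (E : IntermediateField K Ω) (e : ℕ) : Prop :=
  0 < e ∧
    (∀ x : ↥E, x ≠ 0 → ∃ k : ℤ, V.v (x : Ω) = ((((k : ℝ) / (e : ℝ) : ℝ)) : WithTop ℝ)) ∧
    (∃ x : ↥E, V.v (x : Ω) = (((1 / (e : ℝ) : ℝ)) : WithTop ℝ))

end AddVal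

/-- The lower ramification relation `Ξ_r` on `K`-algebra embeddings of `E` into `Ω`,
where `e` is the absolute ramification index of `E` (over the normalization field of `V`):
`σ Ξ_r τ` iff `val_M (σ x - τ x) ≥ e(M/E) (r+1)` for all integral `x` and any (equivalently
some) suitable Galois `M`; this is equivalent to `V.v (σ x - τ x) ≥ (r+1)/e` for all
integral `x`. -/
def xiRel {Ω : Type*} [Field Ω] (V : AddVal Ω) {K : Type*} [Field K] [Algebra K Ω]
    (E : IntermediateField K Ω) (e : ℕ) (r : ℝ) (σ τ : ↥E →ₐ[K] Ω) : Prop :=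
  ∀ x : ↥E, 0 ≤ V.v (x : Ω) →
    ((((r + 1) / (e : ℝ) : ℝ)) : WithTop ℝ) ≤ V.v (σ x - τ x)

/-- `g_t`: the (common) cardinality of a `Ξ_t`-equivalence class, realized as the
cardinality of the class of the inclusion `E ↪ Ω`. -/
def gfun {Ω : Type*} [Field Ω] (V : AddVal Ω) {K : Type*} [Field K] [Algebra K Ω]
    (E : IntermediateField K Ω) (e : ℕ) (t : ℝ) : ℕ :=
  Nat.card {σ : ↥E →ₐ[K] Ω // xiRel V E e t σ E.val}

/-- The Herbrand function `φ_{E/K}(r) = ∫_0^r (g_t / g_0) dt`. -/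
def herbrand {Ω : Type*} [Field Ω] (V : AddVal Ω) {K : Type*} [Field K] [Algebra K Ω]
    (E : IntermediateField K Ω) (e : ℕ) (r : ℝ) : ℝ :=
  ∫ t in (0:ℝ)..r, ((gfun V E e t : ℝ) / (gfun V E e 0 : ℝ))

/-- `E/K` is at most `l`-ramified: for every finite subextension `E₀/K` the relation
`Ξ^l = Ξ_{ψ_{E₀/K}(l)}` is trivial. -/
def atMostRamified {Ω : Type*} [Field Ω] (V : AddVal Ω) {K : Type*} [Field K] [Algebra K Ω]
    (E : IntermediateField K Ω) (l : ℝ) : Prop :=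
  ∀ E₀ : IntermediateField K Ω, E₀ ≤ E → FiniteDimensional K ↥E₀ →
    ∀ (e₀ : ℕ) (s : ℝ), V.IsRamIdx E₀ e₀ → 0 ≤ s → herbrand V E₀ e₀ s = l →
      ∀ σ τ : ↥E₀ →ₐ[K] Ω, xiRel V E₀ e₀ s σ τ → σ = τ

/-- Membership of `γ ∈ Γ_K` in the upper ramification subgroup `I_K^l`: for every
finite Galois subextension `M/K` (with ramification index `eM` and `ψ_{M/K}(l) = sM`),
the image of `γ` in `Gal(M/K)` lies in `Gal(M/K)^l = Gal(M/K)_{ψ_{M/K}(l)}`. -/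
def inUpperRam {Ω : Type*} [Field Ω] (V : AddVal Ω) {K : Type*} [Field K] [Algebra K Ω]
    (l : ℝ) (γ : Ω ≃ₐ[K] Ω) : Prop :=
  ∀ (M : IntermediateField K Ω) (eM : ℕ) (sM : ℝ),
    FiniteDimensional K ↥M → IsGalois K ↥M → V.IsRamIdx M eM → 0 ≤ sM →
      herbrand V M eM sM = l →
      xiRel V M eM sM (γ.toAlgHom.comp M.val) M.val

section

open Polynomial

/-- The strictly decreasing map `r ↦ exp (-r)`, extended by `⊤ ↦ 0`. -/
def expNeg (a : WithTop ℝ) : ℝ := WithTop.recTopCoe 0 (fun r : ℝ => Real.exp (-r)) a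

@[simp] lemma expNeg_top : expNeg ⊤ = 0 := rfl

@[simp] lemma expNeg_coe (r : ℝ) : expNeg (r : WithTop ℝ) = Real.exp (-r) := rfl

lemma expNeg_nonneg (a : WithTop ℝ) : 0 ≤ expNeg a := by
  induction a with
  | top => simp
  | coe r => simpa using (Real.exp_pos _).le

lemma expNeg_strictAnti : StrictAnti expNeg := by
  intro a b h
  induction b with
  | top =>
    induction a with
    | top => exact absurd h (lt_irrefl _)
    | coe r => simpa using Real.exp_pos _
  | coe s =>
    induction a with
    | top => exact absurd h (by simp)
    | coe r => simpa using h

lemma expNeg_zero : expNeg 0 = 1 := by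
  rw [← WithTop.coe_zero, expNeg_coe]; simp

lemma expNeg_add (a b : WithTop ℝ) : expNeg (a + b) = expNeg a * expNeg b := by
  induction a with
  | top => simp
  | coe r =>
    induction b with
    | top => simp
    | coe s => rw [← WithTop.coe_add, expNeg_coe, expNeg_coe, expNeg_coe, neg_add, Real.exp_add]

namespace AddValuation

variable {R : Type*} [Field R] (u : AddValuation R (WithTop ℝ))

/-- The absolute value `exp (-u)` attached to a real-valued additive valuation. -/
def toAbsVal : AbsoluteValue R ℝ where
  toFun x := expNeg (u x)
  map_mul' x y := by rw [map_mul, expNeg_add]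
  nonneg' x := expNeg_nonneg _
  eq_zero' x := by
    rw [← expNeg_top, expNeg_strictAnti.injective.eq_iff, top_iff]
  add_le' x y := by
    have h := expNeg_strictAnti.antitone (u.map_add x y)
    refine h.trans ?_
    rcases min_choice (u x) (u y) with h | h <;> rw [h]
    · linarith [expNeg_nonneg (u y)]
    · linarith [expNeg_nonneg (u x)]

lemma toAbsVal_apply (x : R) : u.toAbsVal x = expNeg (u x) := rfl

lemma toAbsVal_lt_one {x : R} : u.toAbsVal x < 1 ↔ 0 < u x := by
  rw [toAbsVal_apply, ← expNeg_zero, expNeg_strictAnti.lt_iff_gt]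

lemma one_lt_toAbsVal {x : R} : 1 < u.toAbsVal x ↔ u x < 0 := by
  rw [toAbsVal_apply, ← expNeg_zero, expNeg_strictAnti.lt_iff_gt]

lemma toAbsVal_eq_iff {u u' : AddValuation R (WithTop ℝ)} :
    u.toAbsVal = u'.toAbsVal ↔ ∀ x, u x = u' x := by
  refine ⟨fun h x => expNeg_strictAnti.injective (DFunLike.congr_fun h x), fun h => ?_⟩
  ext x
  rw [toAbsVal_apply, toAbsVal_apply, h]

lemma toAbsVal_isNontrivial {x : R} (hx : u x = (1 : ℝ)) : u.toAbsVal.IsNontrivial := by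
  refine ⟨x, fun h => ?_, ?_⟩
  · rw [h, u.map_zero] at hx; exact WithTop.coe_ne_top hx.symm
  · rw [toAbsVal_apply, hx, expNeg_coe]; simp

lemma eq_of_toAbsVal_isEquiv {u u' : AddValuation R (WithTop ℝ)} {x : R} (hx : u x = (1 : ℝ))
    (hx' : u' x = (1 : ℝ)) (h : u.toAbsVal.IsEquiv u'.toAbsVal) :
    u.toAbsVal = u'.toAbsVal := by
  obtain ⟨c, hc, h⟩ := AbsoluteValue.isEquiv_iff_exists_rpow_eq.1 h
  have h1 := congrFun h x
  simp only [toAbsVal_apply, hx, hx', expNeg_coe] at h1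
  rw [← Real.exp_mul, Real.exp_eq_exp] at h1
  have hc1 : c = 1 := by linarith
  subst hc1
  ext y
  simpa using congrFun h y

lemma ne_top {x : R} (hx : x ≠ 0) : u x ≠ ⊤ := fun h => hx (u.top_iff.1 h)

lemma exists_coe {x : R} (hx : x ≠ 0) : ∃ r : ℝ, u x = r :=
  (WithTop.ne_top_iff_exists.1 (u.ne_top hx)).imp fun _ h => h.symm

lemma map_nonneg_mul {x y : R} (hx : 0 ≤ u x) (hy : 0 ≤ u y) : 0 ≤ u (x * y) := by
  rw [u.map_mul]; exact add_nonneg hx hy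

lemma map_pos_mul {x y : R} (hx : 0 < u x) (hy : 0 ≤ u y) : 0 < u (x * y) := by
  rw [u.map_mul]; exact add_pos_of_pos_of_nonneg hx hy

lemma map_one_sub {x : R} (hx : 0 < u x) : u (1 - x) = 0 := by
  rw [← u.map_one]
  exact u.map_sub_eq_of_lt_left (by rwa [u.map_one])

lemma map_eq_zero_of_sub_one {x : R} (hx : 0 < u (x - 1)) : u x = 0 := by
  have := u.map_eq_of_lt_sub (x := 1) (y := x) (by rwa [u.map_one])
  rwa [u.map_one] at this

/-- A polynomial all of whose coefficients are integral for `u`. -/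
def IntegralPoly (p : R[X]) : Prop := ∀ i, 0 ≤ u (p.coeff i)

variable {u}

lemma IntegralPoly.mul {p q : R[X]} (hp : u.IntegralPoly p) (hq : u.IntegralPoly q) :
    u.IntegralPoly (p * q) := by
  intro i
  rw [coeff_mul]
  exact u.map_le_sum fun j _ => u.map_nonneg_mul (hp _) (hq _)

variable (u)

lemma integralPoly_one : u.IntegralPoly 1 := by
  intro i
  rw [coeff_one]
  split_ifs <;> simp

lemma integralPoly_X_sub_C {r : R} (hr : 0 ≤ u r) : u.IntegralPoly (X - C r) := by
  intro i
  rw [coeff_sub, coeff_X, coeff_C]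
  refine u.map_le_sub ?_ ?_ <;> split_ifs <;> simp [hr]

lemma integralPoly_prod {s : Multiset R} (hs : ∀ r ∈ s, 0 ≤ u r) :
    u.IntegralPoly (s.map fun r => X - C r).prod := by
  induction s using Multiset.induction with
  | empty => simpa using u.integralPoly_one
  | cons a s ih =>
    rw [Multiset.map_cons, Multiset.prod_cons]
    exact (u.integralPoly_X_sub_C (hs a (by simp))).mul
      (ih fun r hr => hs r (Multiset.mem_cons_of_mem hr))

lemma map_natCast_nonneg (n : ℕ) : 0 ≤ u (n : R) := by
  induction n with
  | zero => simp
  | succ n ih => push_cast; exact u.map_le_add ih (by simp)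

variable {u}

lemma IntegralPoly.derivative {p : R[X]} (hp : u.IntegralPoly p) :
    u.IntegralPoly (derivative p) := by
  intro i
  rw [coeff_derivative]
  exact u.map_nonneg_mul (hp _) (by exact_mod_cast u.map_natCast_nonneg (i + 1))

lemma IntegralPoly.eval {p : R[X]} (hp : u.IntegralPoly p) {x : R} (hx : 0 ≤ u x) :
    0 ≤ u (p.eval x) := by
  rw [eval_eq_sum_range]
  refine u.map_le_sum fun i _ => u.map_nonneg_mul (hp i) ?_
  rw [u.map_pow]
  exact nsmul_nonneg hx i

end AddValuation

section Invariance

variable {F M : Type*} [Field F] [Field M] [Algebra F M] [FiniteDimensional F M]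
  (u : AddValuation M (WithTop ℝ))

/-- Weak approximation: an element close to `1` for `u` and close to `0` for each conjugate
valuation different from `u`. -/
lemma exists_approx_of_galois {ϖ : F} (hϖ : u (algebraMap F M ϖ) = (1 : ℝ)) :
    ∃ γ : M, 0 < u (γ - 1) ∧
      ∀ σ : M ≃ₐ[F] M, (¬ ∀ x, u (σ x) = u x) → 0 < u (σ γ) := by
  let f : (M ≃ₐ[F] M) → AbsoluteValue M ℝ := fun σ => (u.comap (σ : M →+* M)).toAbsVal
  have hval : ∀ σ : M ≃ₐ[F] M, u.comap (σ : M →+* M) (algebraMap F M ϖ) = (1 : ℝ) := by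
    intro σ
    change u (σ (algebraMap F M ϖ)) = _
    rw [σ.commutes, hϖ]
  obtain ⟨a, ha, ha'⟩ := AbsoluteValue.exists_one_lt_lt_one_pi_of_not_isEquiv
    (v := fun i : Set.range f => (i : AbsoluteValue M ℝ))
    (by
      rintro ⟨_, σ, rfl⟩
      exact AddValuation.toAbsVal_isNontrivial _ (hval σ))
    (by
      rintro ⟨_, σ, rfl⟩ ⟨_, τ, rfl⟩ hne h
      exact hne (Subtype.ext (AddValuation.eq_of_toAbsVal_isEquiv (hval σ) (hval τ) h)))
    ⟨f 1, 1, rfl⟩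
  have ha1 : u a < 0 := (AddValuation.one_lt_toAbsVal _).1 ha
  have ha2 : ∀ σ : M ≃ₐ[F] M, (¬ ∀ x, u (σ x) = u x) → 0 < u (σ a) := by
    intro σ hσ
    exact (AddValuation.toAbsVal_lt_one _).1 (ha' ⟨f σ, σ, rfl⟩
      (fun h => hσ (AddValuation.toAbsVal_eq_iff.1 (Subtype.ext_iff.1 h))))
  have h1a : u (1 + a) = u a := by
    rw [add_comm]
    exact u.map_add_eq_of_lt_left (by simpa using ha1)
  have hne : (1 + a) ≠ 0 := by
    intro h
    rw [h, u.map_zero] at h1a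
    rw [← h1a] at ha1
    exact absurd ha1 (by simp)
  have hane : a ≠ 0 := by
    rintro rfl
    simp at ha1
  refine ⟨a / (1 + a), ?_, fun σ hσ => ?_⟩
  · have : a / (1 + a) - 1 = -(1 + a)⁻¹ := by field_simp; ring
    rw [this, u.map_neg, u.map_inv, h1a]
    obtain ⟨r, hr⟩ := u.exists_coe hane
    rw [hr] at ha1 ⊢
    have hr0 : r < 0 := by exact_mod_cast ha1
    have : -(r : WithTop ℝ) = ((-r : ℝ) : WithTop ℝ) := rfl
    rw [this]
    exact_mod_cast neg_pos.2 hr0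
  · have h0 := ha2 σ hσ
    have h1 : u (1 + σ a) = 0 := by
      rw [← u.map_one]
      exact u.map_add_eq_of_lt_left (by rwa [u.map_one])
    rw [map_div₀, map_add, map_one, u.map_div, h1]
    simpa using h0

lemma map_galois_eq_of_henselian [IsGalois F M] {ϖ : F} (hϖ : u (algebraMap F M ϖ) = (1 : ℝ))
    (hens : ∀ f : F[X], (∀ i : ℕ, 0 ≤ u (algebraMap F M (f.coeff i))) →
      0 < u (algebraMap F M (f.eval 1)) → u (algebraMap F M ((derivative f).eval 1)) = 0 →
        ∃ a : F, f.eval a = 0)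
    (τ : M ≃ₐ[F] M) (x : M) : u (τ x) = u x := by
  by_contra hτ
  replace hτ : ¬ ∀ x, u (τ x) = u x := fun h => hτ (h x)
  obtain ⟨γ, hγ, hγ'⟩ := exists_approx_of_galois u hϖ
  let D : Finset (M ≃ₐ[F] M) := Finset.univ.filter fun σ => ∀ x, u (σ x) = u x
  have hD : ∀ σ, σ ∈ D ↔ ∀ x, u (σ x) = u x := by simp [D]
  set β : M := ∏ σ ∈ D, σ γ with hβ
  have h1 : 0 < u (β - 1) := by
    have : ∀ s : Finset (M ≃ₐ[F] M), s ⊆ D → 0 < u (∏ σ ∈ s, σ γ - 1) := by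
      intro s
      induction s using Finset.induction_on with
      | empty => simp
      | insert σ s hσ ih =>
        intro hs
        have hs1 := ih fun y hy => hs (Finset.mem_insert_of_mem hy)
        have hs2 : 0 < u (σ γ - 1) := by
          have := (hD σ).1 (hs (Finset.mem_insert_self _ _)) (γ - 1)
          rw [map_sub, map_one] at this
          rwa [this]
        rw [Finset.prod_insert hσ]
        have : σ γ * ∏ σ ∈ s, σ γ - 1 = (σ γ - 1) * ∏ σ ∈ s, σ γ + (∏ σ ∈ s, σ γ - 1) := by ring
        rw [this]
        exact u.map_lt_add (u.map_pos_mul hs2 (u.map_eq_zero_of_sub_one hs1).ge) hs1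
    exact this D subset_rfl
  have h2 : ∀ σ, σ ∉ D → 0 < u (σ β) := by
    intro σ hσ
    have hmul : ∀ ρ ∈ D, 0 < u (σ (ρ γ)) := by
      intro ρ hρ
      refine hγ' (σ * ρ) fun h => hσ ((hD σ).2 fun x => ?_)
      have := h (ρ.symm x)
      rw [AlgEquiv.mul_apply, AlgEquiv.apply_symm_apply] at this
      rw [this, ← (hD ρ).1 hρ, AlgEquiv.apply_symm_apply]
    have hone : (1 : M ≃ₐ[F] M) ∈ D := (hD _).2 (by simp)
    rw [hβ, map_prod, ← Finset.mul_prod_erase _ _ hone]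
    refine u.map_pos_mul (hmul _ hone) ?_
    refine Finset.prod_induction _ (fun y => 0 ≤ u y) (fun a b => u.map_nonneg_mul) (by simp) ?_
    exact fun ρ hρ => (hmul ρ (Finset.mem_of_mem_erase hρ)).le
  have h3 : ∀ σ ∈ D, σ β = β := by
    intro σ hσ
    rw [hβ, map_prod]
    refine Finset.prod_bij (fun ρ _ => σ * ρ) ?_ (by simp) ?_ (by simp)
    · intro ρ hρ
      refine (hD _).2 fun x => ?_
      rw [AlgEquiv.mul_apply, (hD σ).1 hσ, (hD ρ).1 hρ]
    · intro ρ hρ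
      refine ⟨σ⁻¹ * ρ, (hD _).2 fun x => ?_, by simp⟩
      rw [← (hD σ).1 hσ, ← AlgEquiv.mul_apply, mul_inv_cancel_left, (hD ρ).1 hρ]
  set p := minpoly F β with hp
  have hint : IsIntegral F β := IsGalois.integral F β
  have hmonic : p.Monic := minpoly.monic hint
  have hsplit : (p.map (algebraMap F M)).Splits := IsGalois.splits F β
  have hroot : ∀ r ∈ (p.map (algebraMap F M)).roots, ∃ σ : M ≃ₐ[F] M, σ β = r := by
    intro r hr
    have hr' : aeval r p = 0 := by
      have := (mem_roots'.1 hr).2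
      rwa [IsRoot, eval_map_algebraMap] at this
    obtain ⟨σ, hσ⟩ := minpoly.exists_algEquiv_of_root (Algebra.IsAlgebraic.isAlgebraic β) hr'
    exact ⟨σ.symm, by rw [← hσ, AlgEquiv.symm_apply_apply]⟩
  have hβmem : β ∈ (p.map (algebraMap F M)).roots := by
    refine mem_roots'.2 ⟨(hmonic.map _).ne_zero, ?_⟩
    rw [IsRoot, eval_map_algebraMap]
    exact minpoly.aeval F β
  set s := (p.map (algebraMap F M)).roots.erase β with hs
  have hnodup : (p.map (algebraMap F M)).roots.Nodup :=
    nodup_roots (Separable.map (IsGalois.separable F β))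
  have hspos : ∀ r ∈ s, 0 < u r := by
    intro r hr
    obtain ⟨σ, rfl⟩ := hroot r (Multiset.mem_of_mem_erase hr)
    refine h2 σ fun hσ => ?_
    rw [h3 σ hσ] at hr
    exact hnodup.notMem_erase hr
  have hfac : p.map (algebraMap F M) = (X - C β) * (s.map fun r => X - C r).prod := by
    rw [hsplit.eq_prod_roots_of_monic (hmonic.map _), ← Multiset.cons_erase hβmem,
      Multiset.map_cons, Multiset.prod_cons]
  set q := (s.map fun r => X - C r).prod with hq
  have hβ0 : u β = 0 := u.map_eq_zero_of_sub_one h1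
  have hqint : u.IntegralPoly q := u.integralPoly_prod fun r hr => (hspos r hr).le
  have hq1 : u (q.eval 1) = 0 := by
    rw [hq, eval_multiset_prod, Multiset.map_map]
    refine Multiset.prod_induction (fun y => u y = 0) _ ?_ (by simp) ?_
    · intro a b ha hb; rw [u.map_mul, ha, hb, add_zero]
    · intro a ha
      obtain ⟨r, hr, rfl⟩ := Multiset.mem_map.1 ha
      simpa using u.map_one_sub (hspos r hr)
  have h1' : 0 < u (1 - β) := by rwa [u.map_sub_swap]
  obtain ⟨a, ha⟩ := hens p (by
      intro i
      rw [← coeff_map, hfac]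
      exact ((u.integralPoly_X_sub_C hβ0.ge).mul hqint) i)
    (by
      rw [← eval_one_map, hfac, eval_mul, eval_sub, eval_X, eval_C]
      exact u.map_pos_mul h1' hq1.ge)
    (by
      rw [← eval_one_map, ← derivative_map, hfac, derivative_mul, derivative_X_sub_C, one_mul,
        eval_add, eval_mul, eval_sub, eval_X, eval_C]
      rw [← hq1]
      refine u.map_add_eq_of_lt_left ?_
      rw [hq1]
      exact u.map_pos_mul h1' (hqint.derivative.eval (by simp)))
  have hdeg : p.degree = 1 := degree_eq_one_of_irreducible_of_root (minpoly.irreducible hint) ha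
  obtain ⟨b, hb⟩ := minpoly.mem_range_of_degree_eq_one F β hdeg
  have hfix : τ β = β := by rw [← hb]; simp
  have := h2 τ fun h => hτ ((hD τ).1 h)
  rw [hfix, hβ0] at this
  exact lt_irrefl _ this

end Invariance

namespace AddVal

variable {Ω : Type*} [Field Ω] (V : AddVal Ω)

/-- The bundled additive valuation attached to `V`. -/
def val : AddValuation Ω (WithTop ℝ) :=
  AddValuation.of V.v V.v_zero
    (by
      have h := V.v_mul 1 1
      obtain ⟨r, hr⟩ := WithTop.ne_top_iff_exists.1 (V.v_ne_top 1 one_ne_zero)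
      rw [mul_one, ← hr, ← WithTop.coe_add, WithTop.coe_inj] at h
      rw [← hr, left_eq_add.1 h, WithTop.coe_zero])
    V.v_min_le_add V.v_mul

lemma val_apply (x : Ω) : V.val x = V.v x := rfl

variable {V}

/-- Over a Henselian field the valuation is invariant under all automorphisms. -/
lemma val_algHom_eq {F : Type*} [Field F] [Algebra F Ω] [IsGalois F Ω]
    (hnorm : V.IsNormalizedOn F) (hhens : V.IsHenselianOn F) (τ : Ω →ₐ[F] Ω) (x : Ω) :
    V.val (τ x) = V.val x := by
  let M : IntermediateField F Ω :=
    IntermediateField.normalClosure F (IntermediateField.adjoin F {x}) Ω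
  have hxint : IsIntegral F x := IsGalois.integral F x
  have : FiniteDimensional F (IntermediateField.adjoin F {x}) :=
    IntermediateField.adjoin.finiteDimensional hxint
  have : FiniteDimensional F M := inferInstanceAs (FiniteDimensional F
    (IntermediateField.normalClosure F (IntermediateField.adjoin F {x}) Ω))
  have : Normal F M := inferInstanceAs (Normal F
    (IntermediateField.normalClosure F (IntermediateField.adjoin F {x}) Ω))
  have : IsGalois F M := ⟨⟩
  have hxM : x ∈ M :=
    IntermediateField.le_normalClosure _ (IntermediateField.mem_adjoin_simple_self F x)
  let τ' : Ω ≃ₐ[F] Ω := AlgEquiv.ofBijective τ (Algebra.IsAlgebraic.algHom_bijective τ)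
  obtain ⟨ϖ, hϖ⟩ := hnorm.2
  have key := map_galois_eq_of_henselian (V.val.comap (algebraMap M Ω)) (ϖ := ϖ) hϖ
    (fun f hf h1 h2 => by
      obtain ⟨a, ha, -⟩ := hhens f hf 1 (by rw [map_one, ← V.val_apply, V.val.map_one]) h1 h2
      exact ⟨a, ha⟩)
    (τ'.restrictNormal M) ⟨x, hxM⟩
  have h2 := τ'.restrictNormal_commutes M ⟨x, hxM⟩
  change V.val (algebraMap M Ω _) = V.val (algebraMap M Ω _) at key
  rw [h2] at key
  exact key

end AddVal

namespace AddValuation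

variable {R : Type*} [Field R] (u : AddValuation R (WithTop ℝ))

/-- The ring of integers of a real-valued additive valuation. -/
def integers : ValuationSubring R where
  carrier := {x | 0 ≤ u x}
  mul_mem' := u.map_nonneg_mul
  one_mem' := by simp
  add_mem' := u.map_le_add
  zero_mem' := by simp
  neg_mem' := by simp
  mem_or_inv_mem' x := by
    by_cases hx : x = 0
    · left; simp [hx]
    · simp only [Set.mem_ofPred_eq]
      rw [u.map_inv]
      obtain ⟨r, hr⟩ := u.exists_coe hx
      have : -(r : WithTop ℝ) = ((-r : ℝ) : WithTop ℝ) := rfl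
      rw [hr, this, ← WithTop.coe_zero, WithTop.coe_le_coe, WithTop.coe_le_coe]
      rcases le_total 0 r with h | h
      · exact Or.inl h
      · exact Or.inr (by linarith)

lemma mem_integers {x : R} : x ∈ u.integers ↔ 0 ≤ u x := Iff.rfl

lemma neg_coe_withTop (r : ℝ) : -(r : WithTop ℝ) = ((-r : ℝ) : WithTop ℝ) := rfl

lemma isUnit_integers_iff {x : u.integers} : IsUnit x ↔ u (x : R) = 0 := by
  constructor
  · rintro ⟨y, rfl⟩
    have h : u ((y : u.integers) : R) + u (((y⁻¹ : u.integersˣ) : u.integers) : R) = 0 := by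
      rw [← u.map_mul, ← u.map_one]
      congr 1
      exact congrArg Subtype.val y.mul_inv
    have h1 : 0 ≤ u ((y : u.integers) : R) := (y : u.integers).2
    have h2 : 0 ≤ u (((y⁻¹ : u.integersˣ) : u.integers) : R) :=
      ((y⁻¹ : u.integersˣ) : u.integers).2
    refine le_antisymm ?_ h1
    calc _ ≤ u ((y : u.integers) : R) + u (((y⁻¹ : u.integersˣ) : u.integers) : R) :=
          le_add_of_nonneg_right h2
      _ = 0 := h
  · intro h
    have hx : (x : R) ≠ 0 := by
      intro h0
      rw [h0, u.map_zero] at h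
      exact WithTop.top_ne_zero h
    refine IsUnit.of_mul_eq_one ⟨(x : R)⁻¹, ?_⟩ (Subtype.ext (mul_inv_cancel₀ hx))
    rw [mem_integers, u.map_inv, h]
    exact (by rw [← WithTop.coe_zero, neg_coe_withTop, neg_zero])

/-- The residue field of a real-valued additive valuation. -/
abbrev Residue : Type _ := IsLocalRing.ResidueField u.integers

lemma residue_eq_zero_iff {x : u.integers} :
    IsLocalRing.residue u.integers x = 0 ↔ 0 < u (x : R) := by
  rw [IsLocalRing.residue_eq_zero_iff, IsLocalRing.mem_maximalIdeal, mem_nonunits_iff,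
    u.isUnit_integers_iff]
  exact ⟨fun h => lt_of_le_of_ne x.2 (Ne.symm h), fun h => h.ne'⟩

variable {F : Type*} [Field F] [Algebra F R]

/-- The inclusion of rings of integers induced by a field extension. -/
def integersMap : (u.comap (algebraMap F R)).integers →+* u.integers :=
  ((algebraMap F R).comp (u.comap (algebraMap F R)).integers.subtype).codRestrict
    u.integers.toSubring fun x => x.2

instance : IsLocalHom (u.integersMap (F := F)) where
  map_nonunit x hx := by
    rw [isUnit_integers_iff] at hx ⊢
    exact hx

end AddValuation

section Perfect

variable {Ω : Type*} [Field Ω] {V : AddVal Ω} {F : Type*} [Field F] [Algebra F Ω]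

lemma AddVal.perfectField_residue (hperf : V.HasPerfectResidueFieldOn F) :
    PerfectField (V.val.comap (algebraMap F Ω)).Residue := by
  set u := V.val.comap (algebraMap F Ω)
  obtain ⟨p, hp⟩ := CharP.exists u.Residue
  rcases CharP.char_is_prime_or_zero u.Residue p with hpp | rfl
  · have : Fact p.Prime := ⟨hpp⟩
    have hpos : 0 < V.v (algebraMap F Ω (p : F)) := by
      have h0 : ((p : ℕ) : u.Residue) = 0 := CharP.cast_eq_zero _ p
      rw [← map_natCast (IsLocalRing.residue u.integers), u.residue_eq_zero_iff] at h0
      exact h0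
    have : PerfectRing u.Residue p := by
      refine PerfectRing.ofSurjective _ p fun z => ?_
      obtain ⟨x, rfl⟩ := IsLocalRing.residue_surjective z
      obtain ⟨y, hy, hxy⟩ := hperf p hpp hpos (x : F) x.2
      refine ⟨IsLocalRing.residue _ ⟨y, hy⟩, ?_⟩
      rw [frobenius_def, ← map_pow, ← sub_eq_zero, ← map_sub, u.residue_eq_zero_iff]
      rw [← V.val_apply, map_sub, V.val.map_sub_swap, ← map_sub] at hxy
      exact hxy
    exact PerfectRing.toPerfectField _ p
  · have := CharP.charP_to_charZero u.Residue
    infer_instance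

end Perfect

section Unramified

variable {Ω : Type*} [Field Ω] (F : Type*) [Field F] [Algebra F Ω]
  (u : AddValuation Ω (WithTop ℝ))

/-- An integral element which is incongruent to each of its other conjugates. -/
def IsUnramifiedElt (t : Ω) : Prop :=
  0 ≤ u t ∧ ∀ τ : Ω →ₐ[F] Ω, 0 < u (τ t - t) → τ t = t

variable {F u}

lemma exists_isUnramifiedElt [IsGalois F Ω] [IsSepClosed Ω]
    [PerfectField (u.comap (algebraMap F Ω)).Residue]
    (hinv : ∀ (τ : Ω →ₐ[F] Ω) (x : Ω), u (τ x) = u x) {x : Ω} (hx : 0 ≤ u x) :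
    ∃ t : Ω, IsUnramifiedElt F u t ∧ 0 < u (x - t) := by
  set uF := u.comap (algebraMap F Ω) with huF
  let κ := uF.Residue
  let φ : κ →+* u.Residue := IsLocalRing.ResidueField.map (u.integersMap (F := F))
  let _ : Algebra κ u.Residue := φ.toAlgebra
  have hφ : algebraMap κ u.Residue = φ := rfl
  have hconj : ∀ (y : Ω) (r : Ω), r ∈ ((minpoly F y).map (algebraMap F Ω)).roots →
      ∃ τ : Ω ≃ₐ[F] Ω, τ y = r := by
    intro y r hr
    have hr' : aeval r (minpoly F y) = 0 := by
      have := (mem_roots'.1 hr).2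
      rwa [IsRoot, eval_map_algebraMap] at this
    exact minpoly.exists_algEquiv_of_root' (Algebra.IsAlgebraic.isAlgebraic y) hr'
  have hred : ∀ (f : uF.integers[X]),
      ((f.map (algebraMap uF.integers F)).map (algebraMap F Ω)) =
        (f.map u.integersMap).map u.integers.subtype := by
    intro f
    rw [Polynomial.map_map, Polynomial.map_map]
    rfl
  have hred2 : ∀ (f : uF.integers[X]),
      (f.map (IsLocalRing.residue uF.integers)).map (algebraMap κ u.Residue) =
        (f.map u.integersMap).map (IsLocalRing.residue u.integers) := by
    intro f
    rw [Polynomial.map_map, Polynomial.map_map, hφ]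
    congr 1
  have heval : ∀ (f : uF.integers[X]) (y : u.integers),
      eval (y : Ω) ((f.map (algebraMap uF.integers F)).map (algebraMap F Ω)) =
        ((eval y (f.map u.integersMap) : u.integers) : Ω) := by
    intro f y
    rw [hred]
    exact (eval_map_apply u.integers.subtype y)
  have hred_eval : ∀ (f : uF.integers[X]) (y : u.integers),
      aeval (IsLocalRing.residue u.integers y) (f.map (IsLocalRing.residue uF.integers)) =
        IsLocalRing.residue u.integers (eval y (f.map u.integersMap)) := by
    intro f y
    rw [← eval_map_algebraMap, hred2]
    exact eval_map_apply (IsLocalRing.residue u.integers) y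
  let X0 : u.integers := ⟨x, hx⟩
  -- `x` is a root of a monic integral polynomial
  obtain ⟨p0, hp0, hp0m⟩ : ∃ p : uF.integers[X],
      p.map (algebraMap uF.integers F) = minpoly F x ∧ p.Monic := by
    have hint : u.IntegralPoly ((minpoly F x).map (algebraMap F Ω)) := by
      rw [(IsGalois.splits F x).eq_prod_roots_of_monic
        ((minpoly.monic (IsGalois.integral F x)).map _)]
      refine u.integralPoly_prod fun r hr => ?_
      obtain ⟨τ, rfl⟩ := hconj x r hr
      exact (hinv τ.toAlgHom x).symm ▸ hx
    obtain ⟨q, hq, -, hqm⟩ := lifts_and_natDegree_eq_and_monic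
      (f := algebraMap uF.integers F) (p := minpoly F x)
      ((lifts_iff_coeff_lifts _).2 fun n =>
        ⟨⟨(minpoly F x).coeff n, by
          have := hint n
          rwa [coeff_map] at this⟩, rfl⟩)
      (minpoly.monic (IsGalois.integral F x))
    exact ⟨q, hq, hqm⟩
  have hxbar : IsIntegral κ (IsLocalRing.residue u.integers X0) := by
    refine ⟨p0.map (IsLocalRing.residue uF.integers), hp0m.map _, ?_⟩
    rw [← aeval_def, hred_eval]
    have h0 : ((eval X0 (p0.map u.integersMap) : u.integers) : Ω) = 0 := by
      rw [← heval, hp0, eval_map_algebraMap]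
      exact minpoly.aeval F x
    rw [Subtype.ext_iff.2 (show _ = ((0 : u.integers) : Ω) from h0), map_zero]
  set g := minpoly κ (IsLocalRing.residue u.integers X0) with hg
  have hgm : g.Monic := minpoly.monic hxbar
  have hgirr : Irreducible g := minpoly.irreducible hxbar
  have hgsep : g.Separable := PerfectField.separable_of_irreducible hgirr
  obtain ⟨f, hf, hfdeg, hfm⟩ := lifts_and_natDegree_eq_and_monic
    (f := IsLocalRing.residue uF.integers) (p := g)
    ((lifts_iff_coeff_lifts _).2 fun n => IsLocalRing.residue_surjective _) hgm
  have hfirr : Irreducible (f.map (algebraMap uF.integers F)) := by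
    rw [← hfm.irreducible_iff_irreducible_map_fraction_map]
    exact hfm.irreducible_of_irreducible_map (IsLocalRing.residue uF.integers) f (by rwa [hf])
  have hfsep : (f.map (algebraMap uF.integers F)).Separable := by
    rw [separable_iff_derivative_ne_zero hfirr, derivative_map]
    intro h0
    have h1 : derivative f = 0 :=
      (Polynomial.map_eq_zero_iff (IsFractionRing.injective _ F)).1 h0
    refine (separable_iff_derivative_ne_zero hgirr).1 hgsep ?_
    rw [← hf, derivative_map, h1, Polynomial.map_zero]
  set P := (f.map (algebraMap uF.integers F)).map (algebraMap F Ω) with hP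
  have hPm : P.Monic := (hfm.map _).map _
  have hPsplit : P.Splits := IsSepClosed.splits_codomain _ hfsep
  have hPx : 0 < u (P.eval x) := by
    have := heval f X0
    rw [← hP] at this
    rw [show x = (X0 : Ω) from rfl, this, ← u.residue_eq_zero_iff, ← hred_eval, hf]
    exact minpoly.aeval _ _
  obtain ⟨t, htroot, ht⟩ : ∃ t ∈ P.roots, 0 < u (x - t) := by
    by_contra! hcon
    rw [hPsplit.eq_prod_roots_of_monic hPm, eval_multiset_prod, Multiset.map_map] at hPx
    refine absurd hPx (not_lt.2 ?_)
    refine Multiset.prod_induction (fun y => u y ≤ 0) _ ?_ (by simp) ?_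
    · intro a b ha hb; rw [u.map_mul]; exact add_nonpos ha hb
    · intro a ha
      obtain ⟨r, hr, rfl⟩ := Multiset.mem_map.1 ha
      simpa using hcon r hr
  have ht0 : 0 ≤ u t := by
    have : t = x - (x - t) := by ring
    rw [this]
    exact u.map_le_sub hx ht.le
  refine ⟨t, ⟨ht0, fun τ hτ => ?_⟩, ht⟩
  by_contra hne
  have htP : aeval t (f.map (algebraMap uF.integers F)) = 0 := by
    rw [← eval_map_algebraMap]
    exact (mem_roots'.1 htroot).2
  have hmin : minpoly F t = f.map (algebraMap uF.integers F) :=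
    (minpoly.eq_of_irreducible_of_monic hfirr htP (hfm.map _)).symm
  have hτroot : τ t ∈ P.roots.erase t := by
    rw [Multiset.mem_erase_of_ne hne]
    refine mem_roots'.2 ⟨hPm.ne_zero, ?_⟩
    rw [IsRoot, hP, eval_map_algebraMap, aeval_algHom_apply, htP, map_zero]
  set s := (P.roots.erase t).erase (τ t) with hs
  have hfac : P = (X - C t) * ((X - C (τ t)) * (s.map fun r => X - C r).prod) := by
    rw [← Multiset.prod_cons, ← Multiset.map_cons (fun r => X - C r), hs,
      Multiset.cons_erase hτroot, ← Multiset.prod_cons,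
      ← Multiset.map_cons (fun r => X - C r), Multiset.cons_erase htroot]
    exact hPsplit.eq_prod_roots_of_monic hPm
  have hsint : u.IntegralPoly (s.map fun r => X - C r).prod := by
    refine u.integralPoly_prod fun r hr => ?_
    have hr' := Multiset.mem_of_mem_erase (Multiset.mem_of_mem_erase hr)
    rw [hP, ← hmin] at hr'
    obtain ⟨ρ, rfl⟩ := hconj t r hr'
    exact (hinv ρ.toAlgHom t).symm ▸ ht0
  have hder : 0 < u ((derivative P).eval t) := by
    rw [hfac, derivative_mul, derivative_X_sub_C, one_mul, eval_add, eval_mul, eval_mul,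
      eval_sub, eval_sub, eval_X, eval_C, eval_C, sub_self, zero_mul, add_zero]
    exact u.map_pos_mul (by rwa [u.map_sub_swap]) (hsint.eval ht0)
  have hres : IsLocalRing.residue u.integers ⟨t, ht0⟩ = IsLocalRing.residue u.integers X0 := by
    rw [← sub_eq_zero, ← map_sub, u.residue_eq_zero_iff]
    change 0 < u (t - x)
    rwa [u.map_sub_swap]
  have h1 := heval (derivative f) ⟨t, ht0⟩
  rw [← derivative_map, ← derivative_map, ← hP] at h1
  have h1' : eval t (derivative P) =
      ((eval (⟨t, ht0⟩ : u.integers) ((derivative f).map u.integersMap) : u.integers) : Ω) := h1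
  rw [h1', ← u.residue_eq_zero_iff, ← hred_eval, hres, ← derivative_map, hf] at hder
  exact hgsep.aeval_derivative_ne_zero (minpoly.aeval _ _) hder

end Unramified

section Embeddings

variable {K E Ω : Type*} [Field K] [Field E] [Field Ω] [Algebra K E] [Algebra E Ω] [Algebra K Ω]
  [IsScalarTower K E Ω] [IsGalois K Ω]

variable (E Ω) in
lemma minpoly_splits_of_isGalois (x : E) : ((minpoly K x).map (algebraMap K Ω)).Splits := by
  rw [← minpoly.algebraMap_eq (algebraMap E Ω).injective x]
  exact IsGalois.splits K _

variable (K E Ω) in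
include Ω in
lemma isAlgebraic_bot_of_isGalois : Algebra.IsAlgebraic K E :=
  Algebra.IsAlgebraic.of_injective (IsScalarTower.toAlgHom K E Ω) (algebraMap E Ω).injective

variable (K E Ω) in
include Ω in
lemma isSeparable_bot_of_isGalois : Algebra.IsSeparable K E :=
  Algebra.isSeparable_tower_bot_of_isSeparable K E Ω

variable (K Ω) in
include Ω in
lemma isIntegral_bot_of_isGalois (x : E) : IsIntegral K x :=
  have := isAlgebraic_bot_of_isGalois K E Ω
  Algebra.IsIntegral.isIntegral x

variable (K Ω) in
include Ω in
lemma aeval_derivative_minpoly_ne_zero (π : E) : aeval π (derivative (minpoly K π)) ≠ 0 :=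
  ((isSeparable_bot_of_isGalois K E Ω).isSeparable' π).aeval_derivative_ne_zero (minpoly.aeval _ _)

/-- The trace is the sum of all embeddings into a Galois overfield. -/
lemma trace_eq_sum_embeddings_of_isGalois [FiniteDimensional K E] (x : E) :
    algebraMap K Ω (Algebra.trace K E x) = ∑ σ : E →ₐ[K] Ω, σ x := by
  have := isAlgebraic_bot_of_isGalois K E Ω
  have := isSeparable_bot_of_isGalois K E Ω
  apply (algebraMap Ω (AlgebraicClosure Ω)).injective
  rw [← IsScalarTower.algebraMap_apply, trace_eq_sum_embeddings (AlgebraicClosure Ω), map_sum]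
  exact (Fintype.sum_equiv (Algebra.IsAlgebraic.algHomEquivAlgHomOfSplits (AlgebraicClosure Ω) Ω
    (minpoly_splits_of_isGalois E Ω)) _ _ fun _ => rfl).symm

/-- Every embedding of a subextension of a Galois extension extends. -/
lemma exists_extend_algHom (σ : E →ₐ[K] Ω) :
    ∃ τ : Ω →ₐ[K] Ω, ∀ x, τ (algebraMap E Ω x) = σ x :=
  ⟨σ.liftNormal Ω, σ.liftNormal_commutes Ω⟩

/-- An element of `Ω` fixed by all automorphisms over `E` lies in `E`. -/
lemma mem_range_of_fixed {x : Ω} (hx : ∀ τ : Ω →ₐ[K] Ω,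
    (∀ y : E, τ (algebraMap E Ω y) = algebraMap E Ω y) → τ x = x) :
    ∃ y : E, algebraMap E Ω y = x := by
  have : IsGalois E Ω := IsGalois.tower_top_of_isGalois K E Ω
  refine (InfiniteGalois.mem_range_algebraMap_iff_fixed x).2 fun f => ?_
  exact hx ((f : Ω →ₐ[E] Ω).restrictScalars K) fun y => f.commutes y

/-- An element separating the embeddings is a generator. -/
lemma adjoin_simple_eq_top {π : E}
    (hπ : ∀ σ σ' : E →ₐ[K] Ω, σ π = σ' π → σ = σ') : IntermediateField.adjoin K {π} = ⊤ := by
  refine eq_top_iff.2 fun y _ => ?_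
  obtain ⟨z, hz⟩ := mem_range_of_fixed (K := K) (E := IntermediateField.adjoin K {π}) (Ω := Ω)
    (x := algebraMap E Ω y) (fun τ hτ => by
      have h := hπ (τ.comp (IsScalarTower.toAlgHom K E Ω)) (IsScalarTower.toAlgHom K E Ω)
        (hτ ⟨π, IntermediateField.mem_adjoin_simple_self K π⟩)
      exact DFunLike.congr_fun h y)
  rw [← (algebraMap E Ω).injective (hz : algebraMap E Ω (z : E) = algebraMap E Ω y)]
  exact z.2

lemma minpoly_map_eq_prod [Fintype (E →ₐ[K] Ω)] {π : E}
    (hπ : ∀ σ σ' : E →ₐ[K] Ω, σ π = σ' π → σ = σ') :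
    (minpoly K π).map (algebraMap K Ω) = ∏ σ : E →ₐ[K] Ω, (X - C (σ π)) := by
  have := isAlgebraic_bot_of_isGalois K E Ω
  have hsep := (isSeparable_bot_of_isGalois K E Ω).isSeparable' π
  have hm := minpoly.monic (Algebra.IsIntegral.isIntegral (R := K) π)
  rw [(minpoly_splits_of_isGalois E Ω π).eq_prod_roots_of_monic (hm.map _)]
  change _ = (Finset.univ.val.map fun σ : E →ₐ[K] Ω => X - C (σ π)).prod
  have hroots : ((minpoly K π).map (algebraMap K Ω)).roots =
      Finset.univ.val.map fun σ : E →ₐ[K] Ω => σ π := by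
    refine (Multiset.Nodup.ext (nodup_roots (Separable.map hsep)) ?_).2 fun r => ?_
    · exact (Multiset.nodup_map_iff_of_injective fun σ σ' h => hπ σ σ' h).2 Finset.univ.nodup
    · rw [mem_roots (hm.map _).ne_zero, IsRoot, eval_map_algebraMap, Multiset.mem_map]
      constructor
      · intro h
        have h' : aeval r (minpoly K (algebraMap E Ω π)) = 0 := by
          rwa [minpoly.algebraMap_eq (algebraMap E Ω).injective]
        obtain ⟨τ, hτ⟩ := minpoly.exists_algEquiv_of_root'
          (Algebra.IsAlgebraic.isAlgebraic (R := K) (algebraMap E Ω π)) h'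
        exact ⟨(τ : Ω →ₐ[K] Ω).comp (IsScalarTower.toAlgHom K E Ω), Finset.mem_univ _, hτ⟩
      · rintro ⟨σ, -, rfl⟩
        rw [aeval_algHom_apply, minpoly.aeval, map_zero]
  rw [hroots, Multiset.map_map]
  rfl

lemma aeval_derivative_minpoly_eq_prod [Fintype (E →ₐ[K] Ω)] [DecidableEq (E →ₐ[K] Ω)] {π : E}
    (hπ : ∀ σ σ' : E →ₐ[K] Ω, σ π = σ' π → σ = σ') :
    algebraMap E Ω (aeval π (derivative (minpoly K π))) =
      ∏ σ ∈ Finset.univ.erase (IsScalarTower.toAlgHom K E Ω), (algebraMap E Ω π - σ π) := by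
  rw [← aeval_algebraMap_apply, ← eval_map_algebraMap, ← derivative_map, minpoly_map_eq_prod hπ,
    ← Finset.mul_prod_erase _ _ (Finset.mem_univ (IsScalarTower.toAlgHom K E Ω)),
    derivative_mul, derivative_X_sub_C, one_mul, eval_add, eval_mul, eval_sub, eval_X, eval_C]
  simp [eval_prod]

end Embeddings

/-- A subextension `E / K` of ramification index `e` with trivial residue extension:
`ϖ` and `π` are uniformizers, and every integer of `E` is congruent to one of `K`. -/
structure IsTotRam {K E Ω : Type*} [Field K] [Field E] [Field Ω] [Algebra K E] [Algebra E Ω]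
    [Algebra K Ω] (u : AddValuation Ω (WithTop ℝ)) (e : ℕ) (ϖ : K) (π : E) : Prop where
  pos : 0 < e
  val_base : ∀ x : K, x ≠ 0 → ∃ k : ℤ, u (algebraMap K Ω x) = ((k : ℝ) : WithTop ℝ)
  val_unif_base : u (algebraMap K Ω ϖ) = (1 : ℝ)
  val_top : ∀ x : E, x ≠ 0 → ∃ k : ℤ, u (algebraMap E Ω x) = ((k / e : ℝ) : WithTop ℝ)
  val_unif : u (algebraMap E Ω π) = ((1 / e : ℝ) : WithTop ℝ)
  val_algHom : ∀ (σ : E →ₐ[K] Ω) (x : E), u (σ x) = u (algebraMap E Ω x)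
  approx : ∀ x : E, 0 ≤ u (algebraMap E Ω x) →
    ∃ t : K, 0 ≤ u (algebraMap K Ω t) ∧ 0 < u (algebraMap E Ω x - algebraMap K Ω t)

namespace IsTotRam

variable {K E Ω : Type*} [Field K] [Field E] [Field Ω] [Algebra K E] [Algebra E Ω] [Algebra K Ω]
  {u : AddValuation Ω (WithTop ℝ)} {e : ℕ} {ϖ : K} {π : E}

section

variable (h : IsTotRam u e ϖ π)
include h

lemma e_pos : (0 : ℝ) < e := by exact_mod_cast h.pos

lemma unif_ne_zero : π ≠ 0 := by
  rintro rfl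
  have := h.val_unif
  rw [map_zero, u.map_zero] at this
  exact WithTop.coe_ne_top this.symm

lemma unif_base_ne_zero : ϖ ≠ 0 := by
  rintro rfl
  have := h.val_unif_base
  rw [map_zero, u.map_zero] at this
  exact WithTop.coe_ne_top this.symm

lemma le_of_pos {x : E} (hx : 0 < u (algebraMap E Ω x)) :
    ((1 / e : ℝ) : WithTop ℝ) ≤ u (algebraMap E Ω x) := by
  by_cases hx0 : x = 0
  · simp [hx0]
  obtain ⟨k, hk⟩ := h.val_top x hx0
  rw [hk] at hx ⊢
  have h1 : (0 : ℝ) < k / e := by exact_mod_cast hx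
  have h2 : (0 : ℝ) < k := (div_pos_iff_of_pos_right h.e_pos).1 h1
  have h3 : (1 : ℝ) ≤ k := by exact_mod_cast (by exact_mod_cast h2 : (0 : ℤ) < k)
  exact WithTop.coe_le_coe.2 (div_le_div_of_nonneg_right h3 h.e_pos.le)

lemma val_aeval_sub_le {g : K[X]} (hg : ∀ i, 0 ≤ u (algebraMap K Ω (g.coeff i)))
    (σ σ' : E →ₐ[K] Ω) : u (σ π - σ' π) ≤ u (σ (aeval π g) - σ' (aeval π g)) := by
  have hpos : ∀ σ : E →ₐ[K] Ω, 0 ≤ u (σ π) := fun σ => by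
    rw [h.val_algHom, h.val_unif]
    exact WithTop.coe_le_coe.2 (by positivity)
  have hpow : ∀ i : ℕ, u (σ π - σ' π) ≤ u (σ π ^ i - σ' π ^ i) := by
    intro i
    induction i with
    | zero => simp
    | succ i ih =>
      have : σ π ^ (i + 1) - σ' π ^ (i + 1) =
          σ π * (σ π ^ i - σ' π ^ i) + (σ π - σ' π) * σ' π ^ i := by ring
      rw [this]
      refine u.map_le_add ?_ ?_
      · rw [u.map_mul]
        exact ih.trans (le_add_of_nonneg_left (hpos σ))
      · rw [u.map_mul, u.map_pow]
        exact le_add_of_nonneg_right (nsmul_nonneg (hpos σ') _)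
  rw [aeval_eq_sum_range, map_sum, map_sum, ← Finset.sum_sub_distrib]
  refine u.map_le_sum fun i _ => ?_
  rw [map_smul, map_smul, ← smul_sub, Algebra.smul_def, u.map_mul, map_pow, map_pow]
  exact (hpow i).trans (le_add_of_nonneg_left (hg i))

variable [IsScalarTower K E Ω]

/-- Integers of `E` are approximated by integral polynomials in `π` of degree `< e`. -/
lemma exists_polynomial_approx {y : E} (hy : 0 ≤ u (algebraMap E Ω y)) (N : ℕ) :
    ∃ g : K[X], g.natDegree < e ∧ (∀ i, 0 ≤ u (algebraMap K Ω (g.coeff i))) ∧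
      ((N / e : ℝ) : WithTop ℝ) ≤ u (algebraMap E Ω (y - aeval π g)) := by
  induction N with
  | zero => exact ⟨0, by simpa using h.pos, by simp, by simpa using hy⟩
  | succ N ih =>
    obtain ⟨g, hg, hgi, hN⟩ := ih
    set q := N / e
    set i := N % e
    have hi : i < e := Nat.mod_lt _ h.pos
    have hNe : (N : ℝ) = e * q + i := by exact_mod_cast (Nat.div_add_mod N e).symm
    set w : E := algebraMap K E ϖ ^ q * π ^ i with hw
    have hw0 : w ≠ 0 := by
      have := h.unif_ne_zero
      have := h.unif_base_ne_zero
      simp [*]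
    have huw : u (algebraMap E Ω w) = ((N / e : ℝ) : WithTop ℝ) := by
      rw [hw, map_mul, map_pow, map_pow, u.map_mul, u.map_pow, u.map_pow, h.val_unif,
        ← IsScalarTower.algebraMap_apply, h.val_unif_base, ← WithTop.coe_nsmul,
        ← WithTop.coe_nsmul, ← WithTop.coe_add, hNe]
      congr 1
      have := h.e_pos.ne'
      simp
      field_simp
    have hz : 0 ≤ u (algebraMap E Ω ((y - aeval π g) / w)) := by
      rw [map_div₀, u.map_div, huw]
      by_cases h0 : y - aeval π g = 0
      · rw [h0, map_zero, u.map_zero]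
        simp
      obtain ⟨k, hk⟩ := h.val_top _ h0
      rw [hk] at hN ⊢
      rw [← WithTop.LinearOrderedAddCommGroup.coe_sub]
      exact_mod_cast sub_nonneg.2 (WithTop.coe_le_coe.1 hN)
    obtain ⟨t, ht, hzt⟩ := h.approx _ hz
    refine ⟨g + C (t * ϖ ^ q) * X ^ i, ?_, fun j => ?_, ?_⟩
    · exact (natDegree_add_le _ _).trans_lt
        (max_lt hg ((natDegree_C_mul_X_pow_le _ _).trans_lt hi))
    · rw [coeff_add, map_add]
      refine u.map_le_add (hgi j) ?_
      rw [coeff_C_mul_X_pow]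
      split_ifs
      · rw [map_mul, map_pow]
        refine u.map_nonneg_mul ht ?_
        rw [u.map_pow, h.val_unif_base]
        exact nsmul_nonneg (by exact_mod_cast zero_le_one) _
      · simp
    · have h1 : y - aeval π (g + C (t * ϖ ^ q) * X ^ i) =
          ((y - aeval π g) / w - algebraMap K E t) * w := by
        rw [sub_mul, div_mul_cancel₀ _ hw0]
        simp [hw]
        ring
      rw [h1, map_mul, u.map_mul, huw, Nat.cast_succ, add_comm (N : ℝ), add_div, WithTop.coe_add]
      gcongr
      refine h.le_of_pos ?_
      rwa [map_sub, ← IsScalarTower.algebraMap_apply]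

lemma val_sub_le (σ σ' : E →ₐ[K] Ω) {y : E} (hy : 0 ≤ u (algebraMap E Ω y)) :
    u (σ π - σ' π) ≤ u (σ y - σ' y) := by
  by_contra! hlt
  obtain ⟨r, hr⟩ := WithTop.ne_top_iff_exists.1 hlt.ne_top
  obtain ⟨N, hN⟩ := exists_nat_gt (r * e)
  obtain ⟨g, -, hg, hyg⟩ := h.exists_polynomial_approx hy N
  have hrN : (r : WithTop ℝ) < ((N / e : ℝ) : WithTop ℝ) :=
    WithTop.coe_lt_coe.2 ((lt_div_iff₀ h.e_pos).2 hN)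
  have h1 : σ y - σ' y = σ (y - aeval π g) - σ' (y - aeval π g) +
      (σ (aeval π g) - σ' (aeval π g)) := by
    rw [map_sub, map_sub]; ring
  rw [← hr] at hlt
  refine lt_irrefl (u (σ y - σ' y)) ?_
  conv_rhs => rw [h1]
  rw [← hr]
  refine u.map_lt_add (lt_of_lt_of_le (lt_min ?_ ?_) (u.map_sub _ _))
    (hlt.trans_le (h.val_aeval_sub_le hg σ σ'))
  · rw [h.val_algHom]; exact hrN.trans_le hyg
  · rw [h.val_algHom]; exact hrN.trans_le hyg

lemma algHom_ext {σ σ' : E →ₐ[K] Ω} (hπ : σ π = σ' π) : σ = σ' := by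
  have key : ∀ y : E, 0 ≤ u (algebraMap E Ω y) → σ y = σ' y := by
    intro y hy
    have := h.val_sub_le σ σ' hy
    rwa [hπ, sub_self, u.map_zero, top_le_iff, u.top_iff, sub_eq_zero] at this
  ext y
  by_cases hy : 0 ≤ u (algebraMap E Ω y)
  · exact key y hy
  · have := (u.integers.mem_or_inv_mem (algebraMap E Ω y)).resolve_left hy
    rw [← map_inv₀] at this
    have := key y⁻¹ this
    rwa [map_inv₀, map_inv₀, inv_inj] at this

variable [IsGalois K Ω]

lemma adjoin_eq_top : IntermediateField.adjoin K {π} = ⊤ :=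
  adjoin_simple_eq_top (Ω := Ω) fun _ _ => h.algHom_ext

lemma finiteDimensional : FiniteDimensional K E := by
  have := IntermediateField.adjoin.finiteDimensional (isIntegral_bot_of_isGalois K Ω π)
  rw [h.adjoin_eq_top] at this
  exact Module.Finite.equiv (IntermediateField.topEquiv (F := K) (E := E)).toLinearEquiv

lemma exists_powerBasis : ∃ pb : PowerBasis K E, pb.gen = π := by
  refine ⟨PowerBasis.ofAdjoinEqTop (isIntegral_bot_of_isGalois K Ω π) ?_,
    PowerBasis.ofAdjoinEqTop_gen _ _⟩
  rw [← IntermediateField.adjoin_simple_toSubalgebra_of_isAlgebraic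
      (isIntegral_bot_of_isGalois K Ω π).isAlgebraic,
    h.adjoin_eq_top, IntermediateField.top_toSubalgebra]

lemma card_algHom : Nat.card (E →ₐ[K] Ω) = Module.finrank K E := by
  have := h.finiteDimensional
  have := isSeparable_bot_of_isGalois K E Ω
  exact AlgHom.natCard_of_splits K E Ω (minpoly_splits_of_isGalois E Ω)

lemma le_finrank : e ≤ Module.finrank K E := by
  have := h.finiteDimensional
  have : Fintype (E →ₐ[K] Ω) := Fintype.ofFinite _
  have h0 := congrArg (eval 0) (minpoly_map_eq_prod (K := K) (E := E) (Ω := Ω) (π := π)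
    fun _ _ => h.algHom_ext)
  rw [eval_prod, eval_zero_map] at h0
  have h1 : u (algebraMap K Ω ((minpoly K π).eval 0)) =
      ((Module.finrank K E / e : ℝ) : WithTop ℝ) := by
    rw [h0]
    have : ∀ s : Finset (E →ₐ[K] Ω), u (∏ σ ∈ s, eval 0 (X - C (σ π))) =
        ((s.card / e : ℝ) : WithTop ℝ) := by
      intro s
      induction s using Finset.induction_on with
      | empty => simp
      | insert σ s hσ ih =>
        rw [Finset.prod_insert hσ, u.map_mul, ih, Finset.card_insert_of_notMem hσ]
        simp only [eval_sub, eval_X, eval_C, zero_sub]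
        rw [u.map_neg, h.val_algHom, h.val_unif, ← WithTop.coe_add]
        congr 1
        push_cast
        ring
    rw [this, Finset.card_univ, Fintype.card_eq_nat_card, h.card_algHom]
  have hne : (minpoly K π).eval 0 ≠ 0 := by
    intro h2
    rw [h2, map_zero, u.map_zero] at h1
    exact WithTop.coe_ne_top h1.symm
  obtain ⟨k, hk⟩ := h.val_base _ hne
  rw [hk, WithTop.coe_inj, eq_div_iff h.e_pos.ne'] at h1
  have hpos : 0 < Module.finrank K E := Module.finrank_pos
  have h2 : k * (e : ℤ) = Module.finrank K E := by exact_mod_cast h1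
  have h3 : (e : ℤ) ∣ (Module.finrank K E : ℤ) := ⟨k, by rw [← h2]; ring⟩
  exact Nat.le_of_dvd hpos (by exact_mod_cast h3)

lemma val_trace_le {r : ℝ} {x : E} (hx : (r : WithTop ℝ) ≤ u (algebraMap E Ω x)) :
    (r : WithTop ℝ) ≤ u (algebraMap K Ω (Algebra.trace K E x)) := by
  have := h.finiteDimensional
  rw [trace_eq_sum_embeddings_of_isGalois]
  exact u.map_le_sum fun σ _ => by rwa [h.val_algHom]

lemma trace_pow_div (i : ℕ) (hi : i < Module.finrank K E) :
    Algebra.trace K E (π ^ i / aeval π (derivative (minpoly K π))) =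
      if i = Module.finrank K E - 1 then 1 else 0 := by
  have := h.finiteDimensional
  have := isSeparable_bot_of_isGalois K E Ω
  obtain ⟨pb, rfl⟩ := h.exists_powerBasis
  rw [pb.finrank] at hi ⊢
  have hlast : pb.dim - 1 < pb.dim := Nat.sub_lt pb.dim_pos one_pos
  have h1 := pb.basis.trace_traceDual_mul (⟨pb.dim - 1, hlast⟩ : Fin pb.dim) ⟨i, hi⟩
  rw [Module.Basis.traceDual_powerBasis_eq, pb.basis_eq_pow] at h1
  have h2 : (minpolyDiv K pb.gen).coeff (pb.dim - 1) = 1 := by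
    have hm := minpolyDiv_monic (isIntegral_bot_of_isGalois K Ω pb.gen)
    have hd := (natDegree_minpolyDiv : (minpolyDiv K pb.gen).natDegree = _)
    rw [pb.natDegree_minpoly] at hd
    rw [← hd]
    exact hm
  simp only [h2] at h1
  rw [div_eq_inv_mul, ← one_div, h1]
  simp [Fin.ext_iff]

lemma finrank_eq : Module.finrank K E = e := by
  refine le_antisymm ?_ h.le_finrank
  by_contra! hlt
  set n := Module.finrank K E
  set δ := aeval π (derivative (minpoly K π)) with hδ
  obtain ⟨k, hk⟩ := h.val_top δ (aeval_derivative_minpoly_ne_zero K Ω π)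
  obtain ⟨N, hN⟩ := exists_nat_gt (k : ℝ)
  have hπ : 0 ≤ u (algebraMap E Ω (π ^ (n - 1))) := by
    rw [map_pow, u.map_pow, h.val_unif]
    exact nsmul_nonneg (WithTop.coe_le_coe.2 (by positivity)) _
  obtain ⟨g, hg, -, hgN⟩ := h.exists_polynomial_approx hπ N
  have h1 : Algebra.trace K E ((π ^ (n - 1) - aeval π g) / δ) = 1 := by
    rw [sub_div, map_sub, h.trace_pow_div _ (by omega), if_pos rfl, aeval_eq_sum_range,
      Finset.sum_div, map_sum, Finset.sum_eq_zero, sub_zero]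
    intro i hi
    rw [Finset.mem_range] at hi
    rw [smul_div_assoc, map_smul, h.trace_pow_div _ (by omega), if_neg (by omega), smul_zero]
  have h2 : (((N - k) / e : ℝ) : WithTop ℝ) ≤
      u (algebraMap E Ω ((π ^ (n - 1) - aeval π g) / δ)) := by
    rw [map_div₀, u.map_div, hk]
    by_cases h0 : π ^ (n - 1) - aeval π g = 0
    · rw [h0, map_zero, u.map_zero]
      simp
    obtain ⟨m, hm⟩ := h.val_top _ h0
    rw [hm] at hgN ⊢
    rw [← WithTop.LinearOrderedAddCommGroup.coe_sub, sub_div]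
    exact WithTop.coe_le_coe.2 (sub_le_sub_right (WithTop.coe_le_coe.1 hgN) _)
  have h3 := h.val_trace_le h2
  rw [h1, map_one, u.map_one] at h3
  have h4 : ((N : ℝ) - k) / e ≤ 0 := by exact_mod_cast h3
  have h5 : 0 < ((N : ℝ) - k) / e := div_pos (sub_pos.2 hN) h.e_pos
  linarith

/-- The trace of an integer of `E` divided by `f'(π)`, read off from a polynomial of
degree `< e` in `π` approximating it. -/
lemma trace_aeval_div {g : K[X]} (hg : g.natDegree < e) :
    Algebra.trace K E (aeval π g / aeval π (derivative (minpoly K π))) = g.coeff (e - 1) := by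
  have he := h.pos
  rw [aeval_eq_sum_range' hg, Finset.sum_div, map_sum, Finset.sum_eq_single (e - 1)]
  · rw [smul_div_assoc, map_smul, h.trace_pow_div _ (by rw [h.finrank_eq]; omega), h.finrank_eq,
      if_pos rfl, smul_eq_mul, mul_one]
  · intro i hi hne
    rw [Finset.mem_range] at hi
    rw [smul_div_assoc, map_smul, h.trace_pow_div _ (by rwa [h.finrank_eq]), h.finrank_eq,
      if_neg hne, smul_zero]
  · intro hi
    exact absurd (Finset.mem_range.2 (by omega)) hi

end

end IsTotRam

section UnramifiedTrace

variable {F K Ω : Type*} [Field F] [Field K] [Field Ω] [Algebra F K] [Algebra K Ω] [Algebra F Ω]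
  [IsScalarTower F K Ω] [IsGalois F Ω] {u : AddValuation Ω (WithTop ℝ)}

lemma AddValuation.val_algHom_apply (hinv : ∀ (τ : Ω →ₐ[F] Ω) (x : Ω), u (τ x) = u x)
    (σ : K →ₐ[F] Ω) (x : K) : u (σ x) = u (algebraMap K Ω x) := by
  obtain ⟨τ, hτ⟩ := exists_extend_algHom σ
  rw [← hτ, hinv]

/-- If distinct embeddings of `K` stay distinct modulo the maximal ideal, the trace form
preserves valuations. -/
lemma exists_val_trace_eq [FiniteDimensional F K]
    (hinv : ∀ (τ : Ω →ₐ[F] Ω) (x : Ω), u (τ x) = u x)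
    (hsep : ∀ σ σ' : K →ₐ[F] Ω,
      (∀ z : K, 0 ≤ u (algebraMap K Ω z) → 0 < u (σ z - σ' z)) → σ = σ')
    {y : K} (hy : y ≠ 0) :
    ∃ z : K, 0 ≤ u (algebraMap K Ω z) ∧
      u (algebraMap F Ω (Algebra.trace F K (y * z))) = u (algebraMap K Ω y) := by
  by_contra! hcon
  let O := (u.comap (algebraMap K Ω)).integers
  have hO : ∀ (σ : K →ₐ[F] Ω) (z : O), 0 ≤ u (σ (z : K)) := fun σ z => by
    rw [AddValuation.val_algHom_apply hinv]; exact z.2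
  let χ : (K →ₐ[F] Ω) → (O →* u.Residue) := fun σ =>
    ((IsLocalRing.residue u.integers).comp
      (((σ : K →+* Ω).comp O.subtype).codRestrict u.integers.toSubring (hO σ))).toMonoidHom
  have hχ : ∀ σ z, χ σ z = IsLocalRing.residue u.integers ⟨σ (z : K), hO σ z⟩ :=
    fun _ _ => rfl
  have hinj : Function.Injective χ := by
    intro σ σ' h
    refine hsep σ σ' fun z hz => ?_
    have := DFunLike.congr_fun h (⟨z, hz⟩ : O)
    rwa [hχ, hχ, ← sub_eq_zero, ← map_sub, u.residue_eq_zero_iff] at this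
  have hy' : algebraMap K Ω y ≠ 0 := by simpa using hy
  obtain ⟨r, hr⟩ := u.exists_coe hy'
  have hdiv : ∀ x : Ω, u (x / algebraMap K Ω y) = u x - r := fun x => by rw [u.map_div, hr]
  have hc : ∀ σ : K →ₐ[F] Ω, 0 ≤ u (σ y / algebraMap K Ω y) := fun σ => by
    rw [hdiv, AddValuation.val_algHom_apply hinv, hr, ← WithTop.LinearOrderedAddCommGroup.coe_sub,
      sub_self, WithTop.coe_zero]
  have hli := (linearIndependent_monoidHom O u.Residue).comp χ hinj
  rw [Fintype.linearIndependent_iff] at hli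
  have h1 := hli (fun σ => IsLocalRing.residue u.integers ⟨_, hc σ⟩) (by
    ext z
    rw [Finset.sum_apply, Pi.zero_apply]
    simp only [Pi.smul_apply, Function.comp_apply, hχ, smul_eq_mul, ← map_mul, ← map_sum]
    rw [u.residue_eq_zero_iff]
    have h2 : ((∑ σ : K →ₐ[F] Ω, (⟨_, hc σ⟩ : u.integers) * ⟨σ (z : K), hO σ z⟩ :
        u.integers) : Ω) =
        algebraMap F Ω (Algebra.trace F K (y * (z : K))) / algebraMap K Ω y := by
      rw [trace_eq_sum_embeddings_of_isGalois, Finset.sum_div]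
      push_cast
      refine Finset.sum_congr rfl fun σ _ => ?_
      change σ y / algebraMap K Ω y * σ z = σ (y * z) / algebraMap K Ω y
      rw [map_mul]
      ring
    rw [h2, hdiv]
    have h3 : (r : WithTop ℝ) ≤ u (algebraMap F Ω (Algebra.trace F K (y * (z : K)))) := by
      rw [trace_eq_sum_embeddings_of_isGalois]
      refine u.map_le_sum fun σ _ => ?_
      rw [map_mul, u.map_mul, AddValuation.val_algHom_apply hinv, hr]
      exact le_add_of_nonneg_right (hO σ z)
    have h4 := hcon z z.2
    rw [hr] at h4
    generalize u (algebraMap F Ω (Algebra.trace F K (y * (z : K)))) = a at h3 h4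
    induction a with
    | top => simp
    | coe s =>
      rw [← WithTop.LinearOrderedAddCommGroup.coe_sub]
      have : r < s := WithTop.coe_lt_coe.1 (lt_of_le_of_ne h3 h4.symm)
      exact_mod_cast sub_pos.2 this) (IsScalarTower.toAlgHom F K Ω)
  rw [u.residue_eq_zero_iff] at h1
  change 0 < u (algebraMap K Ω y / algebraMap K Ω y) at h1
  rw [div_self hy', u.map_one] at h1
  exact lt_irrefl _ h1

end UnramifiedTrace

section UnramifiedPart

variable {F E Ω : Type*} [Field F] [Field E] [Field Ω] [Algebra F E] [Algebra E Ω] [Algebra F Ω]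
  {u : AddValuation Ω (WithTop ℝ)}

variable (F E u) in
/-- The subextension of `E` generated by the unramified elements. -/
def unramifiedPart : IntermediateField F E :=
  IntermediateField.adjoin F {t : E | IsUnramifiedElt F u (algebraMap E Ω t)}

lemma mem_unramifiedPart {t : E} (ht : IsUnramifiedElt F u (algebraMap E Ω t)) :
    t ∈ unramifiedPart F E u :=
  IntermediateField.subset_adjoin _ _ ht

variable [IsScalarTower F E Ω]

/-- An embedding fixing the unramified elements is an embedding over the unramified part. -/
lemma exists_algHom_unramifiedPart (σ : E →ₐ[F] Ω)
    (hσ : ∀ t : E, IsUnramifiedElt F u (algebraMap E Ω t) → σ t = algebraMap E Ω t) :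
    ∃ σ' : E →ₐ[unramifiedPart F E u] Ω, ∀ x, σ' x = σ x := by
  have key : ∀ x : unramifiedPart F E u, σ (x : E) = algebraMap E Ω (x : E) := by
    have : σ.comp (unramifiedPart F E u).val =
        (IsScalarTower.toAlgHom F E Ω).comp (unramifiedPart F E u).val :=
      IntermediateField.algHom_ext_of_eq_adjoin _ rfl fun x hx => hσ x hx
    exact fun x => DFunLike.congr_fun this x
  exact ⟨{ σ with commutes' := key }, fun _ => rfl⟩

variable [IsGalois F Ω]

lemma algHom_eq_of_unramified_of_sub_pos (hinv : ∀ (τ : Ω →ₐ[F] Ω) (x : Ω), u (τ x) = u x)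
    {t : Ω} (ht : IsUnramifiedElt F u t) {τ τ' : Ω →ₐ[F] Ω} (h : 0 < u (τ t - τ' t)) :
    τ t = τ' t := by
  let ρ : Ω ≃ₐ[F] Ω := AlgEquiv.ofBijective τ' (Algebra.IsAlgebraic.algHom_bijective τ')
  have hρ : ∀ x, τ' x = ρ x := fun _ => rfl
  have h1 := ht.2 ((ρ.symm : Ω →ₐ[F] Ω).comp τ) (by
    rw [← hinv τ', map_sub]
    simpa [hρ] using h)
  have h2 : ρ.symm (τ t) = t := h1
  rw [hρ, ← ρ.symm_apply_eq, h2]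

lemma algHom_ext_of_adjoin_unramified (hinv : ∀ (τ : Ω →ₐ[F] Ω) (x : Ω), u (τ x) = u x)
    {S : Set E} (hS : ∀ t ∈ S, IsUnramifiedElt F u (algebraMap E Ω t))
    (σ σ' : IntermediateField.adjoin F S →ₐ[F] Ω)
    (h : ∀ z : IntermediateField.adjoin F S, 0 ≤ u (algebraMap _ Ω z) → 0 < u (σ z - σ' z)) :
    σ = σ' := by
  obtain ⟨τ, hτ⟩ := exists_extend_algHom σ
  obtain ⟨τ', hτ'⟩ := exists_extend_algHom σ'
  refine IntermediateField.algHom_ext_of_eq_adjoin _ rfl fun x hx => ?_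
  have h1 := h ⟨x, IntermediateField.subset_adjoin _ _ hx⟩ (hS x hx).1
  rw [← hτ, ← hτ'] at h1 ⊢
  exact algHom_eq_of_unramified_of_sub_pos hinv (hS x hx) h1

lemma val_unramifiedPart (hinv : ∀ (τ : Ω →ₐ[F] Ω) (x : Ω), u (τ x) = u x)
    (hF : ∀ x : F, x ≠ 0 → ∃ k : ℤ, u (algebraMap F Ω x) = ((k : ℝ) : WithTop ℝ))
    {y : unramifiedPart F E u} (hy : y ≠ 0) :
    ∃ k : ℤ, u (algebraMap _ Ω y) = ((k : ℝ) : WithTop ℝ) := by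
  obtain ⟨S, hS, hyS⟩ := IntermediateField.exists_finset_of_mem_adjoin y.2
  have : FiniteDimensional F (IntermediateField.adjoin F (S : Set E)) :=
    IntermediateField.finiteDimensional_adjoin fun x _ => isIntegral_bot_of_isGalois F Ω x
  have hyE : (y : E) ≠ 0 := by simpa using hy
  obtain ⟨z, -, hz⟩ := exists_val_trace_eq (K := IntermediateField.adjoin F (S : Set E)) hinv
    (algHom_ext_of_adjoin_unramified hinv fun t ht => hS ht) (y := ⟨y, hyS⟩)
    (fun h => hyE (congrArg Subtype.val h))
  change _ = u (algebraMap _ Ω y) at hz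
  rw [← hz]
  refine hF _ fun h => ?_
  rw [h, map_zero, u.map_zero] at hz
  exact u.ne_top (by simpa using hy) hz.symm

lemma exists_val_trace_unramifiedPart_eq_zero
    (hinv : ∀ (τ : Ω →ₐ[F] Ω) (x : Ω), u (τ x) = u x)
    [FiniteDimensional F (unramifiedPart F E u)] :
    ∃ z : unramifiedPart F E u, 0 ≤ u (algebraMap _ Ω z) ∧
      u (algebraMap F Ω (Algebra.trace F (unramifiedPart F E u) z)) = 0 := by
  have hsep : ∀ σ σ' : unramifiedPart F E u →ₐ[F] Ω, (∀ z : unramifiedPart F E u,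
      0 ≤ u (algebraMap _ Ω z) → 0 < u (σ z - σ' z)) → σ = σ' :=
    algHom_ext_of_adjoin_unramified hinv fun t ht => ht
  obtain ⟨z, hz, h⟩ := exists_val_trace_eq hinv hsep one_ne_zero
  exact ⟨z, hz, by simpa using h⟩

variable [IsSepClosed Ω] [PerfectField (u.comap (algebraMap F Ω)).Residue]

lemma exists_unramified_approx (hinv : ∀ (τ : Ω →ₐ[F] Ω) (x : Ω), u (τ x) = u x)
    {x : E} (hx : 0 ≤ u (algebraMap E Ω x)) :
    ∃ t : E, IsUnramifiedElt F u (algebraMap E Ω t) ∧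
      0 < u (algebraMap E Ω x - algebraMap E Ω t) := by
  obtain ⟨t, ht, hxt⟩ := exists_isUnramifiedElt hinv hx
  obtain ⟨t, rfl⟩ := mem_range_of_fixed (K := F) (E := E) (x := t) fun τ hτ => by
    refine ht.2 τ ?_
    have : τ t - t = (algebraMap E Ω x - t) - τ (algebraMap E Ω x - t) := by
      rw [map_sub, hτ]; ring
    rw [this]
    exact lt_of_lt_of_le (lt_min hxt (by rwa [hinv])) (u.map_sub _ _)
  exact ⟨t, ht, hxt⟩

/-- Any extension of ramification index `e` is totally ramified over its unramified part. -/
lemma isTotRam_unramifiedPart (hinv : ∀ (τ : Ω →ₐ[F] Ω) (x : Ω), u (τ x) = u x)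
    (hF : ∀ x : F, x ≠ 0 → ∃ k : ℤ, u (algebraMap F Ω x) = ((k : ℝ) : WithTop ℝ))
    {ϖ : F} (hϖ : u (algebraMap F Ω ϖ) = (1 : ℝ)) {e : ℕ} (he : 0 < e)
    (hE : ∀ x : E, x ≠ 0 → ∃ k : ℤ, u (algebraMap E Ω x) = ((k / e : ℝ) : WithTop ℝ))
    {π : E} (hπ : u (algebraMap E Ω π) = ((1 / e : ℝ) : WithTop ℝ)) :
    IsTotRam u e (algebraMap F (unramifiedPart F E u) ϖ) π where
  pos := he
  val_base x hx := val_unramifiedPart hinv hF hx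
  val_unif_base := by rwa [← IsScalarTower.algebraMap_apply]
  val_top := hE
  val_unif := hπ
  val_algHom σ x := AddValuation.val_algHom_apply hinv (σ.restrictScalars F) x
  approx x hx := by
    obtain ⟨t, ht, hxt⟩ := exists_unramified_approx (F := F) hinv hx
    exact ⟨⟨t, mem_unramifiedPart ht⟩, ht.1, hxt⟩

end UnramifiedPart

namespace IsTotRam

section Integral

variable {K E Ω : Type*} [Field K] [Field E] [Field Ω] [Algebra K E] [Algebra E Ω] [Algebra K Ω]
  {u : AddValuation Ω (WithTop ℝ)} {e : ℕ} {ϖ : K} {π : E}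

variable (K u e π) in
/-- The number of `K`-embeddings `σ` of `E` with `(t + 1) / e ≤ u (σ π - π)`. -/
def lowerCard (t : ℝ) : ℕ :=
  Nat.card {σ : E →ₐ[K] Ω // (((t + 1) / e : ℝ) : WithTop ℝ) ≤ u (σ π - algebraMap E Ω π)}

variable (h : IsTotRam u e ϖ π)
include h

lemma one_div_le (σ : E →ₐ[K] Ω) :
    ((1 / e : ℝ) : WithTop ℝ) ≤ u (σ π - algebraMap E Ω π) :=
  u.map_le_sub (by rw [h.val_algHom, h.val_unif]) h.val_unif.ge

variable [IsScalarTower K E Ω] [IsGalois K Ω]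

lemma finite_algHom : Finite (E →ₐ[K] Ω) :=
  have := h.finiteDimensional
  inferInstance

lemma natCard_algHom : Nat.card (E →ₐ[K] Ω) = e := by
  rw [h.card_algHom, h.finrank_eq]

lemma lowerCard_zero : lowerCard K u e π 0 = e := by
  refine (Nat.card_congr (Equiv.subtypeUnivEquiv fun σ => ?_)).trans h.natCard_algHom
  rw [zero_add]
  exact h.one_div_le σ

/-- For a totally ramified extension, `ψ(l) = e (l + 1) - D - 1` where `D / e` is the valuation
of the derivative of the minimal polynomial of a uniformizer. -/
lemma eq_of_integral_lowerCard {s l : ℝ}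
    (htriv : ∀ σ : E →ₐ[K] Ω, (((s + 1) / e : ℝ) : WithTop ℝ) ≤ u (σ π - algebraMap E Ω π) →
      σ = IsScalarTower.toAlgHom K E Ω)
    (hint : ∫ t in (0 : ℝ)..s, ((lowerCard K u e π t : ℝ) / (lowerCard K u e π 0 : ℝ)) = l)
    {D : ℤ} (hD : u (algebraMap E Ω (aeval π (derivative (minpoly K π)))) =
      ((D / e : ℝ) : WithTop ℝ)) :
    s = e * (l + 1) - D - 1 := by
  have := h.finite_algHom
  have : Fintype (E →ₐ[K] Ω) := Fintype.ofFinite _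
  set ι := IsScalarTower.toAlgHom K E Ω with hι
  set B := Finset.univ.erase ι with hB
  have hne : ∀ σ ∈ B, σ π - algebraMap E Ω π ≠ 0 := fun σ hσ h0 =>
    (Finset.mem_erase.1 hσ).1 (h.algHom_ext (sub_eq_zero.1 h0))
  set c : (E →ₐ[K] Ω) → ℝ := fun σ => (u (σ π - algebraMap E Ω π)).untopD 0 with hc
  have hcu : ∀ σ ∈ B, u (σ π - algebraMap E Ω π) = c σ := by
    intro σ hσ
    obtain ⟨r, hr⟩ := u.exists_coe (hne σ hσ)
    simp only [hc, hr, WithTop.untopD_coe]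
  have he := h.e_pos
  have hc0 : ∀ σ ∈ B, 0 ≤ e * c σ - 1 := by
    intro σ hσ
    have := h.one_div_le σ
    rw [hcu σ hσ, WithTop.coe_le_coe, div_le_iff₀' he] at this
    linarith
  have hcs : ∀ σ ∈ B, e * c σ - 1 ≤ s := by
    intro σ hσ
    by_contra! hlt
    refine (Finset.mem_erase.1 hσ).1 (htriv σ ?_)
    rw [hcu σ hσ, WithTop.coe_le_coe, div_le_iff₀' he]
    linarith
  have hsum : ∑ σ ∈ B, c σ = D / e := by
    have key : ∀ s ⊆ B, u (∏ σ ∈ s, (algebraMap E Ω π - σ π)) =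
        ((∑ σ ∈ s, c σ : ℝ) : WithTop ℝ) := by
      intro s
      induction s using Finset.induction_on with
      | empty => simp
      | insert σ s hσ ih =>
        intro hs
        rw [Finset.prod_insert hσ, u.map_mul, ih fun y hy => hs (Finset.mem_insert_of_mem hy),
          Finset.sum_insert hσ, u.map_sub_swap, hcu σ (hs (Finset.mem_insert_self _ _)),
          WithTop.coe_add]
    have h1 := key B subset_rfl
    rw [hB, hι, ← aeval_derivative_minpoly_eq_prod fun _ _ => h.algHom_ext, hD,
      WithTop.coe_inj] at h1
    exact h1.symm
  have hcardB : (B.card : ℝ) = e - 1 := by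
    have h1 := Finset.card_erase_add_one (Finset.mem_univ ι)
    rw [Finset.card_univ, Fintype.card_eq_nat_card, h.natCard_algHom] at h1
    rw [← h1]
    push_cast
    ring
  have hN : ∀ t : ℝ, (lowerCard K u e π t : ℝ) =
      1 + ∑ σ ∈ B, Set.indicator {x | x ≤ e * c σ - 1} (fun _ => (1 : ℝ)) t := by
    intro t
    rw [lowerCard, Nat.card_eq_fintype_card, Fintype.card_subtype, Finset.card_filter,
      ← Finset.add_sum_erase _ _ (Finset.mem_univ ι), if_pos]
    · push_cast
      congr 1
      refine Finset.sum_congr rfl fun σ hσ => ?_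
      rw [hcu σ hσ, Set.indicator_apply]
      refine if_congr ?_ rfl rfl
      rw [WithTop.coe_le_coe, div_le_iff₀' he, Set.mem_ofPred_eq, le_sub_iff_add_le]
    · have : ι π - algebraMap E Ω π = 0 := sub_self _
      rw [this, u.map_zero]
      exact le_top
  have hii : ∀ a : ℝ, IntervalIntegrable
      (Set.indicator {x | x ≤ a} (fun _ => (1 : ℝ))) MeasureTheory.volume 0 s := fun a =>
    ⟨(intervalIntegrable_const (c := (1 : ℝ))).1.indicator measurableSet_Iic,
      (intervalIntegrable_const (c := (1 : ℝ))).2.indicator measurableSet_Iic⟩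
  simp only [h.lowerCard_zero, hN, intervalIntegral.integral_div] at hint
  rw [intervalIntegral.integral_add intervalIntegrable_const
    (by simpa only [Finset.sum_fn] using
      IntervalIntegrable.sum B fun σ _ => hii (e * c σ - 1)),
    intervalIntegral.integral_finsetSum fun σ _ => hii _] at hint
  rw [Finset.sum_congr rfl fun σ hσ =>
    (intervalIntegral.integral_indicator ⟨hc0 σ hσ, hcs σ hσ⟩).trans
      (intervalIntegral.integral_const _)] at hint
  simp only [intervalIntegral.integral_const, smul_eq_mul, mul_one, sub_zero,
    Finset.sum_sub_distrib, ← Finset.mul_sum, hsum, Finset.sum_const, nsmul_eq_mul, hcardB] at hint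
  rw [mul_div_cancel₀ _ he.ne', div_eq_iff he.ne'] at hint
  linarith

end Integral

section Different

variable {F K E Ω : Type*} [Field F] [Field K] [Field E] [Field Ω] [Algebra F K] [Algebra K E]
  [Algebra F E] [Algebra E Ω] [Algebra K Ω] [Algebra F Ω] [IsScalarTower F K E]
  [IsScalarTower K E Ω] [IsScalarTower F K Ω]
  [IsGalois F Ω] [FiniteDimensional F K]
  {u : AddValuation Ω (WithTop ℝ)} {e : ℕ} {ϖ : F} {π : E}

/-- The exponent of the different is the valuation of the derivative of the minimal polynomial
of a uniformizer over the unramified part. -/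
lemma eq_of_trace_dual (h : IsTotRam u e (algebraMap F K ϖ) π)
    (hinv : ∀ (τ : Ω →ₐ[F] Ω) (x : Ω), u (τ x) = u x)
    (hunit : ∃ z : K, 0 ≤ u (algebraMap K Ω z) ∧
      u (algebraMap F Ω (Algebra.trace F K z)) = 0)
    {D d : ℤ} (hD : u (algebraMap E Ω (aeval π (derivative (minpoly K π)))) =
      ((D / e : ℝ) : WithTop ℝ))
    (hd : ∀ x : E, (∀ y : E, 0 ≤ u (algebraMap E Ω y) →
      0 ≤ u (algebraMap F Ω (Algebra.trace F E (x * y)))) ↔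
        ((-d / e : ℝ) : WithTop ℝ) ≤ u (algebraMap E Ω x)) : d = D := by
  have : IsGalois K Ω := IsGalois.tower_top_of_isGalois F K Ω
  have := h.finiteDimensional
  have he := h.e_pos
  set δ := aeval π (derivative (minpoly K π)) with hδ
  have hδ0 : δ ≠ 0 := aeval_derivative_minpoly_ne_zero K Ω π
  have hneg : ∀ a : ℝ, -((a : ℝ) : WithTop ℝ) = ((-a : ℝ) : WithTop ℝ) := fun _ => rfl
  refine le_antisymm ?_ ?_
  · by_contra! hlt
    have hlt' : (D : ℝ) + 1 ≤ d := by exact_mod_cast hlt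
    obtain ⟨z, hz, hzt⟩ := hunit
    have hϖ0 : algebraMap F K ϖ ≠ 0 := h.unif_base_ne_zero
    have hπ0 := h.unif_ne_zero
    have h1 := (hd (π⁻¹ / δ)).2 (by
      rw [map_div₀, map_inv₀, u.map_div, u.map_inv, hD, h.val_unif, hneg,
        ← WithTop.LinearOrderedAddCommGroup.coe_sub, WithTop.coe_le_coe, ← neg_div, ← sub_div]
      exact div_le_div_of_nonneg_right (by linarith) he.le)
    have h2 := h1 (algebraMap K E (z / algebraMap F K ϖ) * π ^ e) (by
      rw [map_mul, ← IsScalarTower.algebraMap_apply, u.map_mul, map_div₀, u.map_div,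
        h.val_unif_base, map_pow, u.map_pow, h.val_unif, ← WithTop.coe_nsmul]
      have h3 : e • (1 / e : ℝ) = 1 := by
        rw [nsmul_eq_mul, mul_one_div_cancel he.ne']
      rw [h3]
      generalize u (algebraMap K Ω z) = a at hz
      induction a with
      | top => simp
      | coe r =>
        rw [← WithTop.LinearOrderedAddCommGroup.coe_sub, ← WithTop.coe_add, sub_add_cancel]
        exact hz)
    have h3 : π⁻¹ / δ * (algebraMap K E (z / algebraMap F K ϖ) * π ^ e) =
        (z / algebraMap F K ϖ) • (π ^ (e - 1) / δ) := by
      obtain ⟨n, rfl⟩ : ∃ n, e = n + 1 := ⟨e - 1, (Nat.sub_add_cancel h.pos).symm⟩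
      rw [Algebra.smul_def, Nat.add_sub_cancel]
      field_simp
      ring
    have hpos := h.pos
    rw [h3, ← Algebra.trace_trace (S := K), map_smul,
      h.trace_pow_div _ (by rw [h.finrank_eq]; omega), h.finrank_eq, if_pos rfl, smul_eq_mul,
      mul_one, div_eq_inv_mul, ← map_inv₀, ← Algebra.smul_def, map_smul, smul_eq_mul, map_mul,
      u.map_mul, hzt, map_inv₀, u.map_inv, add_zero, IsScalarTower.algebraMap_apply F K Ω,
      h.val_unif_base, hneg] at h2
    have : (0 : ℝ) ≤ -1 := by exact_mod_cast h2
    linarith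
  · have h1 := (hd (1 / δ)).1 (fun y hy => by
      have hN : (0 : WithTop ℝ) ≤ u (algebraMap K Ω (Algebra.trace K E (y / δ))) := by
        obtain ⟨g, hg, hgi, hyg⟩ := h.exists_polynomial_approx hy D.toNat
        have h2 : y / δ = (y - aeval π g) / δ + aeval π g / δ := by ring
        rw [h2, map_add, map_add, h.trace_aeval_div hg]
        refine u.map_le_add ?_ (hgi _)
        refine h.val_trace_le (r := 0) ?_
        rw [map_div₀, u.map_div, hD]
        generalize u (algebraMap E Ω (y - aeval π g)) = a at hyg
        induction a with
        | top => simp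
        | coe r =>
          rw [← WithTop.LinearOrderedAddCommGroup.coe_sub, WithTop.coe_le_coe, sub_nonneg]
          refine le_trans (div_le_div_of_nonneg_right ?_ he.le) (WithTop.coe_le_coe.1 hyg)
          exact_mod_cast D.self_le_toNat
      rw [one_div_mul_eq_div, ← Algebra.trace_trace (S := K), trace_eq_sum_embeddings_of_isGalois]
      refine u.map_le_sum fun σ _ => ?_
      rwa [AddValuation.val_algHom_apply hinv])
    rw [one_div, map_inv₀, u.map_inv, hD, hneg, WithTop.coe_le_coe, ← neg_div,
      div_le_div_iff_of_pos_right he] at h1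
    have : (D : ℝ) ≤ d := by linarith
    exact_mod_cast this

end Different

end IsTotRam

section Transfer

variable {F Ω : Type*} [Field F] [Field Ω] [Algebra F Ω]
  {V : AddVal Ω} {E : IntermediateField F Ω} {e : ℕ}

section

variable [IsGalois F Ω] {π : E} {ϖ : unramifiedPart F E V.val} (h : IsTotRam V.val e ϖ π)
include h

/-- The ramification relation only depends on the image of a uniformizer. -/
lemma xiRel_val_iff {t : ℝ} (ht : 0 ≤ t) (σ : E →ₐ[F] Ω) :
    xiRel V E e t σ E.val ↔ ∃ σ' : E →ₐ[unramifiedPart F E V.val] Ω, (∀ x, σ' x = σ x) ∧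
      (((t + 1) / e : ℝ) : WithTop ℝ) ≤ V.val (σ' π - algebraMap E Ω π) := by
  have : IsGalois (unramifiedPart F E V.val) Ω := IsGalois.tower_top_of_isGalois F _ Ω
  have he := h.e_pos
  constructor
  · intro hσ
    obtain ⟨τ, hτ⟩ := exists_extend_algHom σ
    obtain ⟨σ', hσ'⟩ := exists_algHom_unramifiedPart (u := V.val) σ fun x hx => by
      rw [← hτ]
      refine hx.2 τ (lt_of_lt_of_le ?_ ((hσ x hx.1).trans_eq ?_))
      · rw [← WithTop.coe_zero, WithTop.coe_lt_coe]
        positivity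
      · rw [hτ]; rfl
    refine ⟨σ', hσ', ?_⟩
    rw [hσ']
    refine hσ π ?_
    rw [← V.val_apply, ← IntermediateField.algebraMap_apply, h.val_unif, ← WithTop.coe_zero,
      WithTop.coe_le_coe]
    positivity
  · rintro ⟨σ', hσ', hle⟩ x hx
    rw [← hσ']
    exact hle.trans (h.val_sub_le σ' (IsScalarTower.toAlgHom _ E Ω) hx)

lemma gfun_eq_lowerCard {t : ℝ} (ht : 0 ≤ t) :
    gfun V E e t = IsTotRam.lowerCard (unramifiedPart F E V.val) V.val e π t := by
  symm
  refine Nat.card_eq_of_bijective (fun σ => ⟨σ.1.restrictScalars F,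
    (xiRel_val_iff h ht _).2 ⟨σ.1, fun _ => rfl, σ.2⟩⟩) ⟨fun σ σ' hσ => ?_, fun σ => ?_⟩
  · refine Subtype.ext (AlgHom.ext fun x => ?_)
    exact DFunLike.congr_fun (congrArg Subtype.val hσ) x
  · obtain ⟨σ', hσ', hle⟩ := (xiRel_val_iff h ht σ.1).1 σ.2
    exact ⟨⟨σ', hle⟩, Subtype.ext (AlgHom.ext hσ')⟩

lemma herbrand_eq_integral {s : ℝ} (hs : 0 ≤ s) :
    herbrand V E e s = ∫ t in (0 : ℝ)..s,
      ((IsTotRam.lowerCard (unramifiedPart F E V.val) V.val e π t : ℝ) /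
        (IsTotRam.lowerCard (unramifiedPart F E V.val) V.val e π 0 : ℝ)) := by
  refine intervalIntegral.integral_congr fun t ht => ?_
  rw [Set.uIcc_of_le hs] at ht
  simp only [gfun_eq_lowerCard h ht.1, gfun_eq_lowerCard h le_rfl]

end

variable {E₀ : IntermediateField F Ω} (hE : E₀ ≤ E)
lemma exists_restrict_algHom (σ : E →ₐ[unramifiedPart F E V.val] Ω) :
    ∃ σ₀ : E₀ →ₐ[unramifiedPart F E₀ V.val] Ω,
      ∀ x, σ₀ x = σ (IntermediateField.inclusion hE x) :=
  exists_algHom_unramifiedPart ((σ.restrictScalars F).comp (IntermediateField.inclusion hE))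
    fun t ht => σ.commutes ⟨IntermediateField.inclusion hE t, mem_unramifiedPart ht⟩

lemma lowerCard_eq_of_le [IsGalois F Ω] {π₀ : E₀} {ϖ₀ : unramifiedPart F E₀ V.val}
    {ϖ : unramifiedPart F E V.val} (h₀ : IsTotRam V.val e ϖ₀ π₀)
    (h : IsTotRam V.val e ϖ (IntermediateField.inclusion hE π₀)) (t : ℝ) :
    IsTotRam.lowerCard (unramifiedPart F E₀ V.val) V.val e π₀ t =
      IsTotRam.lowerCard (unramifiedPart F E V.val) V.val e
        (IntermediateField.inclusion hE π₀) t := by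
  have : IsGalois (unramifiedPart F E V.val) Ω := IsGalois.tower_top_of_isGalois F _ Ω
  have : IsGalois (unramifiedPart F E₀ V.val) Ω := IsGalois.tower_top_of_isGalois F _ Ω
  choose r hr using exists_restrict_algHom (V := V) hE
  have := h₀.finite_algHom
  have hinj : Function.Injective r := fun σ σ' hσ => h.algHom_ext (by rw [← hr, ← hr, hσ])
  have hbij := hinj.bijective_of_nat_card_le (by rw [h.natCard_algHom, h₀.natCard_algHom])
  refine (Nat.card_congr ((Equiv.ofBijective r hbij).subtypeEquiv fun σ => ?_)).symm
  rw [Equiv.ofBijective_apply, hr]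
  rfl

/-- If `l` bounds the ramification of `E`, then `ψ(l)` is beyond the last lower ramification
jump of `E`. -/
lemma eq_of_atMostRamified [IsGalois F Ω] {π : E} {ϖ : F}
    (h : ∀ {E₀ : IntermediateField F Ω} {π₀ : E₀}, E₀ ≤ E → (π₀ : Ω) = π →
      IsTotRam V.val e (algebraMap F (unramifiedPart F E₀ V.val) ϖ) π₀)
    {l : ℝ} (hram : atMostRamified V E l) {s : ℝ} (hs : 0 ≤ s) (hl : herbrand V E e s = l)
    (σ : E →ₐ[unramifiedPart F E V.val] Ω)
    (hσ : (((s + 1) / e : ℝ) : WithTop ℝ) ≤ V.val (σ π - algebraMap E Ω π)) :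
    σ = IsScalarTower.toAlgHom (unramifiedPart F E V.val) E Ω := by
  have : IsGalois (unramifiedPart F E V.val) Ω := IsGalois.tower_top_of_isGalois F _ Ω
  let E₀ : IntermediateField F Ω := IntermediateField.adjoin F {(π : Ω)}
  have hE : E₀ ≤ E := by
    rw [IntermediateField.adjoin_le_iff, Set.singleton_subset_iff]
    exact π.2
  have hfin : FiniteDimensional F E₀ :=
    IntermediateField.adjoin.finiteDimensional (Algebra.IsIntegral.isIntegral _)
  let π₀ : E₀ := ⟨π, IntermediateField.mem_adjoin_simple_self F _⟩
  have h₀ : IsTotRam V.val e (algebraMap F (unramifiedPart F E₀ V.val) ϖ) π₀ := h hE rfl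
  have h₁ : IsTotRam V.val e (algebraMap F (unramifiedPart F E V.val) ϖ)
    (IntermediateField.inclusion hE π₀) := h le_rfl rfl
  have hl₀ : herbrand V E₀ e s = l := by
    rw [← hl, herbrand_eq_integral h₀ hs, herbrand_eq_integral h₁ hs]
    simp only [lowerCard_eq_of_le hE h₀ h₁]
  obtain ⟨σ₀, hσ₀⟩ := exists_restrict_algHom (V := V) hE σ
  have hσ₀π : σ₀ π₀ = σ π := hσ₀ π₀
  have hrefl : σ₀.restrictScalars F = E₀.val := by
    refine hram E₀ hE hfin e s ⟨h₀.pos, h₀.val_top, π₀, h₀.val_unif⟩ hs hl₀ _ _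
      ((xiRel_val_iff h₀ hs _).2 ⟨σ₀, fun _ => rfl, ?_⟩)
    rw [hσ₀π]
    exact hσ
  refine h₁.algHom_ext ?_
  rw [← hσ₀]
  exact DFunLike.congr_fun hrefl π₀

end Transfer

end

/-- Let `l` be a positive integer and `E/F` finitely ramified, at most
`l`-ramified and separable.  Then `ψ_{E/F}(l)` is an integer; moreover, if `E/F` is
finite then `ψ_{E/F}(l) = e(E/F)·(l+1) - val_E(𝔡_{E/F}) - 1`, where `d = val_E(𝔡_{E/F})`
is the normalized valuation of the different of `E/F`, characterized by the trace-dual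
property: for `x ∈ E`, `Tr_{E/F}(x·O_E) ⊆ O_F` iff `val_E(x) ≥ -d`
(i.e. `V.v x ≥ -d/e`). -/
theorem psi_of_l_integer_and_different_formula
    {F Ω : Type*} [Field F] [Field Ω] [Algebra F Ω] [IsSepClosure F Ω]
    (V : AddVal Ω) (hnorm : V.IsNormalizedOn F) (hhens : V.IsHenselianOn F)
    (hperf : V.HasPerfectResidueFieldOn F)
    (E : IntermediateField F Ω) (e : ℕ) (he : V.IsRamIdx E e)
    (l : ℕ) (hl : 0 < l) (hram : atMostRamified V E (l : ℝ)) :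
    (∀ s : ℝ, 0 ≤ s → herbrand V E e s = (l : ℝ) → ∃ k : ℤ, s = (k : ℝ)) ∧
    (FiniteDimensional F ↥E →
      ∀ d : ℤ,
        (∀ x : ↥E,
          (∀ y : ↥E, 0 ≤ V.v (y : Ω) →
            0 ≤ V.v (algebraMap F Ω (Algebra.trace F ↥E (x * y)))) ↔
          (((-(d : ℝ) / (e : ℝ) : ℝ)) : WithTop ℝ) ≤ V.v (x : Ω)) →
        ∀ s : ℝ, 0 ≤ s → herbrand V E e s = (l : ℝ) →
          s = (e : ℝ) * ((l : ℝ) + 1) - (d : ℝ) - 1) := by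
  have hgal : IsGalois F Ω := IsSepClosure.isGalois
  have hclosed : IsSepClosed Ω := IsSepClosure.sep_closed F
  have hres := V.perfectField_residue hperf
  have hinv := AddVal.val_algHom_eq hnorm hhens
  obtain ⟨ϖ, hϖ⟩ := hnorm.2
  obtain ⟨π, hπ⟩ := he.2.2
  have htot : ∀ {E₀ : IntermediateField F Ω} {π₀ : E₀}, E₀ ≤ E → (π₀ : Ω) = π →
      IsTotRam V.val e (algebraMap F (unramifiedPart F E₀ V.val) ϖ) π₀ := fun {E₀ π₀} hE₀ hπ₀ =>
    isTotRam_unramifiedPart hinv hnorm.1 hϖ he.1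
      (fun x hx => he.2.1 (IntermediateField.inclusion hE₀ x) (by simpa using hx))
      ((congrArg V.v hπ₀).trans hπ)
  have h := htot le_rfl (rfl : (π : Ω) = π)
  have : IsGalois (unramifiedPart F E V.val) Ω := IsGalois.tower_top_of_isGalois F _ Ω
  obtain ⟨D, hD⟩ := h.val_top (Polynomial.aeval π
    (Polynomial.derivative (minpoly (unramifiedPart F E V.val) π)))
    (aeval_derivative_minpoly_ne_zero _ Ω π)
  have key : ∀ s : ℝ, 0 ≤ s → herbrand V E e s = (l : ℝ) → s = e * ((l : ℝ) + 1) - D - 1 :=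
    fun s hs hl => h.eq_of_integral_lowerCard (eq_of_atMostRamified htot hram hs hl)
      ((herbrand_eq_integral h hs).symm.trans hl) hD
  refine ⟨fun s hs hl => ⟨e * (l + 1) - D - 1, by rw [key s hs hl]; push_cast; ring⟩, ?_⟩
  intro hfin d hd s hs hl
  have : FiniteDimensional F (unramifiedPart F E V.val) :=
    IntermediateField.finiteDimensional_left _
  rw [key s hs hl, h.eq_of_trace_dual hinv (exists_val_trace_unramifiedPart_eq_zero hinv) hD hd]
end
end

section
/- Let F be a discretely valued Henselian field with perfect residue field, l a positive integer, and E/F a finitely ramified, at most l-ramified separable extension. Then l ≤ ψ_{E/F}(l) ≤ l·e(E/F), and the equality ψ_{E/F}(l) = l·e(E/F) holds if and only if E/F is tamely ramified. -/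
noncomputable section

open scoped Classical

namespace HenselianRamification

open Polynomial

section Integers

variable {K : Type*} [Field K] {B : AbsoluteValue K ℝ}

/-- The closed unit ball of a nonarchimedean absolute value, as a valuation subring. -/
def integers (hB : IsNonarchimedean B) : ValuationSubring K where
  carrier := {x | B x ≤ 1}
  mul_mem' {x y} hx hy := by
    simp only [Set.mem_ofPred_eq, map_mul] at *
    exact mul_le_one₀ hx (B.nonneg y) hy
  one_mem' := by simp
  add_mem' {x y} hx hy := (hB x y).trans (max_le hx hy)
  zero_mem' := by simp
  neg_mem' {x} hx := by simpa using hx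
  mem_or_inv_mem' x := by
    simp only [Set.mem_ofPred_eq, map_inv₀]
    rcases le_total (B x) 1 with h | h
    · exact Or.inl h
    · exact Or.inr (inv_le_one_of_one_le₀ h)

theorem mem_integers {hB : IsNonarchimedean B} {x : K} : x ∈ integers hB ↔ B x ≤ 1 :=
  Iff.rfl

theorem isUnit_integers_iff {hB : IsNonarchimedean B} {x : integers hB} :
    IsUnit x ↔ B (x : K) = 1 := by
  constructor
  · rintro ⟨u, rfl⟩
    refine le_antisymm u.1.2 ?_
    have h : B ((u : integers hB) : K) * B ((u⁻¹ : (integers hB)ˣ) : integers hB) = 1 := by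
      rw [← map_mul, ← MulMemClass.coe_mul, Units.mul_inv, OneMemClass.coe_one, map_one]
    have h2 : B (((u⁻¹ : (integers hB)ˣ) : integers hB) : K) ≤ 1 := (u⁻¹ : (integers hB)ˣ).1.2
    nlinarith [B.nonneg ((u : integers hB) : K)]
  · intro h
    have h0 : (x : K) ≠ 0 := by
      rintro h0
      simp [h0] at h
    refine IsUnit.of_mul_eq_one ⟨(x : K)⁻¹, ?_⟩ (Subtype.ext ?_)
    · rw [mem_integers, map_inv₀, h, inv_one]
    · simp [h0]

theorem residue_eq_zero_iff {hB : IsNonarchimedean B} {x : integers hB} :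
    IsLocalRing.residue (integers hB) x = 0 ↔ B (x : K) < 1 := by
  rw [IsLocalRing.residue_eq_zero_iff, IsLocalRing.mem_maximalIdeal, mem_nonunits_iff,
    isUnit_integers_iff]
  exact ⟨fun h => lt_of_le_of_ne x.2 h, fun h => h.ne⟩

theorem sub_le_max (hB : IsNonarchimedean B) (x y : K) : B (x - y) ≤ max (B x) (B y) := by
  simpa [sub_eq_add_neg] using hB x (-y)

theorem sub_le_max_sub (hB : IsNonarchimedean B) (x y z : K) :
    B (x - z) ≤ max (B (x - y)) (B (y - z)) := by
  simpa using hB (x - y) (y - z)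

theorem eq_of_sub_lt (hB : IsNonarchimedean B) {x y : K} (h : B (x - y) < B y) : B x = B y := by
  have := hB.add_eq_max_of_ne h.ne
  rwa [sub_add_cancel, max_eq_right h.le] at this

theorem sum_lt_of_forall_lt (hB : IsNonarchimedean B) {ι : Type*} (s : Finset ι) (f : ι → K)
    {c : ℝ} (hc : 0 < c) (h : ∀ i ∈ s, B (f i) < c) : B (∑ i ∈ s, f i) < c := by
  induction s using Finset.induction_on with
  | empty => simpa
  | insert i s hi ih =>
    rw [Finset.sum_insert hi]
    exact (hB _ _).trans_lt (max_lt (h i (by simp)) (ih fun j hj => h j (by simp [hj])))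

theorem sum_le_of_forall_le (hB : IsNonarchimedean B) {ι : Type*} (s : Finset ι) (f : ι → K)
    {c : ℝ} (hc : 0 ≤ c) (h : ∀ i ∈ s, B (f i) ≤ c) : B (∑ i ∈ s, f i) ≤ c := by
  induction s using Finset.induction_on with
  | empty => simpa
  | insert i s hi ih =>
    rw [Finset.sum_insert hi]
    exact (hB _ _).trans (max_le (h i (by simp)) (ih fun j hj => h j (by simp [hj])))

theorem multiset_sum_lt (hB : IsNonarchimedean B) (s : Multiset K)
    (h : ∀ x ∈ s, B x < 1) : B s.sum < 1 := by
  induction s using Multiset.induction_on with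
  | empty => simp
  | cons x s ih =>
    rw [Multiset.sum_cons]
    exact (hB _ _).trans_lt (max_lt (h x (by simp)) (ih fun y hy => h y (by simp [hy])))

theorem le_one_of_sub_lt (hB : IsNonarchimedean B) {x y : K} (hy : B y ≤ 1)
    (h : B (x - y) < 1) : B x ≤ 1 := by
  simpa using (hB (x - y) y).trans (max_le h.le hy)

theorem eval_le_one (hB : IsNonarchimedean B) {f : K[X]} (hf : ∀ i, B (f.coeff i) ≤ 1) {x : K}
    (hx : B x ≤ 1) : B (f.eval x) ≤ 1 := by
  rw [eval_eq_sum_range]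
  refine sum_le_of_forall_le hB _ _ zero_le_one fun i _ => ?_
  rw [map_mul, map_pow]
  exact mul_le_one₀ (hf i) (by positivity) (pow_le_one₀ (B.nonneg _) hx)

theorem coeff_derivative_le_one (hB : IsNonarchimedean B) {f : K[X]}
    (hf : ∀ i, B (f.coeff i) ≤ 1) (i : ℕ) : B ((derivative f).coeff i) ≤ 1 := by
  rw [coeff_derivative, map_mul]
  refine mul_le_one₀ (hf _) (B.nonneg _) ?_
  exact_mod_cast hB.apply_natCast_le_one (n := i + 1) (f := B)

theorem coeff_prod_le_one (hB : IsNonarchimedean B) (s : Multiset K) (hs : ∀ x ∈ s, B x ≤ 1)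
    (i : ℕ) : B ((s.map fun r => X - C r).prod.coeff i) ≤ 1 := by
  have h : (s.map fun r => X - C r).prod ∈ lifts (integers hB).subtype := by
    refine multiset_prod_mem _ fun p hp => ?_
    obtain ⟨r, hr, rfl⟩ := Multiset.mem_map.1 hp
    rw [lifts_iff_coeff_lifts]
    intro n
    refine ⟨⟨(X - C r).coeff n, ?_⟩, rfl⟩
    rw [coeff_sub, coeff_X, coeff_C]
    refine sub_mem ?_ ?_
    · split_ifs <;> simp
    · split_ifs
      · exact hs r hr
      · exact zero_mem _
  obtain ⟨y, hy⟩ := (lifts_iff_coeff_lifts _).1 h i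
  rw [← hy]
  exact y.2

end Integers

/-- Simple-root form of Hensel's lemma for `F` with respect to an absolute value on an
extension field. -/
def HasSimpleRoots (F : Type*) {K : Type*} [Field F] [Field K] [Algebra F K]
    (B : AbsoluteValue K ℝ) : Prop :=
  ∀ f : F[X], (∀ i, B (algebraMap F K (f.coeff i)) ≤ 1) → ∀ a₀ : F, B (algebraMap F K a₀) ≤ 1 →
    B (algebraMap F K (f.eval a₀)) < 1 → B (algebraMap F K ((derivative f).eval a₀)) = 1 →
    ∃ a : F, f.eval a = 0

section Invariance

variable {F K : Type*} [Field F] [Field K] [Algebra F K]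

/-- An element of a Galois extension of a Henselian field whose nontrivial conjugates lie in the
maximal ideal while it is itself a unit belongs to the base field. -/
theorem mem_range_of_conj_lt_one [IsGalois F K] {B : AbsoluteValue K ℝ}
    (hB : IsNonarchimedean B) (hens : HasSimpleRoots F B) {α : K} (hα : B α = 1)
    (h : ∀ g : K ≃ₐ[F] K, g α = α ∨ B (g α) < 1) : α ∈ Set.range (algebraMap F K) := by
  have hint : IsIntegral F α := Algebra.IsIntegral.isIntegral α
  set f := minpoly F α with hf
  have hmon : f.Monic := minpoly.monic hint
  have hsplit : (f.map (algebraMap F K)).Splits := Normal.splits' α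
  have hmonK : (f.map (algebraMap F K)).Monic := hmon.map _
  have hαroot : α ∈ (f.map (algebraMap F K)).roots := by
    rw [mem_roots hmonK.ne_zero, IsRoot.def, eval_map_algebraMap]
    exact minpoly.aeval F α
  have hnodup : (f.map (algebraMap F K)).roots.Nodup :=
    nodup_roots (Separable.map (Algebra.IsSeparable.isSeparable F α))
  obtain ⟨s, hs⟩ := Multiset.exists_cons_of_mem hαroot
  have hsB : ∀ r ∈ s, B r < 1 := by
    intro r hr
    have hr' : r ∈ (f.map (algebraMap F K)).roots := by
      rw [hs]
      exact Multiset.mem_cons_of_mem hr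
    rw [mem_roots hmonK.ne_zero, IsRoot.def, eval_map_algebraMap] at hr'
    obtain ⟨g, hg⟩ := minpoly.exists_algEquiv_of_root' hint.isAlgebraic hr'
    rcases h g with h1 | h1
    · rw [hs, Multiset.nodup_cons] at hnodup
      exact absurd (by rwa [← hg, h1] at hr) hnodup.1
    · rwa [hg] at h1
  have hprod := hsplit.eq_prod_roots_of_monic hmonK
  rw [hs, Multiset.map_cons, Multiset.prod_cons] at hprod
  set q := (s.map fun r => X - C r).prod with hq
  have hqcoeff : ∀ i, B (q.coeff i) ≤ 1 := coeff_prod_le_one hB s fun r hr => (hsB r hr).le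
  set a₀ : F := -f.nextCoeff with ha₀
  have ha₀eq : algebraMap F K a₀ = α + s.sum := by
    have h1 := hsplit.nextCoeff_eq_neg_sum_roots_of_monic hmonK
    rw [nextCoeff_map (algebraMap F K).injective, hs, Multiset.sum_cons] at h1
    rw [ha₀, map_neg, h1, neg_neg]
  have hsub : B (algebraMap F K a₀ - α) < 1 := by
    rw [ha₀eq, add_sub_cancel_left]
    exact multiset_sum_lt hB s hsB
  have hBa₀ : B (algebraMap F K a₀) = 1 := by
    rw [← hα]
    exact eq_of_sub_lt hB (by rwa [hα])
  have hqa₀ : B (q.eval (algebraMap F K a₀)) = 1 := by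
    rw [hq, eval_multiset_prod, map_multiset_prod, Multiset.map_map, Multiset.map_map]
    refine Multiset.prod_eq_one fun y hy => ?_
    obtain ⟨r, hr, rfl⟩ := Multiset.mem_map.1 hy
    simp only [Function.comp_apply, eval_sub, eval_X, eval_C]
    rw [← hBa₀]
    refine eq_of_sub_lt hB ?_
    rw [sub_sub_cancel_left, map_neg_eq_map, hBa₀]
    exact hsB r hr
  suffices hroot : ∃ a : F, f.eval a = 0 by
    obtain ⟨a, ha⟩ := hroot
    exact minpoly.mem_range_of_degree_eq_one F α
      (degree_eq_one_of_irreducible_of_root (minpoly.irreducible hint) ha)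
  refine hens f ?_ a₀ hBa₀.le ?_ ?_
  · intro i
    rw [← coeff_map, hsplit.eq_prod_roots_of_monic hmonK]
    refine coeff_prod_le_one hB _ (fun r hr => ?_) i
    rw [hs, Multiset.mem_cons] at hr
    rcases hr with rfl | hr
    · exact hα.le
    · exact (hsB r hr).le
  · rw [← eval_map_apply, hprod, eval_mul, map_mul, hqa₀, mul_one]
    simpa using hsub
  · rw [← eval_map_apply, ← derivative_map, hprod, derivative_mul, ← hqa₀]
    refine eq_of_sub_lt hB ?_
    simp only [derivative_sub, derivative_X, derivative_C, sub_zero, one_mul, eval_add, eval_mul,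
      eval_sub, eval_X, eval_C, add_sub_cancel_left, map_mul]
    rw [hqa₀]
    exact mul_lt_one_of_nonneg_of_lt_one_left (B.nonneg _) hsub
      (eval_le_one hB (coeff_derivative_le_one hB hqcoeff) hBa₀.le)

/-- Uniqueness of the extension of a Henselian absolute value to a finite Galois extension. -/
theorem apply_algEquiv_of_finite [FiniteDimensional F K] [IsGalois F K] {B : AbsoluteValue K ℝ}
    (hB : IsNonarchimedean B) (hens : HasSimpleRoots F B) {ϖ : F} (hϖ0 : ϖ ≠ 0)
    (hϖ : B (algebraMap F K ϖ) < 1) (g : K ≃ₐ[F] K) (x : K) : B (g x) = B x := by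
  have hϖK : algebraMap F K ϖ ≠ 0 := by simpa using hϖ0
  let v : (K ≃ₐ[F] K) → AbsoluteValue K ℝ := fun g => B.comp (f := (g : K →+* K)) g.injective
  have hv : ∀ g x, v g x = B (g x) := fun _ _ => rfl
  have hvB : v 1 = B := AbsoluteValue.ext fun _ => rfl
  have hnontriv : ∀ w : Set.range v, (w : AbsoluteValue K ℝ).IsNontrivial := by
    rintro ⟨_, g, rfl⟩
    exact ⟨algebraMap F K ϖ, hϖK, by rw [hv, AlgEquiv.commutes]; exact hϖ.ne⟩
  have hpair : Pairwise fun w w' : Set.range v =>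
      ¬ (w : AbsoluteValue K ℝ).IsEquiv (w' : AbsoluteValue K ℝ) := by
    rintro ⟨_, g, rfl⟩ ⟨_, g', rfl⟩ hne hequiv
    obtain ⟨c, hc, hcv⟩ := AbsoluteValue.isEquiv_iff_exists_rpow_eq.1 hequiv
    have h1 := congrFun hcv (algebraMap F K ϖ)
    simp only [hv, AlgEquiv.commutes] at h1
    have hc1 : c = 1 := by
      have h2 : B (algebraMap F K ϖ) ^ c = B (algebraMap F K ϖ) ^ (1 : ℝ) := by
        rw [h1, Real.rpow_one]
      exact (Real.rpow_right_inj (B.pos hϖK) hϖ.ne).1 h2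
    apply hne
    ext y
    have h3 := congrFun hcv y
    simpa [hc1] using h3
  obtain ⟨a, ha1, ha⟩ := AbsoluteValue.exists_one_lt_lt_one_pi_of_not_isEquiv
    (v := fun w : Set.range v => (w : AbsoluteValue K ℝ)) hnontriv hpair ⟨B, 1, hvB⟩
  simp only at ha1
  have hB1 : ∀ g : K ≃ₐ[F] K, B (1 : K) = 1 := fun _ => map_one B
  set β := a / (1 + a) with hβ
  have hβ1 : B β = 1 := by
    have h1 : B (1 + a) = B a := by
      rw [hB.add_eq_max_of_ne (by rw [map_one]; exact ha1.ne), map_one, max_eq_right ha1.le]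
    rw [hβ, map_div₀, h1, div_self (by linarith)]
  have hβg : ∀ g, v g ≠ B → B (g β) < 1 := by
    intro g hg
    have h1 : B (g a) < 1 := ha ⟨v g, g, rfl⟩ fun h => hg (congrArg Subtype.val h)
    have h2 : B (1 + g a) = 1 := by
      rw [hB.add_eq_max_of_ne (by rw [map_one]; exact h1.ne'), map_one, max_eq_left h1.le]
    rw [hβ, map_div₀, map_add, map_one, map_div₀, h2, div_one]
    exact h1
  let D : Finset (K ≃ₐ[F] K) := Finset.univ.filter fun d => v d = B
  have hD : ∀ d, d ∈ D ↔ ∀ y, B (d y) = B y := by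
    intro d
    simp only [D, Finset.mem_filter, Finset.mem_univ, true_and]
    exact ⟨fun h y => by rw [← hv, h], fun h => AbsoluteValue.ext h⟩
  set α := ∏ d ∈ D, d β with hα
  have hα1 : B α = 1 := by
    rw [hα, map_prod]
    exact Finset.prod_eq_one fun d hd => by rw [(hD d).1 hd, hβ1]
  have hone : (1 : K ≃ₐ[F] K) ∈ D := (hD 1).2 fun _ => rfl
  have hout : ∀ g, g ∉ D → B (g α) < 1 := by
    intro g hg
    have hlt : ∀ d ∈ D, B (g (d β)) < 1 := by
      intro d hd
      refine hβg (g * d) fun h => hg ?_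
      rw [hD]
      intro y
      have h1 : v (g * d) (d.symm y) = B (d.symm y) := by rw [h]
      rw [← (hD d).1 hd (d.symm y), hv] at h1
      simpa using h1
    rw [hα, map_prod, map_prod, ← Finset.mul_prod_erase _ _ hone]
    exact mul_lt_one_of_nonneg_of_lt_one_left (B.nonneg _) (hlt 1 hone)
      (Finset.prod_le_one (fun _ _ => B.nonneg _) fun d hd => (hlt d (Finset.mem_of_mem_erase hd)).le)
  have hin : ∀ g ∈ D, g α = α := by
    intro g hg
    rw [hα, map_prod]
    refine Finset.prod_bij (fun d _ => g * d) (fun d hd => ?_) (fun _ _ _ _ h => mul_left_cancel h)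
      (fun d hd => ⟨g⁻¹ * d, ?_, by simp⟩) fun d _ => rfl
    · rw [hD] at *
      intro y
      rw [AlgEquiv.mul_apply, hg, hd]
    · rw [hD] at *
      intro y
      rw [AlgEquiv.mul_apply, ← hg (g⁻¹ (d y)), ← AlgEquiv.mul_apply, mul_inv_cancel,
        AlgEquiv.one_apply, hd]
  obtain ⟨c, hc⟩ := mem_range_of_conj_lt_one hB hens hα1 fun g => by
    by_cases hg : g ∈ D
    · exact Or.inl (hin g hg)
    · exact Or.inr (hout g hg)
  by_cases hg : g ∈ D
  · exact (hD g).1 hg x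
  · have h1 := hout g hg
    rw [← hc, AlgEquiv.commutes, hc, hα1] at h1
    exact absurd h1 (lt_irrefl _)

/-- Uniqueness of the extension of a Henselian absolute value to a Galois extension. -/
theorem apply_algEquiv [IsGalois F K] {B : AbsoluteValue K ℝ}
    (hB : IsNonarchimedean B) (hens : HasSimpleRoots F B) {ϖ : F} (hϖ0 : ϖ ≠ 0)
    (hϖ : B (algebraMap F K ϖ) < 1) (g : K ≃ₐ[F] K) (x : K) : B (g x) = B x := by
  let M := (FiniteGaloisIntermediateField.adjoin F {x}).toIntermediateField
  let B' : AbsoluteValue M ℝ := B.comp (f := (algebraMap M K)) (algebraMap M K).injective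
  have hxM : x ∈ M := FiniteGaloisIntermediateField.subset_adjoin F {x} (Set.mem_singleton x)
  have h := apply_algEquiv_of_finite (F := F) (B := B') (fun a b => hB a b) hens hϖ0 hϖ
    (g.restrictNormal M) ⟨x, hxM⟩
  have h2 : algebraMap M K (g.restrictNormal M ⟨x, hxM⟩) = g x :=
    g.restrictNormal_commutes M ⟨x, hxM⟩
  rw [← h2]
  exact h

end Invariance

end HenselianRamification

namespace HenselianRamification

open Polynomial IntermediateField

variable {F Ω : Type*} [Field F] [Field Ω] [Algebra F Ω] {A : AbsoluteValue Ω ℝ}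

section Roots

theorem mem_lifts_integers {hA : IsNonarchimedean A} {f : Polynomial Ω} :
    f ∈ lifts (integers hA).subtype ↔ ∀ i, A (f.coeff i) ≤ 1 := by
  rw [lifts_iff_coeff_lifts]
  refine forall_congr' fun i => ⟨?_, fun h => ⟨⟨_, h⟩, rfl⟩⟩
  rintro ⟨y, hy⟩
  rw [← hy]
  exact y.2

theorem eval_sub_eval_le (hA : IsNonarchimedean A) {f : Polynomial Ω} (hf : ∀ i, A (f.coeff i) ≤ 1)
    {x y : Ω} (hx : A x ≤ 1) (hy : A y ≤ 1) : A (f.eval x - f.eval y) ≤ A (x - y) := by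
  obtain ⟨P, rfl⟩ := (mem_lifts _).1 ((mem_lifts_integers (hA := hA)).2 hf)
  obtain ⟨c, hc⟩ := sub_dvd_eval_sub (⟨x, hx⟩ : integers hA) ⟨y, hy⟩ P
  have h := congrArg (integers hA).subtype hc
  rw [map_sub, map_mul, map_sub, ← eval_map_apply, ← eval_map_apply] at h
  change eval x _ - eval y _ = (x - y) * _ at h
  rw [h, map_mul]
  exact mul_le_of_le_one_right (A.nonneg _) c.2

/-- Two congruent roots of an integral polynomial coincide if one of them is simple modulo the
maximal ideal. -/
theorem root_unique (hA : IsNonarchimedean A) {f : Polynomial Ω} (hf : ∀ i, A (f.coeff i) ≤ 1)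
    {r s : Ω} (hr : A r ≤ 1) (hfr : f.eval r = 0) (hfs : f.eval s = 0)
    (hd : A ((derivative f).eval r) = 1) (hsr : A (s - r) < 1) : s = r := by
  obtain ⟨P, rfl⟩ := (mem_lifts _).1 ((mem_lifts_integers (hA := hA)).2 hf)
  have hy : A (s - r) ≤ 1 := hsr.le
  obtain ⟨k, hk⟩ := P.binomExpansion (⟨r, hr⟩ : integers hA) ⟨s - r, hy⟩
  have h := congrArg (integers hA).subtype hk
  simp only [map_add, map_mul, map_pow, ← eval_map_apply] at h
  rw [← derivative_map] at h
  change eval (r + (s - r)) _ = eval r _ + eval r _ * (s - r) + (k : Ω) * (s - r) ^ 2 at h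
  rw [add_sub_cancel, hfr, hfs, zero_add] at h
  by_contra hne
  have h0 : s - r ≠ 0 := sub_ne_zero.2 hne
  have h1 : eval r (derivative (P.map (integers hA).subtype)) = -((k : Ω) * (s - r)) := by
    apply mul_right_cancel₀ h0
    linear_combination -h
  rw [h1, map_neg_eq_map, map_mul] at hd
  have hk1 : A (k : Ω) ≤ 1 := k.2
  nlinarith [A.nonneg (k : Ω), A.nonneg (s - r)]

/-- Hensel's lemma for an intermediate field of the separable closure. -/
theorem exists_root_mem [IsSepClosure F Ω] (hA : IsNonarchimedean A)
    (hinv : ∀ (g : Ω ≃ₐ[F] Ω) (x : Ω), A (g x) = A x) (E : IntermediateField F Ω) {h : E[X]}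
    (hmon : h.Monic) (hsep : h.Separable) (hint : ∀ i, A (h.coeff i : Ω) ≤ 1) {x : Ω}
    (hxE : x ∈ E) (hx : A x ≤ 1) (hhx : A (aeval x h) < 1) (hhx' : A (aeval x (derivative h)) = 1) :
    ∃ r ∈ E, aeval r h = 0 ∧ A (r - x) < 1 ∧ A r ≤ 1 ∧ A (aeval r (derivative h)) = 1 := by
  have : IsSepClosed Ω := IsSepClosure.sep_closed F
  have hmonΩ : (h.map (algebraMap E Ω)).Monic := hmon.map _
  have hsplit : (h.map (algebraMap E Ω)).Splits := IsSepClosed.splits_of_separable _ hsep.map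
  have hcoeff : ∀ i, A ((h.map (algebraMap E Ω)).coeff i) ≤ 1 := fun i => by
    rw [coeff_map]
    exact hint i
  have hex : ∃ r ∈ (h.map (algebraMap E Ω)).roots, A (x - r) < 1 := by
    by_contra! hcon
    rw [← eval_map_algebraMap, hsplit.eval_eq_prod_roots_of_monic hmonΩ, map_multiset_prod,
      Multiset.map_map] at hhx
    refine hhx.not_ge (Multiset.prod_induction (fun z : ℝ => 1 ≤ z) _ (fun a b ha hb => ?_) le_rfl
      fun z hz => ?_)
    · exact one_le_mul_of_one_le_of_one_le ha hb
    · obtain ⟨r, hr, rfl⟩ := Multiset.mem_map.1 hz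
      exact hcon r hr
  obtain ⟨r, hr, hxr⟩ := hex
  rw [mem_roots hmonΩ.ne_zero, IsRoot.def] at hr
  have hrx : A (r - x) < 1 := by rwa [AbsoluteValue.map_sub]
  have hr1 : A r ≤ 1 := le_one_of_sub_lt hA hx hrx
  have hder : A ((derivative (h.map (algebraMap E Ω))).eval r) = 1 := by
    rw [← hhx', ← eval_map_algebraMap, ← derivative_map]
    refine eq_of_sub_lt hA ?_
    refine (eval_sub_eval_le hA (coeff_derivative_le_one hA hcoeff) hr1 hx).trans_lt ?_
    rwa [derivative_map, eval_map_algebraMap, hhx']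
  refine ⟨r, ?_, by rwa [← eval_map_algebraMap], hrx, hr1, ?_⟩
  · have hbot : r ∈ (⊥ : IntermediateField E Ω) := by
      rw [InfiniteGalois.mem_bot_iff_fixed]
      intro g
      refine root_unique hA hcoeff hr1 hr ?_ hder ?_
      · rw [eval_map_algebraMap] at hr ⊢
        change aeval ((g : Ω →ₐ[E] Ω) r) h = 0
        rw [aeval_algHom_apply, hr, map_zero]
      · have hgx : g x = x := g.commutes ⟨x, hxE⟩
        refine (sub_le_max_sub hA (g r) x r).trans_lt (max_lt ?_ hxr)
        nth_rw 1 [← hgx]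
        rw [← map_sub]
        exact (hinv (g.restrictScalars F) (r - x)).trans_lt hrx
    obtain ⟨y, rfl⟩ := IntermediateField.mem_bot.1 hbot
    exact y.2
  · rw [← eval_map_algebraMap, ← derivative_map]
    exact hder

end Roots

section ResidueFields

/-- The ring of integers of an intermediate field. -/
def integersOf (hA : IsNonarchimedean A) (T : IntermediateField F Ω) : ValuationSubring T :=
  (integers hA).comap (algebraMap T Ω)

/-- The inclusion of the ring of integers of an intermediate field into that of `Ω`. -/
def integersIncl (hA : IsNonarchimedean A) (T : IntermediateField F Ω) :
    integersOf hA T →+* integers hA :=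
  ((algebraMap T Ω).comp (integersOf hA T).subtype).codRestrict (integers hA) fun x => x.2

theorem coe_integersIncl (hA : IsNonarchimedean A) (T : IntermediateField F Ω)
    (x : integersOf hA T) : (integersIncl hA T x : Ω) = ((x : T) : Ω) :=
  rfl

/-- The residue field of an intermediate field, inside the residue field of `Ω`. -/
def residueFieldOf (hA : IsNonarchimedean A) (T : IntermediateField F Ω) :
    Subfield (IsLocalRing.ResidueField (integers hA)) where
  __ := ((IsLocalRing.residue (integers hA)).comp (integersIncl hA T)).range
  inv_mem' := by
    rintro _ ⟨x, rfl⟩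
    by_cases h : A ((x : T) : Ω) = 1
    · have hx0 : (x : T) ≠ 0 := by
        rintro h0
        simp [h0] at h
      refine ⟨⟨(x : T)⁻¹, ?_⟩, ?_⟩
      · change A (((x : T)⁻¹ : T) : Ω) ≤ 1
        simp [h]
      · refine eq_inv_of_mul_eq_one_left ?_
        rw [← map_mul, ← map_one ((IsLocalRing.residue (integers hA)).comp (integersIncl hA T))]
        congr 1
        exact Subtype.ext (inv_mul_cancel₀ hx0)
    · have h0 : IsLocalRing.residue (integers hA) (integersIncl hA T x) = 0 :=
        residue_eq_zero_iff.2 (lt_of_le_of_ne (integersIncl hA T x).2 h)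
      refine ⟨0, ?_⟩
      change _ = (IsLocalRing.residue (integers hA) (integersIncl hA T x))⁻¹
      rw [h0, inv_zero, map_zero]

/-- Reduction modulo the maximal ideal on an intermediate field. -/
def reduction (hA : IsNonarchimedean A) (T : IntermediateField F Ω) :
    integersOf hA T →+* residueFieldOf hA T :=
  ((IsLocalRing.residue (integers hA)).comp (integersIncl hA T)).codRestrict
    (residueFieldOf hA T) fun x => ⟨x, rfl⟩

theorem coe_reduction (hA : IsNonarchimedean A) (T : IntermediateField F Ω)
    (x : integersOf hA T) : (reduction hA T x : IsLocalRing.ResidueField (integers hA)) =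
      IsLocalRing.residue (integers hA) (integersIncl hA T x) :=
  rfl

theorem reduction_surjective (hA : IsNonarchimedean A) (T : IntermediateField F Ω) :
    Function.Surjective (reduction hA T) := by
  rintro ⟨_, x, rfl⟩
  exact ⟨x, rfl⟩

theorem residueFieldOf_mono (hA : IsNonarchimedean A) {T T' : IntermediateField F Ω}
    (h : T ≤ T') : residueFieldOf hA T ≤ residueFieldOf hA T' := by
  rintro _ ⟨x, rfl⟩
  exact ⟨⟨⟨(x : T), h (x : T).2⟩, x.2⟩, rfl⟩

theorem coe_eval₂_integersIncl (hA : IsNonarchimedean A) (T : IntermediateField F Ω)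
    (x : integers hA) (P : (integersOf hA T)[X]) :
    ((P.eval₂ (integersIncl hA T) x : integers hA) : Ω) =
      aeval (x : Ω) (P.map (algebraMap (integersOf hA T) T)) := by
  change (integers hA).subtype _ = _
  rw [hom_eval₂, aeval_def, eval₂_map]
  rfl

theorem aeval_map_reduction (hA : IsNonarchimedean A) (T : IntermediateField F Ω)
    (x : integers hA) (P : (integersOf hA T)[X]) :
    aeval (IsLocalRing.residue (integers hA) x) (P.map (reduction hA T)) =
      IsLocalRing.residue (integers hA) (P.eval₂ (integersIncl hA T) x) := by
  rw [hom_eval₂, aeval_def, eval₂_map]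
  rfl

theorem mem_lifts_integersOf {hA : IsNonarchimedean A} {T : IntermediateField F Ω} {f : T[X]} :
    f ∈ lifts (algebraMap (integersOf hA T) T) ↔ ∀ i, A (f.coeff i : Ω) ≤ 1 := by
  rw [lifts_iff_coeff_lifts]
  refine forall_congr' fun i => ⟨?_, fun h => ⟨⟨_, h⟩, rfl⟩⟩
  rintro ⟨y, hy⟩
  rw [← hy]
  exact y.2

theorem perfectField_residueFieldOf_bot (hA : IsNonarchimedean A)
    (hperf : ∀ p : ℕ, p.Prime → A (p : Ω) < 1 → ∀ x : F, A (algebraMap F Ω x) ≤ 1 →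
      ∃ y : F, A (algebraMap F Ω y) ≤ 1 ∧ A (algebraMap F Ω (x - y ^ p)) < 1) :
    PerfectField (residueFieldOf hA (⊥ : IntermediateField F Ω)) := by
  obtain ⟨p, hp⟩ := CharP.exists (residueFieldOf hA (⊥ : IntermediateField F Ω))
  rcases CharP.char_is_prime_or_zero (residueFieldOf hA (⊥ : IntermediateField F Ω)) p with h | rfl
  · have : Fact p.Prime := ⟨h⟩
    have : ExpChar (residueFieldOf hA (⊥ : IntermediateField F Ω)) p := ExpChar.prime h
    have hpA : A (p : Ω) < 1 := by
      have h1 : ((p : residueFieldOf hA (⊥ : IntermediateField F Ω)) :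
        IsLocalRing.ResidueField (integers hA)) = 0 := by
        rw [CharP.cast_eq_zero]
        rfl
      have h2 : IsLocalRing.residue (integers hA) (p : integers hA) = 0 := by
        rw [map_natCast]
        exact h1
      simpa using residue_eq_zero_iff.1 h2
    have : PerfectRing (residueFieldOf hA (⊥ : IntermediateField F Ω)) p := by
      refine PerfectRing.ofSurjective _ _ fun z => ?_
      obtain ⟨⟨x, hx⟩, rfl⟩ := reduction_surjective hA _ z
      obtain ⟨a, ha⟩ := IntermediateField.mem_bot.1 x.2
      have hx' : A (x : Ω) ≤ 1 := hx
      obtain ⟨b, hb, hab⟩ := hperf p h hpA a (by rwa [ha])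
      refine ⟨reduction hA _ ⟨⟨algebraMap F Ω b, IntermediateField.algebraMap_mem _ b⟩, hb⟩, ?_⟩
      rw [frobenius_def, ← map_pow, eq_comm, ← sub_eq_zero, ← map_sub]
      refine Subtype.ext ?_
      rw [coe_reduction]
      refine residue_eq_zero_iff.2 ?_
      rw [map_sub, map_pow, ha] at hab
      exact hab
    exact PerfectRing.toPerfectField _ p
  · have : CharZero (residueFieldOf hA (⊥ : IntermediateField F Ω)) := CharP.charP_to_charZero _
    infer_instance

variable [IsSepClosure F Ω]

theorem coeff_minpoly_le_one (hA : IsNonarchimedean A)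
    (hinv : ∀ (g : Ω ≃ₐ[F] Ω) (x : Ω), A (g x) = A x) (T : IntermediateField F Ω) {x : Ω}
    (hx : A x ≤ 1) (i : ℕ) : A ((minpoly T x).coeff i : Ω) ≤ 1 := by
  have hint : IsIntegral T x := Algebra.IsIntegral.isIntegral x
  have hmon : ((minpoly T x).map (algebraMap T Ω)).Monic := (minpoly.monic hint).map _
  have hsplit : ((minpoly T x).map (algebraMap T Ω)).Splits := Normal.splits' x
  have h := coeff_prod_le_one hA ((minpoly T x).map (algebraMap T Ω)).roots (fun r hr => ?_) i
  · rwa [← hsplit.eq_prod_roots_of_monic hmon, coeff_map] at h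
  · rw [mem_roots hmon.ne_zero, IsRoot.def, eval_map_algebraMap] at hr
    obtain ⟨g, rfl⟩ := minpoly.exists_algEquiv_of_root' hint.isAlgebraic hr
    exact (hinv (g.restrictScalars F) x).trans_le hx

theorem isAlgebraic_residueFieldOf (hA : IsNonarchimedean A)
    (hinv : ∀ (g : Ω ≃ₐ[F] Ω) (x : Ω), A (g x) = A x) (T : IntermediateField F Ω) :
    Algebra.IsAlgebraic (residueFieldOf hA T) (IsLocalRing.ResidueField (integers hA)) := by
  refine ⟨fun y => ?_⟩
  obtain ⟨x, rfl⟩ := IsLocalRing.residue_surjective y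
  have hint : IsIntegral T (x : Ω) := Algebra.IsIntegral.isIntegral _
  obtain ⟨P, hP, -, hPmon⟩ := lifts_and_natDegree_eq_and_monic
    ((mem_lifts_integersOf (hA := hA)).2 (coeff_minpoly_le_one hA hinv T x.2)) (minpoly.monic hint)
  refine ⟨P.map (reduction hA T), (hPmon.map _).ne_zero, ?_⟩
  rw [aeval_map_reduction, residue_eq_zero_iff, coe_eval₂_integersIncl, hP, minpoly.aeval,
    map_zero]
  exact zero_lt_one

end ResidueFields

end HenselianRamification

namespace HenselianRamification

open Polynomial IntermediateField

variable {F Ω : Type*} [Field F] [Field Ω] [Algebra F Ω] {A : AbsoluteValue Ω ℝ}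

theorem isSeparable_residueFieldOf [IsSepClosure F Ω] (hA : IsNonarchimedean A)
    (hinv : ∀ (g : Ω ≃ₐ[F] Ω) (x : Ω), A (g x) = A x)
    (hperf : ∀ p : ℕ, p.Prime → A (p : Ω) < 1 → ∀ x : F, A (algebraMap F Ω x) ≤ 1 →
      ∃ y : F, A (algebraMap F Ω y) ≤ 1 ∧ A (algebraMap F Ω (x - y ^ p)) < 1)
    (T : IntermediateField F Ω) (y : IsLocalRing.ResidueField (integers hA)) :
    IsSeparable (residueFieldOf hA T) y := by
  have := perfectField_residueFieldOf_bot hA hperf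
  have := isAlgebraic_residueFieldOf hA hinv (⊥ : IntermediateField F Ω)
  let := (Subfield.inclusion (residueFieldOf_mono hA (bot_le : ⊥ ≤ T))).toAlgebra
  have : IsScalarTower (residueFieldOf hA (⊥ : IntermediateField F Ω)) (residueFieldOf hA T)
    (IsLocalRing.ResidueField (integers hA)) := IsScalarTower.of_algebraMap_eq fun _ => rfl
  exact (Algebra.IsAlgebraic.isSeparable_of_perfectField.isSeparable'
    (F := residueFieldOf hA (⊥ : IntermediateField F Ω)) y).tower_top _

/-- A polynomial of degree smaller than that of the residue of `r` over the residue field of `T`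
takes at `r` a value whose size is the maximal size of its coefficients. -/
theorem exists_coeff_apply_aeval (hA : IsNonarchimedean A) (T : IntermediateField F Ω)
    (r : integers hA) {g : Polynomial T} (hg : g ≠ 0)
    (hdeg : g.degree < (minpoly (residueFieldOf hA T)
      (IsLocalRing.residue (integers hA) r)).degree) :
    ∃ c : T, c ≠ 0 ∧ A (aeval (r : Ω) g) = A (c : Ω) := by
  obtain ⟨j, hj, hmax⟩ := Finset.exists_max_image g.support (fun i => A (g.coeff i : Ω))
    (support_nonempty.2 hg)
  have hc : g.coeff j ≠ 0 := mem_support_iff.1 hj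
  refine ⟨g.coeff j, hc, ?_⟩
  have hcA : 0 < A (g.coeff j : Ω) := A.pos (by simpa using hc)
  have hint : ∀ i, A ((C (g.coeff j)⁻¹ * g).coeff i : Ω) ≤ 1 := by
    intro i
    rw [coeff_C_mul, IntermediateField.coe_mul, map_mul, IntermediateField.coe_inv, map_inv₀]
    rw [inv_mul_le_iff₀ hcA, mul_one]
    by_cases hi : i ∈ g.support
    · exact hmax i hi
    · rw [notMem_support_iff.1 hi]
      simp
  obtain ⟨Q, hQ⟩ := (mem_lifts _).1 ((mem_lifts_integersOf (hA := hA)).2 hint)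
  have hQ0 : Q.map (reduction hA T) ≠ 0 := by
    intro h0
    have h1 := congrArg (fun q => ((q.coeff j : residueFieldOf hA T) :
      IsLocalRing.ResidueField (integers hA))) h0
    simp only [coeff_map, coe_reduction, coeff_zero, ZeroMemClass.coe_zero] at h1
    rw [residue_eq_zero_iff, coe_integersIncl] at h1
    have h2 : ((Q.coeff j : integersOf hA T) : T) = 1 := by
      have h3 := congrArg (fun q => q.coeff j) hQ
      simpa [hc] using h3
    rw [h2, IntermediateField.coe_one, map_one] at h1
    exact lt_irrefl _ h1
  have hQdeg : (Q.map (reduction hA T)).degree < (minpoly (residueFieldOf hA T)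
      (IsLocalRing.residue (integers hA) r)).degree := by
    refine lt_of_le_of_lt ?_ hdeg
    have h1 : (Q.map (algebraMap (integersOf hA T) T)).degree = Q.degree :=
      degree_map_eq_of_injective Subtype.val_injective _
    rw [hQ, degree_C_mul (inv_ne_zero hc)] at h1
    rw [h1]
    exact degree_map_le
  have hne : aeval (IsLocalRing.residue (integers hA) r) (Q.map (reduction hA T)) ≠ 0 :=
    fun h0 => hQdeg.not_ge (minpoly.degree_le_of_ne_zero _ _ hQ0 h0)
  rw [aeval_map_reduction, Ne, residue_eq_zero_iff, coe_eval₂_integersIncl, hQ, not_lt] at hne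
  have hle : A (aeval (r : Ω) (C (g.coeff j)⁻¹ * g)) ≤ 1 := by
    rw [← hQ, ← coe_eval₂_integersIncl]
    exact (Q.eval₂ (integersIncl hA T) r).2
  have h1 := le_antisymm hle hne
  rw [map_mul, aeval_C, map_mul, map_inv₀, map_inv₀] at h1
  change (A (g.coeff j : Ω))⁻¹ * _ = 1 at h1
  rwa [inv_mul_eq_one₀ hcA.ne', eq_comm] at h1

theorem apply_aeval_of_fixed (T : IntermediateField F Ω) (γ : Ω ≃ₐ[F] Ω)
    (hγ : ∀ x ∈ T, γ x = x) (r : Ω) (g : Polynomial T) : γ (aeval r g) = aeval (γ r) g := by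
  have h1 : (γ : Ω →+* Ω).comp (algebraMap T Ω) = algebraMap T Ω :=
    RingHom.ext fun x => hγ x x.2
  change (γ : Ω →+* Ω) _ = _
  rw [aeval_def, hom_eval₂, h1]
  rfl

/-- One step in enlarging an unramified subextension. -/
theorem exists_unramified_adjoin [IsSepClosure F Ω] (hA : IsNonarchimedean A)
    (hinv : ∀ (g : Ω ≃ₐ[F] Ω) (x : Ω), A (g x) = A x)
    (hperf : ∀ p : ℕ, p.Prime → A (p : Ω) < 1 → ∀ x : F, A (algebraMap F Ω x) ≤ 1 →
      ∃ y : F, A (algebraMap F Ω y) ≤ 1 ∧ A (algebraMap F Ω (x - y ^ p)) < 1)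
    {E T : IntermediateField F Ω} (hTE : T ≤ E) {S : Set (Ω ≃ₐ[F] Ω)}
    (hS : ∀ γ ∈ S, ∀ x ∈ E, A x ≤ 1 → A (γ x - x) < 1) (hST : ∀ γ ∈ S, ∀ x ∈ T, γ x = x)
    {x : Ω} (hxE : x ∈ E) (hx : A x ≤ 1) :
    ∃ T' : IntermediateField F Ω, T ≤ T' ∧ T' ≤ E ∧ (∀ γ ∈ S, ∀ y ∈ T', γ y = y) ∧
      (∀ y ∈ T', y ≠ 0 → ∃ c ∈ T, c ≠ 0 ∧ A y = A c) ∧ ∃ b ∈ T', A (x - b) < 1 := by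
  set y := IsLocalRing.residue (integers hA) ⟨x, hx⟩ with hy
  have hsep := isSeparable_residueFieldOf hA hinv hperf T y
  have hyint : IsIntegral (residueFieldOf hA T) y :=
    (isAlgebraic_residueFieldOf hA hinv T).isAlgebraic y |>.isIntegral
  obtain ⟨P, hP, hPdeg, hPmon⟩ := lifts_and_natDegree_eq_and_monic
    (f := reduction hA T) (p := minpoly (residueFieldOf hA T) y)
    ((mem_lifts _).2 (map_surjective _ (reduction_surjective hA T) _)) (minpoly.monic hyint)
  have hPirr : Irreducible P := hPmon.irreducible_of_irreducible_map (reduction hA T) P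
    (hP ▸ minpoly.irreducible hyint)
  set h := P.map (algebraMap (integersOf hA T) T) with hh
  have hirr : Irreducible h := hPmon.irreducible_iff_irreducible_map_fraction_map.1 hPirr
  have hmon : h.Monic := hPmon.map _
  have hcoeff : ∀ i, A (h.coeff i : Ω) ≤ 1 :=
    mem_lifts_integersOf.1 ((mem_lifts _).2 ⟨P, rfl⟩)
  have hhx : A (aeval x h) < 1 := by
    have h1 : aeval y (P.map (reduction hA T)) = 0 := by rw [hP, minpoly.aeval]
    rwa [aeval_map_reduction, residue_eq_zero_iff, coe_eval₂_integersIncl] at h1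
  have hhx' : A (aeval x (derivative h)) = 1 := by
    have h1 : aeval y ((derivative P).map (reduction hA T)) ≠ 0 := by
      rw [← derivative_map, hP]
      exact Separable.aeval_derivative_ne_zero hsep (minpoly.aeval _ _)
    rw [aeval_map_reduction, Ne, residue_eq_zero_iff, not_lt] at h1
    have h2 := le_antisymm ((derivative P).eval₂ (integersIncl hA T) ⟨x, hx⟩).2 h1
    rwa [coe_eval₂_integersIncl, ← derivative_map] at h2
  have hseph : h.Separable := by
    rw [separable_iff_derivative_ne_zero hirr]
    intro h0
    rw [h0] at hhx'
    simp at hhx'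
  have haeval : ∀ (z : Ω) (f : Polynomial T),
      aeval z (f.map (IntermediateField.inclusion hTE : T →+* E)) = aeval z f := by
    intro z f
    rw [aeval_def, eval₂_map]
    rfl
  obtain ⟨r, hrE, hr0, hrx, hr1, hr'⟩ := exists_root_mem hA hinv E
    (h := h.map (IntermediateField.inclusion hTE : T →+* E)) (hmon.map _) hseph.map
    (fun i => by rw [coeff_map]; exact hcoeff i) hxE hx (by rwa [haeval])
    (by rwa [derivative_map, haeval])
  rw [haeval] at hr0
  rw [derivative_map, haeval] at hr'
  have hrγ : ∀ γ ∈ S, γ r = r := by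
    intro γ hγ
    refine root_unique hA (f := h.map (algebraMap T Ω)) (fun i => ?_) hr1 ?_ ?_ ?_
      (hS γ hγ r hrE hr1)
    · rw [coeff_map]
      exact hcoeff i
    · rwa [eval_map_algebraMap]
    · rw [eval_map_algebraMap, ← apply_aeval_of_fixed T γ (hST γ hγ), hr0, map_zero]
    · rwa [derivative_map, eval_map_algebraMap]
  have hresr : IsLocalRing.residue (integers hA) ⟨r, hr1⟩ = y := by
    rw [hy, ← sub_eq_zero, ← map_sub, residue_eq_zero_iff]
    exact hrx
  have hmem : ∀ z ∈ T⟮r⟯, ∃ g : Polynomial T, g.degree < h.degree ∧ z = aeval r g := by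
    intro z hz
    have hrint : IsIntegral T r := Algebra.IsIntegral.isIntegral r
    rw [← mem_toSubalgebra, adjoin_simple_toSubalgebra_of_isAlgebraic hrint.isAlgebraic,
      Algebra.adjoin_singleton_eq_range_aeval] at hz
    obtain ⟨g, rfl⟩ := hz
    refine ⟨g %ₘ h, degree_modByMonic_lt g hmon, ?_⟩
    conv_lhs => rw [← modByMonic_add_div g h]
    simp [hr0]
  refine ⟨T⟮r⟯.restrictScalars F, fun z hz => T⟮r⟯.algebraMap_mem ⟨z, hz⟩, fun z hz => ?_,
    fun γ hγ z hz => ?_, fun z hz hz0 => ?_, r, mem_adjoin_simple_self T r, ?_⟩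
  · obtain ⟨g, -, rfl⟩ := hmem z hz
    rw [aeval_eq_sum_range]
    refine sum_mem fun i _ => ?_
    rw [Algebra.smul_def]
    exact mul_mem (hTE (g.coeff i).2) (pow_mem hrE i)
  · obtain ⟨g, -, rfl⟩ := hmem z hz
    rw [apply_aeval_of_fixed T γ (hST γ hγ), hrγ γ hγ]
  · obtain ⟨g, hgdeg, rfl⟩ := hmem z hz
    have hg0 : g ≠ 0 := by
      rintro rfl
      simp at hz0
    obtain ⟨c, hc0, hc⟩ := exists_coeff_apply_aeval hA T ⟨r, hr1⟩ hg0 (by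
      rw [hresr, ← hP, hPmon.degree_map, ← hPmon.degree_map (algebraMap (integersOf hA T) T)]
      exact hgdeg)
    exact ⟨c, c.2, by simpa using hc0, hc⟩
  · rwa [AbsoluteValue.map_sub]

/-- Existence of an unramified subextension with the same residues, fixed by every automorphism
that acts trivially on residues. -/
theorem exists_unramified_subextension [IsSepClosure F Ω] (hA : IsNonarchimedean A)
    (hinv : ∀ (g : Ω ≃ₐ[F] Ω) (x : Ω), A (g x) = A x)
    (hperf : ∀ p : ℕ, p.Prime → A (p : Ω) < 1 → ∀ x : F, A (algebraMap F Ω x) ≤ 1 →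
      ∃ y : F, A (algebraMap F Ω y) ≤ 1 ∧ A (algebraMap F Ω (x - y ^ p)) < 1)
    (E : IntermediateField F Ω) {S : Set (Ω ≃ₐ[F] Ω)}
    (hS : ∀ γ ∈ S, ∀ x ∈ E, A x ≤ 1 → A (γ x - x) < 1) :
    ∃ T ≤ E, (∀ γ ∈ S, ∀ x ∈ T, γ x = x) ∧
      (∀ x ∈ T, x ≠ 0 → ∃ c : F, c ≠ 0 ∧ A x = A (algebraMap F Ω c)) ∧
      ∀ x ∈ E, A x ≤ 1 → ∃ b ∈ T, A (x - b) < 1 := by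
  let P : Set (IntermediateField F Ω) := {T | T ≤ E ∧ (∀ γ ∈ S, ∀ x ∈ T, γ x = x) ∧
      ∀ x ∈ T, x ≠ 0 → ∃ c : F, c ≠ 0 ∧ A x = A (algebraMap F Ω c)}
  have hbot : (⊥ : IntermediateField F Ω) ∈ P := by
    refine ⟨bot_le, fun γ _ x hx => ?_, fun x hx hx0 => ?_⟩
    · obtain ⟨c, rfl⟩ := IntermediateField.mem_bot.1 hx
      exact γ.commutes c
    · obtain ⟨c, rfl⟩ := IntermediateField.mem_bot.1 hx
      exact ⟨c, fun h => hx0 (by rw [h, map_zero]), rfl⟩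
  obtain ⟨T, -, hT⟩ := zorn_le_nonempty₀ P (fun c hcP hc y hy => by
    have hne : Nonempty c := ⟨⟨y, hy⟩⟩
    have hmem : ∀ x ∈ sSup c, ∃ T ∈ c, x ∈ T := by
      intro x hx
      rw [sSup_eq_iSup', ← SetLike.mem_coe, coe_iSup_of_directed hc.directedOn.directed_val,
        Set.mem_iUnion] at hx
      obtain ⟨T, hT⟩ := hx
      exact ⟨T, T.2, hT⟩
    refine ⟨sSup c, ⟨sSup_le fun T hT => (hcP hT).1, fun γ hγ x hx => ?_, fun x hx hx0 => ?_⟩,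
      fun z hz => le_sSup hz⟩
    · obtain ⟨T, hTc, hxT⟩ := hmem x hx
      exact (hcP hTc).2.1 γ hγ x hxT
    · obtain ⟨T, hTc, hxT⟩ := hmem x hx
      exact (hcP hTc).2.2 x hxT hx0) ⊥ hbot
  obtain ⟨hTE, hfix, hval⟩ := hT.prop
  refine ⟨T, hTE, hfix, hval, fun x hxE hx => ?_⟩
  obtain ⟨T', hTT', hT'E, hfix', hval', b, hb, hxb⟩ :=
    exists_unramified_adjoin hA hinv hperf hTE hS hfix hxE hx
  refine ⟨b, hT.le_of_ge ⟨hT'E, hfix', fun z hz hz0 => ?_⟩ hTT' hb, hxb⟩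
  obtain ⟨c, hcT, hc0, hc⟩ := hval' z hz hz0
  obtain ⟨d, hd0, hd⟩ := hval c hcT hc0
  exact ⟨d, hd0, hc.trans hd⟩

end HenselianRamification

namespace HenselianRamification

open Polynomial IntermediateField

variable {F Ω : Type*} [Field F] [Field Ω] [Algebra F Ω] {A : AbsoluteValue Ω ℝ}

/-- `E` is totally ramified of index `e` over the field `T`, with uniformizer `π` of absolute
value `ρ`. -/
structure IsUniformizedBy (A : AbsoluteValue Ω ℝ) (T E : IntermediateField F Ω) (ρ : ℝ) (e : ℕ)
    (π : E) : Prop where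
  nonarch : IsNonarchimedean A
  le : T ≤ E
  pos : 0 < ρ
  lt_one : ρ < 1
  index_pos : 0 < e
  apply_uniformizer : A π = ρ
  apply_mem : ∀ x : E, x ≠ 0 → ∃ k : ℤ, A x = ρ ^ k
  apply_mem_base : ∀ x : Ω, x ∈ T → x ≠ 0 → ∃ k : ℤ, A x = (ρ ^ e) ^ k
  exists_base_uniformizer : ∃ ϖ ∈ T, A ϖ = ρ ^ e
  exists_residue : ∀ x : E, A x ≤ 1 → ∃ b ∈ T, A (x - b) < 1

/-- The embedding `σ` fixes `T` and preserves the absolute value `A`. -/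
structure IsIsometricOver (A : AbsoluteValue Ω ℝ) (T : IntermediateField F Ω)
    {E : IntermediateField F Ω} (σ : E →ₐ[F] Ω) : Prop where
  apply_base : ∀ x : E, (x : Ω) ∈ T → σ x = x
  isometry : ∀ x : E, A (σ x) = A x

namespace IsUniformizedBy

variable {T E : IntermediateField F Ω} {ρ : ℝ} {e : ℕ} {π : E}

theorem uniformizer_ne_zero (h : IsUniformizedBy A T E ρ e π) : (π : Ω) ≠ 0 := by
  intro h0
  have := h.apply_uniformizer
  rw [h0, map_zero] at this
  exact h.pos.ne this

theorem le_of_lt_one (h : IsUniformizedBy A T E ρ e π) {x : E} (hx : A x < 1) : A x ≤ ρ := by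
  by_cases hx0 : x = 0
  · simp [hx0, h.pos.le]
  · obtain ⟨k, hk⟩ := h.apply_mem x hx0
    rw [hk] at hx ⊢
    have hk0 : 0 < k := by
      rwa [← zpow_zero ρ, zpow_lt_zpow_iff_right_of_lt_one₀ h.pos h.lt_one] at hx
    calc ρ ^ k ≤ ρ ^ (1 : ℤ) := (zpow_le_zpow_iff_right_of_lt_one₀ h.pos h.lt_one).2 (by omega)
      _ = ρ := zpow_one ρ

/-- Every element of `E` is approximated by combinations of `1, π, …, π ^ (e - 1)` over `T`. -/
theorem exists_approx (h : IsUniformizedBy A T E ρ e π) (x : E) (n : ℕ) :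
    ∃ c : ℕ → T, A (x - ∑ i ∈ Finset.range e, (c i : Ω) * (π : Ω) ^ i) ≤ A x * ρ ^ n := by
  induction n with
  | zero => exact ⟨0, by simp⟩
  | succ n ih =>
    obtain ⟨c, hc⟩ := ih
    set y := (x : Ω) - ∑ i ∈ Finset.range e, (c i : Ω) * (π : Ω) ^ i with hy
    have hyE : y ∈ E := sub_mem x.2 (sum_mem fun i _ => mul_mem (h.le (c i).2) (pow_mem π.2 i))
    by_cases hy0 : y = 0
    · refine ⟨c, ?_⟩
      rw [← hy, hy0, map_zero]
      exact mul_nonneg (A.nonneg _) (pow_nonneg h.pos.le _)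
    · obtain ⟨m, hm⟩ := h.apply_mem ⟨y, hyE⟩ (by simpa [Subtype.ext_iff] using hy0)
      obtain ⟨ϖ, hϖT, hϖ⟩ := h.exists_base_uniformizer
      have he : (0 : ℤ) < e := by exact_mod_cast h.index_pos
      obtain ⟨i, hi⟩ := Int.eq_ofNat_of_zero_le (Int.emod_nonneg m he.ne')
      have hie : i < e := by
        have := Int.emod_lt_of_pos m he
        omega
      set u := ϖ ^ (m / e) * (π : Ω) ^ i with hu
      have hAu : A u = A y := by
        rw [hu, map_mul, map_zpow₀, map_pow, hϖ, h.apply_uniformizer, hm, ← zpow_natCast ρ e,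
          ← zpow_mul, ← zpow_natCast ρ i, ← zpow_add₀ h.pos.ne', ← hi, Int.mul_ediv_add_emod]
      have hu0 : u ≠ 0 := by
        rw [← A.ne_zero_iff, hAu, A.ne_zero_iff]
        exact hy0
      have huE : u ∈ E := mul_mem (zpow_mem (h.le hϖT) _) (pow_mem π.2 _)
      obtain ⟨b, hbT, hb⟩ := h.exists_residue ⟨y / u, div_mem hyE huE⟩ (by
        rw [map_div₀, hAu, div_self (A.ne_zero hy0)])
      have hb' := h.le_of_lt_one (x := ⟨y / u - b, sub_mem (div_mem hyE huE) (h.le hbT)⟩) hb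
      refine ⟨fun j => c j + if j = i then ⟨b * ϖ ^ (m / e), mul_mem hbT (zpow_mem hϖT _)⟩ else 0,
        ?_⟩
      have hsum : (x : Ω) - ∑ j ∈ Finset.range e, ((c j + if j = i then
          (⟨b * ϖ ^ (m / e), mul_mem hbT (zpow_mem hϖT _)⟩ : T) else 0 : T) : Ω) * (π : Ω) ^ j
          = (y / u - b) * u := by
        rw [sub_mul, div_mul_cancel₀ _ hu0, hy]
        simp only [AddMemClass.coe_add, add_mul, Finset.sum_add_distrib]
        rw [Finset.sum_eq_single (f := fun j => ((if j = i then
          (⟨b * ϖ ^ (m / e), mul_mem hbT (zpow_mem hϖT _)⟩ : T) else 0 : T) : Ω) * (π : Ω) ^ j) i]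
        · simp only [if_true, hu]
          ring
        · intro j _ hj
          simp [hj]
        · intro hi
          exact absurd (Finset.mem_range.2 hie) hi
      rw [hsum, map_mul, hAu]
      calc _ ≤ ρ * (A x * ρ ^ n) := mul_le_mul hb' hc (A.nonneg _) h.pos.le
        _ = A x * ρ ^ (n + 1) := by ring

/-- The elements `1, π, …, π ^ (e - 1)` are linearly independent over `T`. -/
theorem coeff_eq_zero (h : IsUniformizedBy A T E ρ e π) {c : ℕ → T}
    (hc : ∑ i ∈ Finset.range e, (c i : Ω) * (π : Ω) ^ i = 0) {i : ℕ} (hi : i < e) : c i = 0 := by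
  by_contra hci
  obtain ⟨j, hj, hmax⟩ := Finset.exists_max_image (Finset.range e)
    (fun j => A ((c j : Ω) * (π : Ω) ^ j)) ⟨i, Finset.mem_range.2 hi⟩
  have hpos : ∀ k, c k ≠ 0 → 0 < A ((c k : Ω) * (π : Ω) ^ k) := fun k hk =>
    A.pos (mul_ne_zero (by simpa using hk) (pow_ne_zero _ h.uniformizer_ne_zero))
  have hj0 : 0 < A ((c j : Ω) * (π : Ω) ^ j) :=
    (hpos i hci).trans_le (hmax i (Finset.mem_range.2 hi))
  have hval : ∀ k, c k ≠ 0 → ∃ m : ℤ, A ((c k : Ω) * (π : Ω) ^ k) = ρ ^ (e * m + k) := by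
    intro k hk
    obtain ⟨m, hm⟩ := h.apply_mem_base (c k) (c k).2 (by simpa using hk)
    refine ⟨m, ?_⟩
    rw [map_mul, map_pow, hm, h.apply_uniformizer, ← zpow_natCast ρ e, ← zpow_mul,
      ← zpow_natCast ρ k, ← zpow_add₀ h.pos.ne']
  have hcj : c j ≠ 0 := by
    intro h0
    simp [h0] at hj0
  rw [← Finset.add_sum_erase _ _ hj] at hc
  refine lt_irrefl (A ((c j : Ω) * (π : Ω) ^ j)) ?_
  conv_lhs => rw [eq_neg_of_add_eq_zero_left hc, map_neg_eq_map]
  refine sum_lt_of_forall_lt h.nonarch _ _ hj0 fun k hk => ?_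
  rw [Finset.mem_erase] at hk
  refine lt_of_le_of_ne (hmax k hk.2) fun heq => hk.1 ?_
  have hck : c k ≠ 0 := by
    intro h0
    simp [h0] at heq
    rcases heq with h0 | h0
    · exact hcj h0
    · exact h.uniformizer_ne_zero (by simp [h0.1])
  obtain ⟨m, hm⟩ := hval k hck
  obtain ⟨m', hm'⟩ := hval j hcj
  rw [hm, hm'] at heq
  have := zpow_right_injective₀ h.pos h.lt_one.ne heq
  have hk' := Finset.mem_range.1 hk.2
  have hj' := Finset.mem_range.1 hj
  have h1 := congrArg (· % (e : ℤ)) this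
  simp only [Int.mul_add_emod_self_left] at h1
  rw [Int.emod_eq_of_lt (by omega) (by omega), Int.emod_eq_of_lt (by omega) (by omega)] at h1
  exact_mod_cast h1

theorem le_natDegree_minpoly [IsSepClosure F Ω] (h : IsUniformizedBy A T E ρ e π) :
    e ≤ (minpoly T (π : Ω)).natDegree := by
  by_contra! hlt
  have hint : IsIntegral T (π : Ω) := Algebra.IsIntegral.isIntegral _
  have h0 := minpoly.aeval T (π : Ω)
  rw [aeval_eq_sum_range' hlt] at h0
  have := h.coeff_eq_zero (c := fun i => (minpoly T (π : Ω)).coeff i) h0 hlt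
  rw [coeff_natDegree, (minpoly.monic hint).leadingCoeff] at this
  exact one_ne_zero this

/-- A linear relation between embeddings over `T` can be checked on `1, π, …, π ^ (e - 1)`. -/
theorem sum_mul_eq_zero (h : IsUniformizedBy A T E ρ e π) (s : Finset (E →ₐ[F] Ω))
    (hs : ∀ σ ∈ s, IsIsometricOver A T σ) {w : (E →ₐ[F] Ω) → Ω}
    (hw : ∀ i < e, ∑ σ ∈ s, w σ * σ π ^ i = 0) (x : E) : ∑ σ ∈ s, w σ * σ x = 0 := by
  rw [← A.eq_zero]
  refine le_antisymm ?_ (A.nonneg _)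
  set C := ∑ σ ∈ s, A (w σ) with hC
  have hC0 : 0 ≤ C := Finset.sum_nonneg fun _ _ => A.nonneg _
  have hn : ∀ n : ℕ, A (∑ σ ∈ s, w σ * σ x) ≤ C * A x * ρ ^ n := by
    intro n
    obtain ⟨c, hc⟩ := h.exists_approx x n
    set z : E := ∑ i ∈ Finset.range e, (⟨c i, h.le (c i).2⟩ : E) * π ^ i with hz
    have hz' : ((x - z : E) : Ω) = x - ∑ i ∈ Finset.range e, (c i : Ω) * (π : Ω) ^ i := by
      rw [hz]
      push_cast
      rfl
    have hz0 : ∑ σ ∈ s, w σ * σ z = 0 := by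
      calc ∑ σ ∈ s, w σ * σ z
          = ∑ σ ∈ s, ∑ i ∈ Finset.range e, (c i : Ω) * (w σ * σ π ^ i) := by
            refine Finset.sum_congr rfl fun σ hσ => ?_
            rw [hz, map_sum, Finset.mul_sum]
            refine Finset.sum_congr rfl fun i _ => ?_
            rw [map_mul, map_pow, (hs σ hσ).apply_base _ (c i).2]
            ring
        _ = 0 := by
            rw [Finset.sum_comm]
            refine Finset.sum_eq_zero fun i hi => ?_
            rw [← Finset.mul_sum, hw i (Finset.mem_range.1 hi), mul_zero]
    have hx : ∑ σ ∈ s, w σ * σ x = ∑ σ ∈ s, w σ * σ (x - z) := by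
      simp only [map_sub, mul_sub, Finset.sum_sub_distrib, hz0, sub_zero]
    rw [hx]
    have hnn : 0 ≤ A x * ρ ^ n := mul_nonneg (A.nonneg _) (pow_nonneg h.pos.le _)
    refine sum_le_of_forall_le h.nonarch _ _ (by rw [mul_assoc]; exact mul_nonneg hC0 hnn)
      fun σ hσ => ?_
    rw [map_mul, (hs σ hσ).isometry, hz', mul_assoc]
    exact mul_le_mul (Finset.single_le_sum (f := fun σ => A (w σ)) (fun _ _ => A.nonneg _) hσ) hc
      (A.nonneg _) hC0
  have hlim : Filter.Tendsto (fun n : ℕ => C * A x * ρ ^ n) Filter.atTop (nhds 0) := by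
    simpa using (tendsto_pow_atTop_nhds_zero_of_lt_one h.pos.le h.lt_one).const_mul (C * A x)
  exact ge_of_tendsto' hlim hn

theorem algHom_ext (h : IsUniformizedBy A T E ρ e π) {σ τ : E →ₐ[F] Ω}
    (hσ : IsIsometricOver A T σ) (hτ : IsIsometricOver A T τ) (hπ : σ π = τ π) : σ = τ := by
  by_contra hne
  refine hne (AlgHom.ext fun x => ?_)
  have := h.sum_mul_eq_zero {σ, τ} (by simp [hσ, hτ]) (w := fun γ => if γ = σ then 1 else -1)
    (fun i _ => by
      rw [Finset.sum_pair hne]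
      simp [hπ, Ne.symm hne]) x
  rw [Finset.sum_pair hne] at this
  simpa [Ne.symm hne, ← sub_eq_add_neg, sub_eq_zero] using this

theorem card_le (h : IsUniformizedBy A T E ρ e π) (s : Finset (E →ₐ[F] Ω))
    (hs : ∀ σ ∈ s, IsIsometricOver A T σ) : s.card ≤ e := by
  by_contra! hlt
  let M : Matrix (Fin e) s Ω := fun i σ => (σ : E →ₐ[F] Ω) π ^ (i : ℕ)
  have hker := LinearMap.ker_ne_bot_of_finrank_lt (f := M.mulVecLin) (by simpa using hlt)
  obtain ⟨w, hw, hw0⟩ := (Submodule.ne_bot_iff _).1 hker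
  refine hw0 (funext fun σ => ?_)
  have hlin : LinearIndependent Ω (fun σ : s => ((σ : E →ₐ[F] Ω) : E →* Ω) : s → E → Ω) :=
    (linearIndependent_monoidHom E Ω).comp (fun σ : s => (((σ : E →ₐ[F] Ω) : E →+* Ω) : E →* Ω))
      (fun σ τ hστ => Subtype.ext (AlgHom.ext fun x => DFunLike.congr_fun hστ x))
  refine Fintype.linearIndependent_iff.1 hlin w (funext fun x => ?_) σ
  have := h.sum_mul_eq_zero s hs (w := fun σ => if hσ : σ ∈ s then w ⟨σ, hσ⟩ else 0)
    (fun i hi => by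
      have h1 := congrFun (LinearMap.mem_ker.1 hw) ⟨i, hi⟩
      rw [Matrix.mulVecLin_apply] at h1
      rw [← Finset.sum_attach]
      simpa [Matrix.mulVec, dotProduct, M, mul_comm] using h1) x
  rw [← Finset.sum_attach] at this
  simpa using this

theorem exists_base_add (h : IsUniformizedBy A T E ρ e π) {x : E} (hx : A x ≤ 1) :
    ∃ b : E, (b : Ω) ∈ T ∧ ∃ z : E, A z ≤ 1 ∧ x = b + π * z := by
  obtain ⟨b, hbT, hb⟩ := h.exists_residue x hx
  have hb' := h.le_of_lt_one (x := x - ⟨b, h.le hbT⟩) hb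
  have hπ : π ≠ 0 := fun h0 => h.uniformizer_ne_zero (by simp [h0])
  refine ⟨⟨b, h.le hbT⟩, hbT, (x - ⟨b, h.le hbT⟩) / π, ?_, ?_⟩
  · change A (((x - ⟨b, h.le hbT⟩ : E) : Ω) / π) ≤ 1
    rw [map_div₀, h.apply_uniformizer]
    exact (div_le_one h.pos).2 hb'
  · rw [mul_div_cancel₀ _ hπ]
    ring

theorem apply_sub_le (h : IsUniformizedBy A T E ρ e π) {σ : E →ₐ[F] Ω}
    (hσ : IsIsometricOver A T σ) {x : E} (hx : A x ≤ 1) : A (σ x - x) ≤ ρ := by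
  obtain ⟨b, hbT, z, hz, rfl⟩ := h.exists_base_add hx
  have hle : A ((π * z : E) : Ω) ≤ ρ := by
    rw [MulMemClass.coe_mul, map_mul, h.apply_uniformizer]
    exact mul_le_of_le_one_right h.pos.le hz
  rw [map_add, hσ.apply_base b hbT, AddMemClass.coe_add, add_sub_add_left_eq_sub]
  refine (sub_le_max h.nonarch _ _).trans (max_le ?_ hle)
  rw [hσ.isometry]
  exact hle

theorem apply_sub_le_of_uniformizer (h : IsUniformizedBy A T E ρ e π) {σ : E →ₐ[F] Ω}
    (hσ : IsIsometricOver A T σ) {c : ℝ} (hc : ρ ^ 2 ≤ c) (hπ : A (σ π - π) ≤ c) {x : E}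
    (hx : A x ≤ 1) : A (σ x - x) ≤ c := by
  obtain ⟨b, hbT, z, hz, rfl⟩ := h.exists_base_add hx
  have heq : σ (b + π * z) - ((b + π * z : E) : Ω)
      = (σ π - π) * σ z + (π : Ω) * (σ z - z) := by
    rw [map_add, hσ.apply_base b hbT, map_mul]
    push_cast
    ring
  rw [heq]
  refine (h.nonarch _ _).trans (max_le ?_ ?_)
  · rw [map_mul, hσ.isometry]
    exact (mul_le_of_le_one_right (A.nonneg _) hz).trans hπ
  · rw [map_mul, h.apply_uniformizer]
    refine le_trans ?_ hc
    rw [sq]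
    exact mul_le_mul_of_nonneg_left (h.apply_sub_le hσ hz) h.pos.le

theorem finite_setOf_isIsometricOver (h : IsUniformizedBy A T E ρ e π) :
    {σ : E →ₐ[F] Ω | IsIsometricOver A T σ}.Finite := by
  by_contra hinf
  obtain ⟨s, hs, hcard⟩ := Set.Infinite.exists_subset_card_eq hinf (e + 1)
  have := h.card_le s fun σ hσ => hs hσ
  omega

theorem ncard_setOf_isIsometricOver [IsSepClosure F Ω] (h : IsUniformizedBy A T E ρ e π)
    (hinv : ∀ (g : Ω ≃ₐ[F] Ω) (x : Ω), A (g x) = A x) :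
    {σ : E →ₐ[F] Ω | IsIsometricOver A T σ}.ncard = e := by
  have hfin := h.finite_setOf_isIsometricOver
  apply le_antisymm
  · rw [Set.ncard_eq_toFinset_card _ hfin]
    exact h.card_le _ fun σ hσ => by simpa using hσ
  · have : IsSepClosed Ω := IsSepClosure.sep_closed F
    have hsep : (minpoly T (π : Ω)).Separable := Algebra.IsSeparable.isSeparable T (π : Ω)
    have hcard := card_rootSet_eq_natDegree (K := Ω) hsep (IsSepClosed.splits_codomain _ hsep)
    refine h.le_natDegree_minpoly.trans ?_
    rw [← hcard, ← Nat.card_eq_fintype_card]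
    change ((minpoly T (π : Ω)).rootSet Ω).ncard ≤ _
    refine le_trans (Set.ncard_le_ncard ?_ (hfin.image fun σ => σ π))
      (Set.ncard_image_le hfin)
    intro r hr
    obtain ⟨g, hg⟩ := minpoly.exists_algEquiv_of_root' (K := T) (x := r) (y := (π : Ω))
      (Algebra.IsAlgebraic.isAlgebraic _) (aeval_eq_zero_of_mem_rootSet hr)
    refine ⟨(((g.restrictScalars F) : Ω →ₐ[F] Ω)).comp E.val, ⟨?_, ?_⟩, hg⟩
    · intro x hx
      exact g.commutes ⟨x, hx⟩
    · intro x
      exact hinv (g.restrictScalars F) x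

/-- In the tame case an embedding over `T` moving the uniformizer by a small amount is trivial,
once the uniformizer is normalized. -/
theorem eq_val_of_pow_mem (h : IsUniformizedBy A T E ρ e π) (he : A (e : Ω) = 1)
    (hπ : (π : Ω) ^ e ∈ T) {σ : E →ₐ[F] Ω} (hσ : IsIsometricOver A T σ)
    (hlt : A (σ π - π) < ρ) : σ = E.val := by
  have hval : IsIsometricOver A T E.val := ⟨fun _ _ => rfl, fun _ => rfl⟩
  refine h.algHom_ext hσ hval ?_
  have h0 := h.uniformizer_ne_zero
  have hpow : (σ π / π) ^ e = 1 := by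
    rw [div_pow, div_eq_one_iff_eq (pow_ne_zero _ h0), ← map_pow]
    exact hσ.apply_base (π ^ e) (by simpa using hπ)
  have hcoeff : ∀ i, A ((X ^ e - 1 : Polynomial Ω).coeff i) ≤ 1 := by
    intro i
    rw [coeff_sub, coeff_X_pow, coeff_one]
    refine (sub_le_max h.nonarch _ _).trans (max_le ?_ ?_) <;> split_ifs <;> simp
  have h1 := root_unique h.nonarch hcoeff (r := 1) (s := σ π / π) (by simp) (by simp)
    (by simp [hpow]) (by simpa [derivative_X_pow] using he) (by
      rw [div_sub_one h0, map_div₀, h.apply_uniformizer]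
      exact (div_lt_one h.pos).2 hlt)
  exact (div_eq_one_iff_eq h0).1 h1

/-- In the tame case the uniformizer can be normalized so that its `e`-th power lies in `T`. -/
theorem exists_pow_mem [IsSepClosure F Ω] (h : IsUniformizedBy A T E ρ e π)
    (hinv : ∀ (g : Ω ≃ₐ[F] Ω) (x : Ω), A (g x) = A x) (he : A (e : Ω) = 1) :
    ∃ π' : E, IsUniformizedBy A T E ρ e π' ∧ (π' : Ω) ^ e ∈ T := by
  obtain ⟨ϖ, hϖT, hϖ⟩ := h.exists_base_uniformizer
  have hϖ0 : ϖ ≠ 0 := by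
    rw [← A.ne_zero_iff, hϖ]
    exact pow_ne_zero _ h.pos.ne'
  have hu1 : A ((π : Ω) ^ e / ϖ) = 1 := by
    rw [map_div₀, map_pow, h.apply_uniformizer, hϖ, div_self (pow_ne_zero _ h.pos.ne')]
  have huE : (π : Ω) ^ e / ϖ ∈ E := div_mem (pow_mem π.2 _) (h.le hϖT)
  obtain ⟨b, hbT, hb⟩ := h.exists_residue ⟨_, huE⟩ hu1.le
  change A ((π : Ω) ^ e / ϖ - b) < 1 at hb
  have hb1 : A b = 1 := by
    rw [← hu1]
    refine eq_of_sub_lt h.nonarch ?_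
    rwa [AbsoluteValue.map_sub, hu1]
  have hb0 : b ≠ 0 := by
    rw [← A.ne_zero_iff, hb1]
    exact one_ne_zero
  set y : E := ⟨(π : Ω) ^ e / ϖ / b, div_mem huE (h.le hbT)⟩ with hy
  have hy1 : A (y : Ω) = 1 := by
    change A ((π : Ω) ^ e / ϖ / b) = 1
    rw [map_div₀, hu1, hb1, div_one]
  have hyb : A (1 - (y : Ω)) < 1 := by
    change A (1 - (π : Ω) ^ e / ϖ / b) < 1
    rw [one_sub_div hb0, map_div₀, hb1, div_one, AbsoluteValue.map_sub]
    exact hb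
  have heΩ : (e : Ω) ≠ 0 := by
    rw [← A.ne_zero_iff, he]
    exact one_ne_zero
  have heE : (e : E) ≠ 0 := fun h0 => heΩ (by simpa using congrArg (algebraMap E Ω) h0)
  have hy0 : y ≠ 0 := by
    intro h0
    simp [h0] at hy1
  obtain ⟨r, hrE, hr, hr1, -, -⟩ := exists_root_mem h.nonarch hinv E
    (h := X ^ e - C y) (monic_X_pow_sub_C y h.index_pos.ne') (separable_X_pow_sub_C y heE hy0)
    (fun i => by
      rw [coeff_sub, coeff_X_pow, coeff_C]
      refine (sub_le_max h.nonarch (if i = e then (1 : E) else 0 : E)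
        (if i = 0 then y else 0 : E)).trans (max_le ?_ ?_) <;> split_ifs <;> simp [hy1])
    (x := 1) (one_mem E) (by simp) (by simpa using hyb)
    (by simpa [derivative_X_pow] using he)
  have hAr : A r = 1 := by
    rw [← A.map_one]
    exact eq_of_sub_lt h.nonarch (by simpa using hr1)
  have hr0 : r ≠ 0 := by
    rw [← A.ne_zero_iff, hAr]
    exact one_ne_zero
  have hre : r ^ e = (π : Ω) ^ e / ϖ / b := by
    simpa [sub_eq_zero, hy] using hr
  refine ⟨⟨π / r, div_mem π.2 hrE⟩, { h with apply_uniformizer := ?_ }, ?_⟩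
  · change A ((π : Ω) / r) = ρ
    rw [map_div₀, h.apply_uniformizer, hAr, div_one]
  · change ((π : Ω) / r) ^ e ∈ T
    have : ((π : Ω) / r) ^ e = ϖ * b := by
      rw [div_pow, hre]
      field_simp [h.uniformizer_ne_zero]
    rw [this]
    exact mul_mem hϖT hbT

end IsUniformizedBy

/-- Every embedding of a subextension of a separable closure extends to an automorphism. -/
theorem exists_algEquiv_extending [IsSepClosure F Ω] {E : IntermediateField F Ω}
    (σ : E →ₐ[F] Ω) : ∃ g : Ω ≃ₐ[F] Ω, ∀ x : E, g x = σ x := by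
  have : IsGalois F Ω := IsSepClosure.isGalois
  have : Normal F Ω := inferInstance
  exact ⟨AlgEquiv.ofBijective (σ.liftNormal Ω) (AlgHom.normal_bijective F Ω Ω _),
    fun x => σ.liftNormal_commutes Ω x⟩

namespace IsUniformizedBy

variable {T E : IntermediateField F Ω} {ρ : ℝ} {e : ℕ} {π : E}

theorem apply_div_pow_sub_one_lt (h : IsUniformizedBy A T E ρ e π) {σ : E →ₐ[F] Ω}
    (hσ : IsIsometricOver A T σ) : A ((σ π / π) ^ e - 1) < 1 := by
  obtain ⟨ϖ, hϖT, hϖ⟩ := h.exists_base_uniformizer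
  have hπ0 := h.uniformizer_ne_zero
  have hϖ0 : ϖ ≠ 0 := by
    rw [← A.ne_zero_iff, hϖ]
    exact pow_ne_zero _ h.pos.ne'
  set u : E := π ^ e / ⟨ϖ, h.le hϖT⟩ with hu
  have hu' : (u : Ω) = (π : Ω) ^ e / ϖ := rfl
  have hu1 : A u = 1 := by
    rw [hu', map_div₀, map_pow, h.apply_uniformizer, hϖ, div_self (pow_ne_zero _ h.pos.ne')]
  have hσu : σ u = σ π ^ e / ϖ := by
    rw [hu, map_div₀, map_pow, hσ.apply_base ⟨ϖ, h.le hϖT⟩ hϖT]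
  have hu0 : (u : Ω) ≠ 0 := by
    rw [← A.ne_zero_iff, hu1]
    exact one_ne_zero
  have heq : (σ π / π) ^ e - 1 = (σ u - u) / u := by
    rw [hσu, hu']
    field_simp
    rw [sub_mul, ← mul_pow, div_mul_cancel₀ _ hπ0, one_mul]
  rw [heq, map_div₀, hu1, div_one]
  exact (h.apply_sub_le hσ hu1.le).trans_lt h.lt_one

/-- In the wild case some nontrivial embedding over `T` moves the uniformizer only slightly. -/
theorem exists_ne_val [IsSepClosure F Ω] (h : IsUniformizedBy A T E ρ e π)
    (hinv : ∀ (g : Ω ≃ₐ[F] Ω) (x : Ω), A (g x) = A x) {p : ℕ} (hp : p.Prime) (hpe : p ∣ e)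
    (hAp : A (p : Ω) < 1) :
    ∃ σ : E →ₐ[F] Ω, IsIsometricOver A T σ ∧ σ ≠ E.val ∧ A (σ π - π) < ρ := by
  have hπ0 := h.uniformizer_ne_zero
  have hfin := h.finite_setOf_isIsometricOver
  obtain ⟨m, rfl⟩ := hpe
  have hm : 0 < m := Nat.pos_of_mul_pos_left h.index_pos
  let κ := IsLocalRing.ResidueField (integers h.nonarch)
  have hpκ : (p : κ) = 0 := by
    rw [← map_natCast (IsLocalRing.residue (integers h.nonarch)), residue_eq_zero_iff]
    exact hAp
  have : CharP κ p := (CharP.charP_iff_prime_eq_zero hp).2 hpκ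
  have : Fact p.Prime := ⟨hp⟩
  have hone : ∀ σ : E →ₐ[F] Ω, IsIsometricOver A T σ → A (σ π / π) = 1 := by
    intro σ hσ
    rw [map_div₀, hσ.isometry, div_self (A.ne_zero hπ0)]
  let f : (E →ₐ[F] Ω) → κ := fun σ => if hσ : IsIsometricOver A T σ then
    IsLocalRing.residue (integers h.nonarch) ⟨σ π / π, (hone σ hσ).le⟩ else 0
  have hf : ∀ σ, IsIsometricOver A T σ → f σ ^ m = 1 := by
    intro σ hσ
    apply frobenius_inj κ p
    rw [frobenius_def, frobenius_def, one_pow, ← pow_mul, mul_comm m p, ← sub_eq_zero]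
    simp only [f, dif_pos hσ]
    rw [← map_pow, ← map_one (IsLocalRing.residue (integers h.nonarch)), ← map_sub,
      residue_eq_zero_iff]
    exact h.apply_div_pow_sub_one_lt hσ
  obtain ⟨σ, hσ, τ, hτ, hne, hfστ⟩ := Finset.exists_ne_map_eq_of_card_lt_of_maps_to
    (s := hfin.toFinset) (t := nthRootsFinset m (1 : κ)) (f := f)
    (by
      rw [← Set.ncard_eq_toFinset_card _ hfin, h.ncard_setOf_isIsometricOver hinv, nthRootsFinset_def]
      calc _ ≤ _ := Multiset.toFinset_card_le _
        _ ≤ m := card_nthRoots _ _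
        _ < p * m := lt_mul_of_one_lt_left hm hp.one_lt)
    (fun σ hσ => by
      rw [Finset.mem_coe, mem_nthRootsFinset hm]
      exact hf σ (by simpa using hσ))
  rw [Set.Finite.mem_toFinset] at hσ hτ
  change IsIsometricOver A T σ at hσ
  change IsIsometricOver A T τ at hτ
  have hlt : A (σ π - τ π) < ρ := by
    simp only [f, dif_pos hσ, dif_pos hτ] at hfστ
    rw [← sub_eq_zero, ← map_sub, residue_eq_zero_iff] at hfστ
    change A (σ π / π - τ π / π) < 1 at hfστ
    rw [← sub_div, map_div₀, h.apply_uniformizer] at hfστ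
    exact (div_lt_one h.pos).1 hfστ
  obtain ⟨g, hg⟩ := exists_algEquiv_extending τ
  refine ⟨(g.symm : Ω →ₐ[F] Ω).comp σ, ⟨fun x hx => ?_, fun x => ?_⟩, fun hval => hne ?_, ?_⟩
  · change g.symm (σ x) = x
    rw [hσ.apply_base x hx, AlgEquiv.symm_apply_eq, hg, hτ.apply_base x hx]
  · change A (g.symm (σ x)) = A x
    rw [hinv, hσ.isometry]
  · refine AlgHom.ext fun x => ?_
    have := DFunLike.congr_fun hval x
    change g.symm (σ x) = x at this
    rw [← hg, ← this, AlgEquiv.apply_symm_apply]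
  · change A (g.symm (σ π) - π) < ρ
    rwa [← hinv g, map_sub, AlgEquiv.apply_symm_apply, hg]

end IsUniformizedBy

end HenselianRamification

namespace HenselianRamification

section Integral

open intervalIntegral

variable {N : ℝ → ℕ}

theorem intervalIntegrable_of_antitoneOn (hN : AntitoneOn N (Set.Ici 0)) {a b : ℝ} (ha : 0 ≤ a)
    (hb : 0 ≤ b) : IntervalIntegrable (fun t => (N t : ℝ)) MeasureTheory.volume a b := by
  refine AntitoneOn.intervalIntegrable fun x hx y hy hxy => ?_
  have h0 : ∀ z ∈ Set.uIcc a b, z ∈ Set.Ici (0 : ℝ) := fun z hz => (le_inf ha hb).trans hz.1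
  exact_mod_cast hN (h0 x hx) (h0 y hy) hxy

theorem le_integral_of_antitoneOn (hN : AntitoneOn N (Set.Ici 0)) {a b : ℝ} {c : ℕ} (ha : 0 ≤ a)
    (hab : a ≤ b) (hc : ∀ t ∈ Set.Icc a b, c ≤ N t) : c * (b - a) ≤ ∫ t in a..b, (N t : ℝ) := by
  have h := integral_mono_on (f := fun _ => (c : ℝ)) hab intervalIntegrable_const
    (intervalIntegrable_of_antitoneOn hN ha (ha.trans hab)) fun t ht => by exact_mod_cast hc t ht
  rw [intervalIntegral.integral_const, smul_eq_mul] at h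
  linarith

theorem integral_le_of_antitoneOn (hN : AntitoneOn N (Set.Ici 0)) {s : ℝ} (hs : 0 ≤ s) :
    ∫ t in (0 : ℝ)..s, (N t : ℝ) ≤ N 0 * s := by
  have h := integral_mono_on (g := fun _ => (N 0 : ℝ)) hs
    (intervalIntegrable_of_antitoneOn hN le_rfl hs) intervalIntegrable_const fun t ht => by
      exact_mod_cast hN (Set.mem_Ici.2 le_rfl) ht.1 ht.1
  rw [intervalIntegral.integral_const, smul_eq_mul] at h
  linarith

theorem lt_integral_of_antitoneOn (hN : AntitoneOn N (Set.Ici 0)) (hN1 : ∀ t, 0 ≤ t → 1 ≤ N t)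
    {s t₀ : ℝ} (hs : 0 < s) (ht₀ : 0 < t₀) (h2 : 2 ≤ N t₀) :
    s < ∫ t in (0 : ℝ)..s, (N t : ℝ) := by
  set m := min t₀ s with hm
  have hm0 : 0 < m := lt_min ht₀ hs
  have hms : m ≤ s := min_le_right _ _
  rw [← integral_add_adjacent_intervals (intervalIntegrable_of_antitoneOn hN le_rfl hm0.le)
    (intervalIntegrable_of_antitoneOn hN hm0.le hs.le)]
  have h3 := le_integral_of_antitoneOn (c := 2) hN le_rfl hm0.le fun t ht =>
    h2.trans (hN ht.1 ht₀.le (ht.2.trans (min_le_left _ _)))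
  have h4 := le_integral_of_antitoneOn (c := 1) hN hm0.le hms fun t ht =>
    hN1 t (hm0.le.trans ht.1)
  push_cast at h3 h4
  linarith

theorem integral_eq_of_eq_one {s : ℝ} (hs : 0 ≤ s) (h1 : ∀ t, 0 < t → N t = 1) :
    ∫ t in (0 : ℝ)..s, (N t : ℝ) = s := by
  rw [integral_congr_ae (g := fun _ => (1 : ℝ))]
  · simp
  · filter_upwards with t ht
    rw [Set.uIoc_of_le hs] at ht
    simp [h1 t ht.1]

end Integral

end HenselianRamification

namespace AddVal

variable {Ω : Type*} [Field Ω] (V : AddVal Ω)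

theorem exists_real {x : Ω} (hx : x ≠ 0) : ∃ r : ℝ, V.v x = r :=
  (WithTop.ne_top_iff_exists.1 (V.v_ne_top x hx)).imp fun _ h => h.symm

/-- The multiplicative absolute value attached to an additive valuation. -/
def absFun (x : Ω) : ℝ :=
  if x = 0 then 0 else Real.exp (-(V.v x).untopD 0)

theorem absFun_zero : V.absFun 0 = 0 := if_pos rfl

theorem absFun_eq_exp {x : Ω} {r : ℝ} (h : V.v x = r) : V.absFun x = Real.exp (-r) := by
  have hx : x ≠ 0 := by
    rintro rfl
    rw [V.v_zero] at h
    exact WithTop.top_ne_coe h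
  rw [absFun, if_neg hx, h, WithTop.untopD_coe]

theorem absFun_nonneg (x : Ω) : 0 ≤ V.absFun x := by
  rw [absFun]
  split_ifs
  · exact le_rfl
  · exact (Real.exp_pos _).le

theorem le_v_iff {x : Ω} {r : ℝ} : (r : WithTop ℝ) ≤ V.v x ↔ V.absFun x ≤ Real.exp (-r) := by
  by_cases hx : x = 0
  · simp [hx, V.v_zero, V.absFun_zero, (Real.exp_pos _).le]
  · obtain ⟨s, hs⟩ := V.exists_real hx
    rw [V.absFun_eq_exp hs, hs, WithTop.coe_le_coe, Real.exp_le_exp, neg_le_neg_iff]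

theorem lt_v_iff {x : Ω} {r : ℝ} : (r : WithTop ℝ) < V.v x ↔ V.absFun x < Real.exp (-r) := by
  by_cases hx : x = 0
  · simp [hx, V.v_zero, V.absFun_zero, Real.exp_pos _]
  · obtain ⟨s, hs⟩ := V.exists_real hx
    rw [V.absFun_eq_exp hs, hs, WithTop.coe_lt_coe, Real.exp_lt_exp, neg_lt_neg_iff]

theorem absFun_add_le_max (x y : Ω) : V.absFun (x + y) ≤ max (V.absFun x) (V.absFun y) := by
  by_cases hx : x = 0
  · simp [hx]
  by_cases hy : y = 0
  · simp [hy]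
  obtain ⟨r, hr⟩ := V.exists_real hx
  obtain ⟨s, hs⟩ := V.exists_real hy
  have h := V.v_min_le_add x y
  rw [hr, hs, min_le_iff, V.le_v_iff, V.le_v_iff] at h
  rw [V.absFun_eq_exp hr, V.absFun_eq_exp hs]
  exact le_max_iff.2 h

/-- The multiplicative absolute value attached to an additive valuation, bundled. -/
def toAbs : AbsoluteValue Ω ℝ where
  toFun := V.absFun
  map_mul' x y := by
    by_cases hx : x = 0
    · simp [hx, V.absFun_zero]
    by_cases hy : y = 0
    · simp [hy, V.absFun_zero]
    obtain ⟨r, hr⟩ := V.exists_real hx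
    obtain ⟨s, hs⟩ := V.exists_real hy
    rw [V.absFun_eq_exp hr, V.absFun_eq_exp hs, V.absFun_eq_exp (r := r + s), neg_add, Real.exp_add]
    rw [V.v_mul, hr, hs, WithTop.coe_add]
  nonneg' := V.absFun_nonneg
  eq_zero' x := by
    refine ⟨fun h => ?_, fun h => h ▸ V.absFun_zero⟩
    by_contra hx
    obtain ⟨r, hr⟩ := V.exists_real hx
    rw [V.absFun_eq_exp hr] at h
    exact (Real.exp_pos _).ne' h
  add_le' x y := (V.absFun_add_le_max x y).trans
    (max_le_add_of_nonneg (V.absFun_nonneg x) (V.absFun_nonneg y))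

theorem isNonarchimedean_toAbs : IsNonarchimedean V.toAbs :=
  V.absFun_add_le_max

theorem toAbs_eq_exp {x : Ω} {r : ℝ} (h : V.v x = r) : V.toAbs x = Real.exp (-r) :=
  V.absFun_eq_exp h

theorem le_v_iff_toAbs_le {x : Ω} {r : ℝ} :
    (r : WithTop ℝ) ≤ V.v x ↔ V.toAbs x ≤ Real.exp (-r) :=
  V.le_v_iff

theorem v_nonneg_iff {x : Ω} : 0 ≤ V.v x ↔ V.toAbs x ≤ 1 := by
  rw [← WithTop.coe_zero, V.le_v_iff_toAbs_le, neg_zero, Real.exp_zero]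

theorem v_pos_iff {x : Ω} : 0 < V.v x ↔ V.toAbs x < 1 := by
  rw [← WithTop.coe_zero, V.lt_v_iff, neg_zero, Real.exp_zero]
  rfl

theorem v_eq_zero_iff {x : Ω} : V.v x = 0 ↔ V.toAbs x = 1 := by
  have h := V.v_nonneg_iff (x := x)
  have h' := V.v_pos_iff (x := x)
  constructor
  · intro h0
    exact le_antisymm (h.1 h0.ge) (not_lt.1 fun hlt => (h'.2 hlt).ne' h0)
  · intro h0
    exact le_antisymm (not_lt.1 fun hlt => (h'.1 hlt).ne h0) (h.2 h0.le)

end AddVal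

namespace HenselianRamification

open IntermediateField

theorem apply_natCast_eq_one {Ω : Type*} [Field Ω] {A : AbsoluteValue Ω ℝ} {n : ℕ} (hn : n ≠ 0)
    (h : ∀ p : ℕ, p.Prime → p ∣ n → A (p : Ω) = 1) : A (n : Ω) = 1 := by
  induction n using induction_on_primes with
  | zero => exact absurd rfl hn
  | one => simp
  | prime_mul p a hp ih =>
    rw [Nat.cast_mul, map_mul, h p hp (dvd_mul_right p a), one_mul]
    exact ih (right_ne_zero_of_mul hn) fun q hq hqa => h q hq (hqa.mul_left p)

variable {F Ω : Type*} [Field F] [Field Ω] [Algebra F Ω]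

theorem xiRel_val_iff {V : AddVal Ω} {E : IntermediateField F Ω} {e : ℕ} {r : ℝ}
    {σ : E →ₐ[F] Ω} : xiRel V E e r σ E.val ↔
      ∀ x : E, V.toAbs x ≤ 1 → V.toAbs (σ x - x) ≤ Real.exp (-((r + 1) / e)) := by
  unfold xiRel
  simp only [V.le_v_iff_toAbs_le, V.v_nonneg_iff, coe_val]

theorem hasSimpleRoots_toAbs {V : AddVal Ω} (h : V.IsHenselianOn F) :
    HasSimpleRoots F V.toAbs := by
  intro f hf a₀ ha₀ hfa hfa'
  obtain ⟨a, ha, -⟩ := h f (fun i => V.v_nonneg_iff.2 (hf i)) a₀ (V.v_nonneg_iff.2 ha₀)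
    (V.v_pos_iff.2 hfa) (V.v_eq_zero_iff.2 hfa')
  exact ⟨a, ha⟩

theorem toAbs_algEquiv [IsSepClosure F Ω] {V : AddVal Ω} (hnorm : V.IsNormalizedOn F)
    (hhens : V.IsHenselianOn F) (g : Ω ≃ₐ[F] Ω) (x : Ω) : V.toAbs (g x) = V.toAbs x := by
  have : IsGalois F Ω := IsSepClosure.isGalois
  obtain ⟨ϖ, hϖ⟩ := hnorm.2
  have hA := V.toAbs_eq_exp hϖ
  refine apply_algEquiv V.isNonarchimedean_toAbs (hasSimpleRoots_toAbs hhens) (ϖ := ϖ) ?_ ?_ g x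
  · rintro rfl
    rw [map_zero, map_zero] at hA
    exact (Real.exp_pos _).ne hA
  · rw [hA, Real.exp_lt_one_iff]
    norm_num

/-- The field `E` is totally ramified over a subfield `T` cut out by the inertial embeddings. -/
theorem exists_isUniformizedBy [IsSepClosure F Ω] {V : AddVal Ω} (hnorm : V.IsNormalizedOn F)
    (hhens : V.IsHenselianOn F) (hperf : V.HasPerfectResidueFieldOn F)
    {E : IntermediateField F Ω} {e : ℕ} (he : V.IsRamIdx E e) :
    ∃ (T : IntermediateField F Ω) (π : E),
      IsUniformizedBy V.toAbs T E (Real.exp (-(1 / e))) e π ∧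
      ∀ σ : E →ₐ[F] Ω, xiRel V E e 0 σ E.val ↔ IsIsometricOver V.toAbs T σ := by
  have hinv := toAbs_algEquiv hnorm hhens
  obtain ⟨he0, hval, π, hπ⟩ := he
  have he0' : (0 : ℝ) < e := by exact_mod_cast he0
  have hρ1 : Real.exp (-(1 / e)) < 1 := by
    rw [Real.exp_lt_one_iff, neg_lt_zero]
    positivity
  have hpow : Real.exp (-(1 / e)) ^ e = Real.exp (-1) := by
    rw [← Real.exp_nat_mul]
    congr 1
    field_simp
  obtain ⟨T, hTE, hfix, hTval, hres⟩ := exists_unramified_subextension (A := V.toAbs)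
    V.isNonarchimedean_toAbs hinv
    (fun p hp hp1 x hx => by
      obtain ⟨y, hy, hxy⟩ := hperf p hp (V.v_pos_iff.2 (by simpa using hp1)) x
        (V.v_nonneg_iff.2 hx)
      exact ⟨y, V.v_nonneg_iff.1 hy, V.v_pos_iff.1 hxy⟩) E
    (S := {γ | ∀ x ∈ E, V.toAbs x ≤ 1 → V.toAbs (γ x - x) ≤ Real.exp (-(1 / e))})
    (fun γ hγ x hxE hx => (hγ x hxE hx).trans_lt hρ1)
  have hU : IsUniformizedBy V.toAbs T E (Real.exp (-(1 / e))) e π :=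
    { nonarch := V.isNonarchimedean_toAbs
      le := hTE
      pos := Real.exp_pos _
      lt_one := hρ1
      index_pos := he0
      apply_uniformizer := V.toAbs_eq_exp hπ
      apply_mem := fun x hx => by
        obtain ⟨k, hk⟩ := hval x hx
        refine ⟨k, ?_⟩
        rw [V.toAbs_eq_exp hk, ← Real.rpow_intCast, ← Real.exp_mul]
        congr 1
        ring
      apply_mem_base := fun x hx hx0 => by
        obtain ⟨c, hc0, hc⟩ := hTval x hx hx0
        obtain ⟨k, hk⟩ := hnorm.1 c hc0
        refine ⟨k, ?_⟩
        rw [hc, V.toAbs_eq_exp hk, hpow, ← Real.rpow_intCast, ← Real.exp_mul]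
        congr 1
        ring
      exists_base_uniformizer := by
        obtain ⟨ϖ, hϖ⟩ := hnorm.2
        exact ⟨_, T.algebraMap_mem ϖ, by rw [V.toAbs_eq_exp hϖ, hpow]⟩
      exists_residue := fun x hx => hres x x.2 hx }
  refine ⟨T, π, hU, fun σ => ?_⟩
  rw [xiRel_val_iff, zero_add]
  refine ⟨fun h => ?_, fun h x hx => hU.apply_sub_le h hx⟩
  obtain ⟨g, hg⟩ := exists_algEquiv_extending σ
  refine ⟨fun x hx => ?_, fun x => by rw [← hg, hinv]⟩
  rw [← hg]
  refine hfix g (fun y hyE hy => ?_) x hx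
  have := hg ⟨y, hyE⟩
  rw [show g y = σ ⟨y, hyE⟩ from this]
  exact h ⟨y, hyE⟩ hy

section Counting

variable {V : AddVal Ω} {E : IntermediateField F Ω} {e : ℕ} {T : IntermediateField F Ω} {π : E}

theorem xiRel.mono {r s : ℝ} (hrs : r ≤ s) {σ τ : E →ₐ[F] Ω} (h : xiRel V E e s σ τ) :
    xiRel V E e r σ τ := fun x hx => (WithTop.coe_le_coe.2 (by gcongr)).trans (h x hx)

theorem xiRel_refl {r : ℝ} (σ : E →ₐ[F] Ω) : xiRel V E e r σ σ := fun x _ => by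
  rw [sub_self, V.v_zero]
  exact le_top

theorem gfun_eq_ncard (t : ℝ) : gfun V E e t = {σ | xiRel V E e t σ E.val}.ncard :=
  rfl

theorem finite_setOf_xiRel (h : IsUniformizedBy V.toAbs T E (Real.exp (-(1 / e))) e π)
    (hT : ∀ σ : E →ₐ[F] Ω, xiRel V E e 0 σ E.val ↔ IsIsometricOver V.toAbs T σ) {t : ℝ}
    (ht : 0 ≤ t) : {σ | xiRel V E e t σ E.val}.Finite :=
  h.finite_setOf_isIsometricOver.subset fun σ hσ => (hT σ).1 (xiRel.mono ht hσ)

theorem gfun_zero [IsSepClosure F Ω] (hinv : ∀ (g : Ω ≃ₐ[F] Ω) x, V.toAbs (g x) = V.toAbs x)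
    (h : IsUniformizedBy V.toAbs T E (Real.exp (-(1 / e))) e π)
    (hT : ∀ σ : E →ₐ[F] Ω, xiRel V E e 0 σ E.val ↔ IsIsometricOver V.toAbs T σ) :
    gfun V E e 0 = e := by
  simp only [gfun_eq_ncard, hT]
  exact h.ncard_setOf_isIsometricOver hinv

theorem gfun_antitoneOn (h : IsUniformizedBy V.toAbs T E (Real.exp (-(1 / e))) e π)
    (hT : ∀ σ : E →ₐ[F] Ω, xiRel V E e 0 σ E.val ↔ IsIsometricOver V.toAbs T σ) :
    AntitoneOn (gfun V E e) (Set.Ici 0) := fun _ hs _ _ hst =>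
  Set.ncard_le_ncard (fun _ hσ => xiRel.mono hst hσ) (finite_setOf_xiRel h hT hs)

theorem one_le_gfun (h : IsUniformizedBy V.toAbs T E (Real.exp (-(1 / e))) e π)
    (hT : ∀ σ : E →ₐ[F] Ω, xiRel V E e 0 σ E.val ↔ IsIsometricOver V.toAbs T σ) (t : ℝ)
    (ht : 0 ≤ t) : 1 ≤ gfun V E e t :=
  (Set.ncard_pos (finite_setOf_xiRel h hT ht)).2 ⟨E.val, xiRel_refl _⟩

theorem gfun_eq_one_of_tame [IsSepClosure F Ω]
    (hinv : ∀ (g : Ω ≃ₐ[F] Ω) x, V.toAbs (g x) = V.toAbs x)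
    (h : IsUniformizedBy V.toAbs T E (Real.exp (-(1 / e))) e π)
    (hT : ∀ σ : E →ₐ[F] Ω, xiRel V E e 0 σ E.val ↔ IsIsometricOver V.toAbs T σ)
    (he : V.toAbs (e : Ω) = 1) {t : ℝ} (ht : 0 < t) : gfun V E e t = 1 := by
  obtain ⟨π', h', hπ'⟩ := h.exists_pow_mem hinv he
  rw [gfun_eq_ncard, Set.ncard_eq_one]
  refine ⟨E.val, Set.eq_singleton_iff_unique_mem.2 ⟨xiRel_refl _, fun σ hσ => ?_⟩⟩
  refine h'.eq_val_of_pow_mem he hπ' ((hT σ).1 (xiRel.mono ht.le hσ)) ?_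
  refine (xiRel_val_iff.1 hσ π' (h'.apply_uniformizer.trans_le h.lt_one.le)).trans_lt ?_
  have he0 : (0 : ℝ) < e := by exact_mod_cast h.index_pos
  rw [Real.exp_lt_exp, neg_lt_neg_iff]
  gcongr
  linarith

theorem exists_two_le_gfun_of_wild [IsSepClosure F Ω]
    (hinv : ∀ (g : Ω ≃ₐ[F] Ω) x, V.toAbs (g x) = V.toAbs x)
    (h : IsUniformizedBy V.toAbs T E (Real.exp (-(1 / e))) e π)
    (hT : ∀ σ : E →ₐ[F] Ω, xiRel V E e 0 σ E.val ↔ IsIsometricOver V.toAbs T σ)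
    {p : ℕ} (hp : p.Prime) (hpe : p ∣ e) (hAp : V.toAbs (p : Ω) < 1) :
    ∃ t : ℝ, 0 < t ∧ 2 ≤ gfun V E e t := by
  obtain ⟨σ, hσ, hne, hlt⟩ := h.exists_ne_val hinv hp hpe hAp
  have he0 : (0 : ℝ) < e := by exact_mod_cast h.index_pos
  set ρ := Real.exp (-(1 / e)) with hρ
  set c := max (V.toAbs (σ π - π)) (ρ ^ 2) with hc
  have hρc : ρ ^ 2 ≤ c := le_max_right _ _
  have hc0 : 0 < c := (pow_pos h.pos 2).trans_le hρc
  have hcρ : c < ρ := max_lt hlt (by nlinarith [h.pos, h.lt_one])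
  have hlog : Real.log c < -(1 / e) := by
    rwa [Real.log_lt_iff_lt_exp hc0]
  set t : ℝ := -(e * Real.log c) - 1 with ht
  have ht0 : 0 < t := by
    have := mul_lt_mul_of_pos_left hlog he0
    rw [mul_neg, mul_one_div_cancel he0.ne'] at this
    linarith
  have hexp : Real.exp (-((t + 1) / e)) = c := by
    rw [ht, sub_add_cancel, neg_div, neg_neg, mul_div_cancel_left₀ _ he0.ne', Real.exp_log hc0]
  refine ⟨t, ht0, ?_⟩
  have hσt : xiRel V E e t σ E.val := by
    rw [xiRel_val_iff, hexp]
    exact fun x hx => h.apply_sub_le_of_uniformizer hσ hρc (le_max_left _ _) hx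
  rw [gfun_eq_ncard, ← Set.ncard_pair hne]
  refine Set.ncard_le_ncard ?_ (finite_setOf_xiRel h hT ht0.le)
  rintro τ (rfl | rfl)
  · exact hσt
  · exact xiRel_refl _

end Counting

end HenselianRamification

open HenselianRamification

/-- Let `l` be a positive integer and `E/F` a finitely ramified,
at most `l`-ramified separable extension.  Then `l ≤ ψ_{E/F}(l) ≤ l·e(E/F)`, with
equality `ψ_{E/F}(l) = l·e(E/F)` if and only if `E/F` is tamely ramified (the residue
characteristic of `F` does not divide `e(E/F)`). -/
theorem psi_bounds_and_tame_iff
    {F Ω : Type*} [Field F] [Field Ω] [Algebra F Ω] [IsSepClosure F Ω]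
    (V : AddVal Ω) (hnorm : V.IsNormalizedOn F) (hhens : V.IsHenselianOn F)
    (hperf : V.HasPerfectResidueFieldOn F)
    (E : IntermediateField F Ω) (e : ℕ) (he : V.IsRamIdx E e)
    (l : ℕ) (hl : 0 < l) (hram : atMostRamified V E (l : ℝ)) :
    ∀ s : ℝ, 0 ≤ s → herbrand V E e s = (l : ℝ) →
      (l : ℝ) ≤ s ∧ s ≤ (l : ℝ) * (e : ℝ) ∧
        (s = (l : ℝ) * (e : ℝ) ↔
          ∀ p : ℕ, p.Prime → 0 < V.v (algebraMap F Ω (p : F)) → ¬ p ∣ e) := by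
  intro s hs hls
  have hinv := toAbs_algEquiv hnorm hhens
  obtain ⟨T, π, h, hT⟩ := exists_isUniformizedBy hnorm hhens hperf he
  have he0 : (0 : ℝ) < e := by exact_mod_cast he.1
  have hl0 : (0 : ℝ) < l := by exact_mod_cast hl
  have h0 := gfun_zero hinv h hT
  have hanti := gfun_antitoneOn h hT
  have hone := one_le_gfun h hT
  have hint : ∫ t in (0 : ℝ)..s, (gfun V E e t : ℝ) = l * e := by
    rw [herbrand, intervalIntegral.integral_div, h0, div_eq_iff he0.ne'] at hls
    exact hls
  have hs0 : 0 < s := by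
    refine hs.lt_of_ne fun hs0 => ?_
    rw [← hs0, intervalIntegral.integral_same] at hint
    exact (mul_pos hl0 he0).ne hint
  refine ⟨?_, ?_, fun hse p hp hp1 hpe => ?_, fun htame => ?_⟩
  · have := integral_le_of_antitoneOn hanti hs
    rw [hint, h0, mul_comm] at this
    exact le_of_mul_le_mul_left this he0
  · have := le_integral_of_antitoneOn (c := 1) hanti le_rfl hs fun t ht => hone t ht.1
    rw [hint] at this
    simpa using this
  · rw [map_natCast, V.v_pos_iff] at hp1
    obtain ⟨t, ht, h2⟩ := exists_two_le_gfun_of_wild hinv h hT hp hpe hp1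
    have := lt_integral_of_antitoneOn hanti hone hs0 ht h2
    rw [hint] at this
    exact this.ne hse
  · have hAe : V.toAbs (e : Ω) = 1 := apply_natCast_eq_one he.1.ne' fun p hp hpe => by
      refine le_antisymm (V.isNonarchimedean_toAbs.apply_natCast_le_one) (not_lt.1 fun hlt => ?_)
      exact htame p hp (by rwa [map_natCast, V.v_pos_iff]) hpe
    rw [← hint, integral_eq_of_eq_one hs fun t ht => gfun_eq_one_of_tame hinv h hT hAe ht]
end
end
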